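/- arXiv:2309.11885 — 3 statements merged into one kernel-verified Lean document; each statement's English description precedes it below -/
import Mathlib

section
/- Let T be a nontrivial k-tree and let C_1, C_2 be adjacent k-cliques of T (i.e., both contained in a common (k+1)-clique). Let c_2 be the unique vertex in V(C_2)∖V(C_1). Then the characteristic 1-tree T'_{C_2} is isomorphic to the tree obtained from T'_{C_1} by a partial Kelmans operation from the vertex c_2 to the vertex C_1. -/
open Finset Polynomial

variable {V : Type*}

/-- The vertex sets of the subtrees of `G` that lie inside the set `S` and contain
the vertex `w` : nonempty connected induced subgraphs. -/
noncomputable def subtreesIn [Fintype V] [DecidableEq V] (G : SimpleGraph V) (S : Set V)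
    (w : V) : Finset (Finset V) := by
  classical
  exact Finset.univ.filter fun A => w ∈ A ∧ (A : Set V) ⊆ S ∧ (G.induce (A : Set V)).Connected

/-- The vertex sets of the subtrees of `G` containing `w`. -/
noncomputable def subtrees [Fintype V] [DecidableEq V] (G : SimpleGraph V) (w : V) :
    Finset (Finset V) := subtreesIn G Set.univ w

/-- The generating polynomial `φ_{T,w}` of subtrees of `G` inside `S` containing `w`,
counted by order. -/
noncomputable def subtreePolyIn [Fintype V] [DecidableEq V] (G : SimpleGraph V) (S : Set V)
    (w : V) : Polynomial ℝ := ∑ A ∈ subtreesIn G S w, X ^ A.card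

/-- The generating polynomial `φ_{T,w}` of subtrees of `G` containing `w`. -/
noncomputable def subtreePoly [Fintype V] [DecidableEq V] (G : SimpleGraph V) (w : V) :
    Polynomial ℝ := subtreePolyIn G Set.univ w

/-- The local mean subtree order `μ(G; w)`: the average order of subtrees of `G`
containing `w`. -/
noncomputable def meanOrder [Fintype V] [DecidableEq V] (G : SimpleGraph V) (w : V) : ℝ :=
  (∑ A ∈ subtrees G w, (A.card : ℝ)) / ((subtrees G w).card : ℝ)

/-- The vertex set of the connected component of `G - D` containing `w`. -/
def compDel (G : SimpleGraph V) (D : Set V) (w : V) : Set V :=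
  {x | ∃ p : G.Walk w x, ∀ y ∈ p.support, y ∉ D}

/-- The neighbours of `u` as a `Finset`. -/
noncomputable def nbrFinset [Fintype V] (G : SimpleGraph V) (u : V) : Finset V := by
  classical
  exact Finset.univ.filter fun w => G.Adj u w

/-- `G` is a path: a tree all of whose vertices have degree at most `2`. -/
def IsPathGraph [Fintype V] (G : SimpleGraph V) : Prop :=
  G.IsTree ∧ ∀ v : V, (G.neighborSet v).ncard ≤ 2

/-- The induced subgraph of `G` on `S` is a path (as a subgraph of a tree:
connected with all degrees within `S` at most `2`). -/
def IsPathOn (G : SimpleGraph V) (S : Set V) : Prop :=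
  (G.induce S).Connected ∧ ∀ x ∈ S, (G.neighborSet x ∩ S).ncard ≤ 2

/-- The partial Kelmans operation on `G` from `v` to `u`, moving the edges between
`v` and the set `W`: each edge `v w`, `w ∈ W`, is replaced by the edge `u w`. -/
def pkelmans (G : SimpleGraph V) (v u : V) (W : Set V) : SimpleGraph V :=
  SimpleGraph.fromRel fun a b =>
    (G.Adj a b ∧ ¬(a = v ∧ b ∈ W) ∧ ¬(b = v ∧ a ∈ W)) ∨
    (a = u ∧ b ∈ W ∧ G.Adj v b)

/-- The Kelmans operation on `G` from `v` to `u`: every edge `v w` with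
`w ∈ N(v) \ {u}` is replaced by the edge `u w`. -/
def kelmans (G : SimpleGraph V) (v u : V) : SimpleGraph V :=
  pkelmans G v u (G.neighborSet v \ {u})

/-- `IsKTreeOn G k s` : the induced subgraph of `G` on the vertex set `s` is a `k`-tree,
following the recursive definition: `K_k` is a `k`-tree, and a `k`-tree grows by adding a
new vertex adjacent exactly to the vertices of some `k`-clique. -/
inductive IsKTreeOn [DecidableEq V] (G : SimpleGraph V) (k : ℕ) : Finset V → Prop
  | base (s : Finset V) : G.IsNClique k s → IsKTreeOn G k s
  | grow (s : Finset V) (v : V) (C : Finset V) :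
      IsKTreeOn G k s → v ∉ s → C ⊆ s → G.IsNClique k C →
      (∀ w ∈ s, G.Adj v w ↔ w ∈ C) → IsKTreeOn G k (insert v s)

/-- `G` is a `k`-tree. -/
def IsKTree [Fintype V] [DecidableEq V] (G : SimpleGraph V) (k : ℕ) : Prop :=
  IsKTreeOn G k Finset.univ

/-- The vertex sets of the sub-`k`-trees of `G` containing the `k`-clique `C`. -/
noncomputable def subKTrees [Fintype V] [DecidableEq V] (G : SimpleGraph V) (k : ℕ)
    (C : Finset V) : Finset (Finset V) := by
  classical
  exact Finset.univ.filter fun A => C ⊆ A ∧ IsKTreeOn G k A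

/-- The local mean order `μ(T; C)`: the average order of the sub-`k`-trees of `G`
containing the `k`-clique `C`. -/
noncomputable def kMean [Fintype V] [DecidableEq V] (G : SimpleGraph V) (k : ℕ)
    (C : Finset V) : ℝ :=
  (∑ A ∈ subKTrees G k C, (A.card : ℝ)) / ((subKTrees G k C).card : ℝ)

/-- The degree of a `k`-clique `C` in `G`: the number of `(k+1)`-cliques of `G`
containing `C`. -/
noncomputable def cliqueDeg [Fintype V] [DecidableEq V] (G : SimpleGraph V) (k : ℕ)
    (C : Finset V) : ℕ := by
  classical
  exact (Finset.univ.filter fun Q : Finset V => C ⊆ Q ∧ G.IsNClique (k + 1) Q).card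

/-- Two (distinct) `k`-cliques are adjacent if they are contained in a common
`(k+1)`-clique. -/
def CliqueAdj (G : SimpleGraph V) (k : ℕ) (C₁ C₂ : Finset V) : Prop :=
  C₁ ≠ C₂ ∧ ∃ Q : Finset V, G.IsNClique (k + 1) Q ∧ C₁ ⊆ Q ∧ C₂ ⊆ Q

/-- `IsPathTypeOn G k s` : the induced subgraph of `G` on `s` is a path-type `k`-tree:
`K_k` and `K_{k+1}` are path-type, and a path-type `k`-tree of order `≥ k+1` grows by
joining a new vertex to a simplicial `k`-clique (a `k`-clique containing a vertex of
degree `k`). -/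
inductive IsPathTypeOn [DecidableEq V] (G : SimpleGraph V) (k : ℕ) : Finset V → Prop
  | base₁ (s : Finset V) : G.IsNClique k s → IsPathTypeOn G k s
  | base₂ (s : Finset V) : G.IsNClique (k + 1) s → IsPathTypeOn G k s
  | grow (s : Finset V) (v : V) (C : Finset V) :
      IsPathTypeOn G k s → k + 1 ≤ s.card → v ∉ s → C ⊆ s → G.IsNClique k C →
      (∃ ℓ ∈ C, (G.neighborSet ℓ ∩ (↑s : Set V)).ncard = k) →
      (∀ w ∈ s, G.Adj v w ↔ w ∈ C) → IsPathTypeOn G k (insert v s)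

/-- `IsPEO G k C L` : the reverse of the list `L = [w₁, …, w_s, v]` is a perfect
elimination ordering of the induced subgraph on `C ∪ L` down to `C`: each vertex, from
the last one backwards, is a `k`-leaf (degree exactly `k`) of the graph induced on `C`
together with the not-yet-eliminated vertices. -/
inductive IsPEO [DecidableEq V] (G : SimpleGraph V) (k : ℕ) (C : Finset V) : List V → Prop
  | nil : IsPEO G k C []
  | snoc (l : List V) (v : V) : IsPEO G k C l → v ∉ C → v ∉ l →
      (G.neighborSet v ∩ ((↑C : Set V) ∪ {x | x ∈ l})).ncard = k →
      IsPEO G k C (l ++ [v])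

/-- `IsCanonPath G k C L` : the list `L = [w₁, …, w_s, v]` records the unique sequence
`A_T(C, v)` of Stephens–Oellermann: the induced subgraph on `C ∪ L` is a path-type
`k`-tree having `C` as a simplicial `k`-clique, and `(v, w_s, …, w₁)` is a perfect
elimination ordering of it down to `C`. -/
def IsCanonPath [Fintype V] [DecidableEq V] (G : SimpleGraph V) (k : ℕ) (C : Finset V)
    (L : List V) : Prop :=
  L ≠ [] ∧ L.Nodup ∧ (∀ x ∈ L, x ∉ C) ∧
    IsPathTypeOn G k (C ∪ L.toFinset) ∧
    (∃ ℓ ∈ C, (G.neighborSet ℓ ∩ ((↑C : Set V) ∪ {x | x ∈ L})).ncard = k) ∧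
    IsPEO G k C L

/-- The characteristic `1`-tree `T'_C` of the `k`-tree `G` with respect to the `k`-clique
`C`.  Its vertices are the vertices of `G` outside `C` together with one extra vertex
`none` representing `C`; its edges are the union, over all `k`-leaves `v` of `G` outside
`C`, of the paths `C – w₁ – ⋯ – w_s – v` given by the canonical sequences `A_T(C, v)`. -/
def charTree [Fintype V] [DecidableEq V] (G : SimpleGraph V) (k : ℕ) (C : Finset V) :
    SimpleGraph (Option {x : V // x ∉ C}) :=
  SimpleGraph.fromRel fun a b =>
    ∃ L : List V, IsCanonPath G k C L ∧
      (∃ v, L.getLast? = some v ∧ (G.neighborSet v).ncard = k) ∧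
      ((a = none ∧ ∃ y : {x : V // x ∉ C}, b = some y ∧ L.head? = some y.val) ∨
        (∃ x y : {x : V // x ∉ C}, a = some x ∧ b = some y ∧ [x.val, y.val] <:+: L))

/-! ### Rebuilding a `k`-tree from a given clique -/

/-- `BuiltFrom G k Q s`: the induced subgraph on `s` arises from the vertex set `Q` by
repeatedly adding a vertex joined to a `k`-clique. -/
inductive BuiltFrom [DecidableEq V] (G : SimpleGraph V) (k : ℕ) (Q : Finset V) :
    Finset V → Prop
  | base : BuiltFrom G k Q Q
  | grow (s : Finset V) (v : V) (C : Finset V) :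
      BuiltFrom G k Q s → v ∉ s → C ⊆ s → G.IsNClique k C →
      (∀ w ∈ s, G.Adj v w ↔ w ∈ C) → BuiltFrom G k Q (insert v s)

section Build

variable [DecidableEq V] {G : SimpleGraph V} {k : ℕ}

lemma BuiltFrom.subset {Q s : Finset V} (h : BuiltFrom G k Q s) : Q ⊆ s := by
  induction h with
  | base => exact subset_rfl
  | grow s v C _ _ _ _ _ ih => exact ih.trans (Finset.subset_insert _ _)

lemma BuiltFrom.trans {P Q s : Finset V} (hPQ : BuiltFrom G k P Q) (h : BuiltFrom G k Q s) :
    BuiltFrom G k P s := by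
  induction h with
  | base => exact hPQ
  | grow s v C _ hv hC hcl hadj ih => exact .grow s v C ih hv hC hcl hadj

/-- A vertex attached to the initial clique can be added first instead of last. -/
lemma BuiltFrom.insert_first {C s : Finset V} {v : V} (h : BuiltFrom G k C s) (hv : v ∉ s)
    (hadj : ∀ w ∈ s, G.Adj v w ↔ w ∈ C) : BuiltFrom G k (insert v C) (insert v s) := by
  induction h with
  | base => exact .base
  | grow s w D hs hw hD hcl hwadj ih =>
    rw [Finset.mem_insert, not_or] at hv
    rw [Finset.insert_comm]
    refine .grow _ w D (ih hv.2 fun x hx => hadj x (Finset.mem_insert_of_mem hx)) ?_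
      (hD.trans (Finset.subset_insert _ _)) hcl ?_
    · rw [Finset.mem_insert, not_or]
      exact ⟨Ne.symm hv.1, hw⟩
    · intro x hx
      rcases Finset.mem_insert.1 hx with rfl | hx
      · have h₁ : ¬ G.Adj x w := fun hxw =>
          hw (hs.subset ((hadj w (Finset.mem_insert_self _ _)).1 hxw))
        exact ⟨fun hwx => absurd hwx.symm h₁, fun hxD => absurd (hD hxD) hv.2⟩
      · exact hwadj x hx

/-- A `k`-tree can be built starting from any of its cliques of order `k` or `k + 1`. -/
lemma IsKTreeOn.builtFrom {s : Finset V} (h : IsKTreeOn G k s) :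
    ∀ Q ⊆ s, G.IsClique (Q : Set V) → (Q.card = k ∨ Q.card = k + 1) → BuiltFrom G k Q s := by
  induction h with
  | base s hs =>
    intro Q hQ _ hcard
    have hle := Finset.card_le_card hQ
    have hs' := hs.card_eq
    have : Q = s := Finset.eq_of_subset_of_card_le hQ (by omega)
    exact this ▸ .base
  | grow s v C _ hv hC hcl hadj ih =>
    intro Q hQ hQcl hcard
    by_cases hvQ : v ∈ Q
    · have hb : BuiltFrom G k (insert v C) (insert v s) :=
        (ih C hC hcl.isClique (.inl hcl.card_eq)).insert_first hv hadj
      have hQC : Q.erase v ⊆ C := by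
        intro x hx
        rw [Finset.mem_erase] at hx
        have hxs : x ∈ s := (Finset.mem_insert.1 (hQ hx.2)).resolve_left hx.1
        exact (hadj x hxs).1 (hQcl hvQ hx.2 hx.1.symm)
      have hQe := Finset.card_erase_add_one hvQ
      have hCc := hcl.card_eq
      have hvC : v ∉ C := fun hvC => hv (hC hvC)
      rcases hcard with hcard | hcard
      · have hex : (C \ Q.erase v).card = 1 := by
          rw [Finset.card_sdiff_of_subset hQC]
          omega
        obtain ⟨x, hx⟩ := Finset.card_eq_one.1 hex
        have hxm : x ∈ C ∧ x ∉ Q.erase v := by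
          rw [← Finset.mem_sdiff, hx, Finset.mem_singleton]
        have hxv : x ≠ v := fun hxv => hvC (hxv ▸ hxm.1)
        have hxQ : x ∉ Q := fun hxQ => hxm.2 (Finset.mem_erase.2 ⟨hxv, hxQ⟩)
        have heq : insert v C = insert x Q := by
          rw [← Finset.sdiff_union_of_subset hQC, hx, ← Finset.insert_eq,
            Finset.insert_comm, Finset.insert_erase hvQ]
        rw [heq] at hb
        refine BuiltFrom.trans (.grow Q x Q .base hxQ subset_rfl ⟨hQcl, hcard⟩ ?_) hb
        intro w hw
        refine ⟨fun _ => hw, fun _ => ?_⟩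
        by_cases hwv : w = v
        · exact hwv ▸ ((hadj x (hC hxm.1)).2 hxm.1).symm
        · refine hcl.isClique hxm.1 (hQC (Finset.mem_erase.2 ⟨hwv, hw⟩)) ?_
          rintro rfl
          exact hxQ hw
      · have heq : Q.erase v = C := Finset.eq_of_subset_of_card_le hQC (by omega)
        rw [← heq, Finset.insert_erase hvQ] at hb
        exact hb
    · exact .grow s v C
        (ih Q ((Finset.subset_insert_iff_of_notMem hvQ).1 hQ) hQcl hcard) hv hC hcl hadj

end Build

/-! ### Ranks: the order in which the vertices are added -/

section Rank

open Classical in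
/-- The neighbours of `v` of smaller rank. -/
noncomputable def backNbrs [Fintype V] (G : SimpleGraph V) (r : V → ℕ) (v : V) : Finset V :=
  Finset.univ.filter fun u => G.Adj u v ∧ r u < r v

/-- `IsRank G k Q r`: the vertices outside `Q` can be added to `Q` in the order of
increasing `r`, each of them being joined to a `k`-clique of vertices added before. -/
structure IsRank [Fintype V] (G : SimpleGraph V) (k : ℕ) (Q : Finset V) (r : V → ℕ) :
    Prop where
  eq_zero_iff : ∀ v, r v = 0 ↔ v ∈ Q
  inj : ∀ u v, v ∉ Q → r u = r v → u = v
  isNClique : ∀ v, v ∉ Q → G.IsNClique k (backNbrs G r v)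

/-- `x` is the neighbour of `y` of smaller rank which has been added last. -/
def IsParent [Fintype V] (G : SimpleGraph V) (r : V → ℕ) (x y : V) : Prop :=
  x ∈ backNbrs G r y ∧ ∀ u ∈ backNbrs G r y, r u ≤ r x

variable [Fintype V] {G : SimpleGraph V} {k : ℕ}

@[simp] lemma mem_backNbrs {r : V → ℕ} {u v : V} :
    u ∈ backNbrs G r v ↔ G.Adj u v ∧ r u < r v := by
  simp [backNbrs]

omit [Fintype V] in
open Classical in
lemma BuiltFrom.exists_rank [DecidableEq V] {Q s : Finset V} (h : BuiltFrom G k Q s) :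
    ∃ r : V → ℕ, (∀ v ∈ s, r v = 0 ↔ v ∈ Q) ∧
      (∀ u ∈ s, ∀ v ∈ s, v ∉ Q → r u = r v → u = v) ∧
      ∀ v ∈ s, v ∉ Q → G.IsNClique k (s.filter fun u => G.Adj u v ∧ r u < r v) := by
  induction h with
  | base =>
    exact ⟨fun _ => 0, fun v hv => by simp [hv], fun _ _ v hv hv' => absurd hv hv',
      fun v hv hv' => absurd hv hv'⟩
  | grow s v C hs hv hC hcl hadj ih =>
    obtain ⟨r, h0, hinj, hclq⟩ := ih
    have hvQ : v ∉ Q := fun hvQ => hv (hs.subset hvQ)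
    have hlt : ∀ u ∈ s, r u < s.sup r + 1 := fun u hu => Nat.lt_succ_of_le (Finset.le_sup hu)
    have hrv : Function.update r v (s.sup r + 1) v = s.sup r + 1 := Function.update_self _ _ _
    have hru : ∀ u ∈ s, Function.update r v (s.sup r + 1) u = r u := fun u hu =>
      Function.update_of_ne (ne_of_mem_of_not_mem hu hv) _ _
    refine ⟨Function.update r v (s.sup r + 1), ?_, ?_, ?_⟩
    · intro u hu
      rcases Finset.mem_insert.1 hu with rfl | hu
      · simp [hvQ]
      · rw [hru u hu, h0 u hu]
    · intro u hu w hw hwQ huw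
      rcases Finset.mem_insert.1 hu with hu' | hu' <;> rcases Finset.mem_insert.1 hw with hw' | hw'
      · rw [hu', hw']
      · rw [hu', hrv, hru w hw'] at huw
        exact absurd huw (hlt w hw').ne'
      · rw [hw', hrv, hru u hu'] at huw
        exact absurd huw (hlt u hu').ne
      · rw [hru u hu', hru w hw'] at huw
        exact hinj u hu' w hw' hwQ huw
    · intro w hw hwQ
      rcases Finset.mem_insert.1 hw with rfl | hws
      · convert hcl using 1
        ext u
        simp only [Finset.mem_filter, Finset.mem_insert]
        constructor
        · rintro ⟨rfl | hu, huw, -⟩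
          · exact absurd huw (G.loopless.irrefl _)
          · exact (hadj u hu).1 huw.symm
        · intro hu
          refine ⟨.inr (hC hu), ((hadj u (hC hu)).2 hu).symm, ?_⟩
          rw [hrv, hru u (hC hu)]
          exact hlt u (hC hu)
      · convert hclq w hws hwQ using 1
        ext u
        simp only [Finset.mem_filter, Finset.mem_insert]
        constructor
        · rintro ⟨rfl | hu, huw, hlt'⟩
          · rw [hrv, hru w hws] at hlt'
            exact absurd hlt' (hlt w hws).not_gt
          · rw [hru u hu, hru w hws] at hlt'
            exact ⟨hu, huw, hlt'⟩
        · rintro ⟨hu, huw, hlt'⟩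
          exact ⟨.inr hu, huw, by rwa [hru u hu, hru w hws]⟩

lemma IsKTree.exists_isRank [DecidableEq V] (hG : IsKTree G k) {Q : Finset V}
    (hQ : G.IsNClique (k + 1) Q) : ∃ r, IsRank G k Q r := by
  obtain ⟨r, h0, hinj, hcl⟩ := (hG.builtFrom Q (Finset.subset_univ _) hQ.isClique
    (.inr hQ.card_eq)).exists_rank
  exact ⟨r, fun v => h0 v (Finset.mem_univ _),
    fun u v => hinj u (Finset.mem_univ _) v (Finset.mem_univ _),
    fun v => hcl v (Finset.mem_univ _)⟩

namespace IsRank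

variable {C : Finset V} {r : V → ℕ}

lemma pos (hr : IsRank G k C r) {v : V} (hv : v ∉ C) : 0 < r v :=
  Nat.pos_of_ne_zero fun h => hv ((hr.eq_zero_iff v).1 h)

lemma notMem_of_mem_backNbrs (hr : IsRank G k C r) {u v : V} (h : u ∈ backNbrs G r v) :
    v ∉ C := by
  intro hv
  rw [mem_backNbrs, (hr.eq_zero_iff v).2 hv] at h
  omega

lemma adj_iff_mem_backNbrs (hr : IsRank G k C r) {u v : V} (hu : u ∈ C) (hv : v ∉ C) :
    G.Adj u v ↔ u ∈ backNbrs G r v := by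
  rw [mem_backNbrs, (hr.eq_zero_iff u).2 hu]
  exact ⟨fun h => ⟨h, hr.pos hv⟩, fun h => h.1⟩

lemma adj_iff (hr : IsRank G k C r) {u v : V} (hv : v ∉ C) :
    G.Adj u v ↔ u ∈ backNbrs G r v ∨ v ∈ backNbrs G r u := by
  simp only [mem_backNbrs]
  refine ⟨fun h => ?_, fun h => h.elim (fun h => h.1) fun h => h.1.symm⟩
  have : r u ≠ r v := fun huv => h.ne (hr.inj u v hv huv)
  rcases this.lt_or_gt with h' | h'
  · exact .inl ⟨h, h'⟩
  · exact .inr ⟨h.symm, h'⟩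

lemma backNbrs_subset_insert [DecidableEq V] (hr : IsRank G k C r) {x y : V} (hx : x ∉ C)
    (h : IsParent G r x y) : backNbrs G r y ⊆ insert x (backNbrs G r x) := by
  intro u hu
  rw [Finset.mem_insert]
  by_cases hux : u = x
  · exact .inl hux
  · have hy := hr.notMem_of_mem_backNbrs hu
    refine .inr (mem_backNbrs.2 ⟨(hr.isNClique y hy).isClique hu h.1 hux, ?_⟩)
    exact lt_of_le_of_ne (h.2 u hu) fun e => hux (hr.inj u x hx e)

lemma exists_parent (hr : IsRank G k C r) (hC : G.IsNClique k C) {y : V} (hy : y ∉ C)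
    (hne : backNbrs G r y ≠ C) : ∃ x, x ∉ C ∧ IsParent G r x y := by
  have hcard := (hr.isNClique y hy).card_eq
  have hnot : ¬ backNbrs G r y ⊆ C := fun hsub =>
    hne (Finset.eq_of_subset_of_card_le hsub (by rw [hcard, hC.card_eq]))
  obtain ⟨z, hz, hzC⟩ := Finset.not_subset.1 hnot
  obtain ⟨x, hx, hmax⟩ := Finset.exists_max_image (backNbrs G r y) r ⟨z, hz⟩
  refine ⟨x, fun hxC => ?_, hx, hmax⟩
  have h₁ := hmax z hz
  have h₂ := hr.pos hzC
  rw [(hr.eq_zero_iff x).2 hxC] at h₁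
  omega

/-- A vertex with a neighbour of larger rank is the parent of some vertex. -/
lemma exists_child (hr : IsRank G k C r) {w : V} :
    ∀ n u, r u = n → w ∈ backNbrs G r u → ∃ y, IsParent G r w y := by
  intro n
  induction n using Nat.strong_induction_on with
  | _ n ih =>
    intro u hu hw
    by_cases hmax : ∀ x ∈ backNbrs G r u, r x ≤ r w
    · exact ⟨u, hw, hmax⟩
    · push Not at hmax
      obtain ⟨x, hx, hwx⟩ := hmax
      have hadj := (hr.isNClique u (hr.notMem_of_mem_backNbrs hw)).isClique hw hx
        (fun e => hwx.ne (congrArg r e))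
      exact ih (r x) (hu ▸ (mem_backNbrs.1 hx).2) x rfl (mem_backNbrs.2 ⟨hadj, hwx⟩)

/-- A vertex outside the root which is not a parent is a `k`-leaf. -/
lemma ncard_neighborSet (hr : IsRank G k C r) {w : V} (hw : w ∉ C)
    (h : ∀ y, ¬ IsParent G r w y) : (G.neighborSet w).ncard = k := by
  have : G.neighborSet w = backNbrs G r w := by
    ext u
    rw [SimpleGraph.mem_neighborSet, Finset.mem_coe, G.adj_comm, hr.adj_iff hw]
    refine or_iff_left fun hu => ?_
    obtain ⟨y, hy⟩ := hr.exists_child _ u rfl hu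
    exact h y hy
  rw [this, Set.ncard_coe_finset, (hr.isNClique w hw).card_eq]

end IsRank

end Rank

/-! ### Descending paths and canonical sequences -/

section NbrsIn

variable {G : SimpleGraph V} {k : ℕ}

open Classical in
/-- The neighbours of `x` inside `s`. -/
noncomputable def nbrsIn (G : SimpleGraph V) (s : Finset V) (x : V) : Finset V :=
  s.filter (G.Adj x)

@[simp] lemma mem_nbrsIn {s : Finset V} {x y : V} : y ∈ nbrsIn G s x ↔ y ∈ s ∧ G.Adj x y := by
  simp [nbrsIn]

lemma ncard_neighborSet_inter (s : Finset V) (x : V) :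
    (G.neighborSet x ∩ (s : Set V)).ncard = (nbrsIn G s x).card := by
  rw [← Set.ncard_coe_finset]
  congr 1
  ext y
  simp [and_comm]

lemma nbrsIn_mono {s t : Finset V} (h : s ⊆ t) (x : V) : nbrsIn G s x ⊆ nbrsIn G t x := by
  intro y
  simp only [mem_nbrsIn]
  exact fun hy => ⟨h hy.1, hy.2⟩

lemma nbrsIn_insert_of_not_adj [DecidableEq V] {s : Finset V} {v x : V} (h : ¬ G.Adj x v) :
    nbrsIn G (insert v s) x = nbrsIn G s x := by
  ext y
  simp only [mem_nbrsIn, Finset.mem_insert]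
  grind

lemma card_nbrsIn_insert_of_adj [DecidableEq V] {s : Finset V} {v x : V} (hv : v ∉ s)
    (h : G.Adj x v) : (nbrsIn G (insert v s) x).card = (nbrsIn G s x).card + 1 := by
  rw [← Finset.card_insert_of_notMem (s := nbrsIn G s x) (a := v) (by simp [hv])]
  congr 1
  ext y
  simp only [mem_nbrsIn, Finset.mem_insert]
  grind

lemma nbrsIn_clique [DecidableEq V] {s : Finset V} (h : G.IsClique (s : Set V)) {x : V}
    (hx : x ∈ s) : nbrsIn G s x = s.erase x := by
  ext y
  simp only [mem_nbrsIn, Finset.mem_erase]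
  exact ⟨fun hy => ⟨hy.2.ne', hy.1⟩, fun hy => ⟨hy.2, h hx hy.2 hy.1.symm⟩⟩

/-- In a path-type `k`-tree of order at least `k + 1` all degrees are at least `k`, and one of
order at least `k + 2` does not have three `k`-leaves. -/
lemma IsPathTypeOn.leaves [DecidableEq V] {s : Finset V} (h : IsPathTypeOn G k s) :
    (k + 1 ≤ s.card → ∀ x ∈ s, k ≤ (nbrsIn G s x).card) ∧
      (k + 2 ≤ s.card → ∀ a ∈ s, ∀ b ∈ s, ∀ c ∈ s, a ≠ b → a ≠ c → b ≠ c →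
        (nbrsIn G s a).card = k → (nbrsIn G s b).card = k → (nbrsIn G s c).card ≠ k) := by
  induction h with
  | base₁ s hs =>
    have := hs.card_eq
    exact ⟨by omega, by omega⟩
  | base₂ s hs =>
    have := hs.card_eq
    refine ⟨fun _ x hx => ?_, by omega⟩
    rw [nbrsIn_clique hs.isClique hx, Finset.card_erase_of_mem hx]
    omega
  | grow s v C hs hcard hv hC hcl hℓ hadj ih =>
    obtain ⟨hdeg, hleaf⟩ := ih
    obtain ⟨ℓ, hℓC, hℓ⟩ := hℓ
    rw [ncard_neighborSet_inter] at hℓ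
    have hci := Finset.card_insert_of_notMem hv
    have hold : ∀ x ∈ insert v s, x ≠ v → (nbrsIn G (insert v s) x).card = k →
        x ∈ s ∧ x ∉ C ∧ (nbrsIn G s x).card = k := by
      intro x hx hxv hxk
      have hxs := (Finset.mem_insert.1 hx).resolve_left hxv
      have hge := hdeg hcard x hxs
      have hna : ¬ G.Adj x v := by
        intro hxa
        rw [card_nbrsIn_insert_of_adj hv hxa] at hxk
        omega
      refine ⟨hxs, fun hxC => hna ((hadj x hxs).2 hxC).symm, ?_⟩
      rwa [nbrsIn_insert_of_not_adj hna] at hxk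
    have htwo : ∀ a ∈ insert v s, ∀ b ∈ insert v s, a ≠ v → b ≠ v → a ≠ b →
        (nbrsIn G (insert v s) a).card = k → (nbrsIn G (insert v s) b).card = k → False := by
      intro a ha b hb hav hbv hab hka hkb
      obtain ⟨has, haC, hka'⟩ := hold a ha hav hka
      obtain ⟨hbs, hbC, hkb'⟩ := hold b hb hbv hkb
      rcases hcard.eq_or_lt with heq | hlt
      · have hsub : insert a (insert b C) ⊆ s :=
          Finset.insert_subset has (Finset.insert_subset hbs hC)
        have hle := Finset.card_le_card hsub
        rw [Finset.card_insert_of_notMem (by simp [hab, haC]),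
          Finset.card_insert_of_notMem hbC, hcl.card_eq] at hle
        omega
      · exact hleaf hlt a has b hbs ℓ (hC hℓC) hab (fun e => haC (e ▸ hℓC))
          (fun e => hbC (e ▸ hℓC)) hka' hkb' hℓ
    refine ⟨fun _ x hx => ?_, ?_⟩
    · rcases Finset.mem_insert.1 hx with rfl | hx
      · have hsub : C ⊆ nbrsIn G (insert x s) x := fun y hy =>
          mem_nbrsIn.2 ⟨Finset.mem_insert_of_mem (hC hy), (hadj y (hC hy)).2 hy⟩
        exact hcl.card_eq ▸ Finset.card_le_card hsub
      · exact (hdeg hcard x hx).trans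
          (Finset.card_le_card (nbrsIn_mono (Finset.subset_insert _ _) x))
    · intro _ a ha b hb c hc hab hac hbc hka hkb hkc
      by_cases hav : a = v
      · exact htwo b hb c hc (fun e => hab (hav.trans e.symm)) (fun e => hac (hav.trans e.symm))
          hbc hkb hkc
      · by_cases hbv : b = v
        · exact htwo a ha c hc hav (fun e => hbc (hbv.trans e.symm)) hac hka hkc
        · exact htwo a ha b hb hav hbv hab hka hkb

/-- The set `s` contains three pairwise nonadjacent vertices having degree `k` within `s`. -/
def HasThreeLeaves (G : SimpleGraph V) (k : ℕ) (s : Finset V) : Prop :=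
  ∃ a ∈ s, ∃ b ∈ s, ∃ c ∈ s, a ≠ b ∧ a ≠ c ∧ b ≠ c ∧ ¬ G.Adj a b ∧ ¬ G.Adj a c ∧ ¬ G.Adj b c ∧
    (nbrsIn G s a).card = k ∧ (nbrsIn G s b).card = k ∧ (nbrsIn G s c).card = k

lemma HasThreeLeaves.insert [DecidableEq V] {s : Finset V} {v : V} (h : HasThreeLeaves G k s)
    (hv : v ∉ s) (hcl : G.IsNClique k (nbrsIn G s v)) : HasThreeLeaves G k (insert v s) := by
  have hvk : (nbrsIn G (Insert.insert v s) v).card = k := by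
    rw [nbrsIn_insert_of_not_adj (G.loopless.irrefl v), hcl.card_eq]
  have hmem : ∀ {x}, x ∈ s → x ∈ Insert.insert v s := fun hx => Finset.mem_insert_of_mem hx
  have hvs := Finset.mem_insert_self v s
  have hpair : ∀ x ∈ s, ∀ y ∈ s, x ≠ y → ¬ G.Adj x y → G.Adj x v → ¬ G.Adj y v := by
    intro x hx y hy hxy hna hxv hyv
    exact hna (hcl.isClique (by simp [hx, hxv.symm]) (by simp [hy, hyv.symm]) hxy)
  have hkeep : ∀ x, ¬ G.Adj x v → (nbrsIn G s x).card = k →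
      (nbrsIn G (Insert.insert v s) x).card = k := by
    intro x hx hk
    rwa [nbrsIn_insert_of_not_adj hx]
  obtain ⟨a, ha, b, hb, c, hc, hab, hac, hbc, nab, nac, nbc, ka, kb, kc⟩ := h
  have hne : ∀ {x}, x ∈ s → x ≠ v := fun hx => ne_of_mem_of_not_mem hx hv
  by_cases hav : G.Adj a v
  · have hbv := hpair a ha b hb hab nab hav
    have hcv := hpair a ha c hc hac nac hav
    exact ⟨b, hmem hb, c, hmem hc, v, hvs, hbc, hne hb, hne hc, nbc, hbv, hcv,
      hkeep b hbv kb, hkeep c hcv kc, hvk⟩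
  · by_cases hbv : G.Adj b v
    · have hcv := hpair b hb c hc hbc nbc hbv
      exact ⟨a, hmem ha, c, hmem hc, v, hvs, hac, hne ha, hne hc, nac, hav, hcv,
        hkeep a hav ka, hkeep c hcv kc, hvk⟩
    · by_cases hcv : G.Adj c v
      · exact ⟨a, hmem ha, b, hmem hb, v, hvs, hab, hne ha, hne hb, nab, hav, hbv,
          hkeep a hav ka, hkeep b hbv kb, hvk⟩
      · exact ⟨a, hmem ha, b, hmem hb, c, hmem hc, hab, hac, hbc, nab, nac, nbc,
          hkeep a hav ka, hkeep b hbv kb, hkeep c hcv kc⟩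

end NbrsIn

/-- `IsDescPath G C r L y`: the list `L` starts with a vertex joined to all of `C`, every
further entry has the preceding one as its parent, and the last entry is `y`. -/
inductive IsDescPath [Fintype V] (G : SimpleGraph V) (C : Finset V) (r : V → ℕ) :
    List V → V → Prop
  | single (y : V) : y ∉ C → backNbrs G r y = C → IsDescPath G C r [y] y
  | snoc (l : List V) (x y : V) : IsDescPath G C r l x → y ∉ C → IsParent G r x y →
      IsDescPath G C r (l ++ [y]) y

section DescPath

variable [Fintype V] {G : SimpleGraph V} {k : ℕ} {C : Finset V} {r : V → ℕ} {L : List V} {y : V}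

namespace IsDescPath

lemma notMem_last (h : IsDescPath G C r L y) : y ∉ C := by
  cases h <;> assumption

lemma exists_eq_append (h : IsDescPath G C r L y) : ∃ l, L = l ++ [y] := by
  cases h with
  | single _ _ _ => exact ⟨[], rfl⟩
  | snoc l _ _ _ _ _ => exact ⟨l, rfl⟩

lemma notMem (h : IsDescPath G C r L y) : ∀ x ∈ L, x ∉ C := by
  induction h with
  | single y hy _ => simpa using hy
  | snoc l x y _ hy _ ih => simpa [or_imp, forall_and] using ⟨ih, hy⟩

lemma exists_head (h : IsDescPath G C r L y) : ∃ a t, L = a :: t ∧ backNbrs G r a = C := by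
  induction h with
  | single y _ hy => exact ⟨y, [], rfl, hy⟩
  | snoc l x y _ _ _ ih =>
    obtain ⟨a, t, rfl, ha⟩ := ih
    exact ⟨a, t ++ [y], rfl, ha⟩

lemma isParent_of_consecutive (h : IsDescPath G C r L y) {a b : V} (hab : [a, b] <:+: L) :
    IsParent G r a b := by
  induction h with
  | single y _ hy =>
    have := hab.length_le
    simp at this
  | snoc l x y hl _ hxy ih =>
    rw [List.infix_concat_iff] at hab
    rcases hab with hab | hab
    · obtain ⟨l', rfl⟩ := hl.exists_eq_append
      obtain ⟨m, hm⟩ := hab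
      have : (m ++ [a]) ++ [b] = (l' ++ [x]) ++ [y] := by simpa using hm
      obtain ⟨h₁, h₂⟩ := List.append_inj' this rfl
      obtain ⟨-, h₃⟩ := List.append_inj' h₁ rfl
      simp only [List.cons.injEq, and_true] at h₂ h₃
      rwa [h₂, h₃]
    · exact ih hab

lemma rank_le (h : IsDescPath G C r L y) : ∀ x ∈ L, r x ≤ r y := by
  induction h with
  | single y _ _ => simp
  | snoc l x y _ _ hxy ih =>
    have := (mem_backNbrs.1 hxy.1).2
    intro z hz
    rcases List.mem_append.1 hz with hz | hz
    · exact (ih z hz).trans this.le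
    · rw [List.mem_singleton.1 hz]

lemma notMem_of_isParent (h : IsDescPath G C r L y) {z : V} (hz : IsParent G r y z) : z ∉ L :=
  fun hzL => absurd (h.rank_le z hzL) (mem_backNbrs.1 hz.1).2.not_ge

lemma nodup (h : IsDescPath G C r L y) : L.Nodup := by
  induction h with
  | single y _ _ => simp
  | snoc l x y hl _ hxy ih =>
    rw [← List.concat_eq_append]
    exact ih.concat (hl.notMem_of_isParent hxy)

/-- Every vertex outside the root is the end of a descending path. -/
lemma exists_path (hr : IsRank G k C r) (hC : G.IsNClique k C) :
    ∀ n y, r y = n → y ∉ C → ∃ L, IsDescPath G C r L y := by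
  intro n
  induction n using Nat.strong_induction_on with
  | _ n ih =>
    intro y hyn hy
    by_cases hB : backNbrs G r y = C
    · exact ⟨[y], .single y hy hB⟩
    · obtain ⟨x, hx, hxy⟩ := hr.exists_parent hC hy hB
      obtain ⟨l, hl⟩ := ih (r x) (hyn ▸ (mem_backNbrs.1 hxy.1).2) x rfl hx
      exact ⟨l ++ [y], .snoc l x y hl hy hxy⟩

/-- Every descending path extends to one ending in a `k`-leaf. -/
lemma exists_extension (hr : IsRank G k C r) : ∀ n L y, Finset.univ.sup r - r y = n →
    IsDescPath G C r L y →
    ∃ L' v, IsDescPath G C r L' v ∧ L <+: L' ∧ (G.neighborSet v).ncard = k := by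
  intro n
  induction n using Nat.strong_induction_on with
  | _ n ih =>
    intro L y hn hL
    by_cases hc : ∃ z, IsParent G r y z
    · obtain ⟨z, hz⟩ := hc
      have h₁ := (mem_backNbrs.1 hz.1).2
      have h₂ : r z ≤ Finset.univ.sup r := Finset.le_sup (Finset.mem_univ z)
      obtain ⟨L', v, hL', hpre, hv⟩ := ih (Finset.univ.sup r - r z) (by omega) (L ++ [z]) z rfl
        (.snoc L y z hL (hr.notMem_of_mem_backNbrs hz.1) hz)
      exact ⟨L', v, hL', (List.prefix_append _ _).trans hpre, hv⟩
    · exact ⟨L, y, hL, List.prefix_rfl, hr.ncard_neighborSet hL.notMem_last (not_exists.1 hc)⟩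

end IsDescPath

end DescPath

section Canonical

variable [Fintype V] [DecidableEq V] {G : SimpleGraph V} {k : ℕ} {C : Finset V} {r : V → ℕ}
  {L : List V} {y : V}

omit [Fintype V] in
lemma coe_union_setOf_mem (C : Finset V) (L : List V) :
    ((C : Set V) ∪ {x | x ∈ L}) = ((C ∪ L.toFinset : Finset V) : Set V) := by
  ext x
  simp

omit [Fintype V] in
lemma union_toFinset_append (C : Finset V) (l : List V) (y : V) :
    C ∪ (l ++ [y]).toFinset = insert y (C ∪ l.toFinset) := by
  ext x
  simp only [Finset.mem_union, List.mem_toFinset, List.mem_append, List.mem_singleton,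
    Finset.mem_insert]
  tauto

omit [DecidableEq V] in
lemma IsRank.nbrsIn_eq (hr : IsRank G k C r) {s : Finset V} (hs : backNbrs G r y ⊆ s)
    (hle : ∀ u ∈ s, r u ≤ r y) (hy : y ∉ C) : nbrsIn G s y = backNbrs G r y := by
  ext u
  rw [mem_nbrsIn, G.adj_comm]
  refine ⟨fun ⟨hu, hadj⟩ => mem_backNbrs.2 ⟨hadj, ?_⟩, fun hu => ⟨hs hu, (mem_backNbrs.1 hu).1⟩⟩
  exact lt_of_le_of_ne (hle u hu) fun e => hadj.ne (hr.inj u y hy e)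

namespace IsDescPath

lemma rank_le_of_mem_union (hr : IsRank G k C r) (h : IsDescPath G C r L y) :
    ∀ x ∈ C ∪ L.toFinset, r x ≤ r y := by
  intro x hx
  rcases Finset.mem_union.1 hx with hx | hx
  · rw [(hr.eq_zero_iff x).2 hx]
    exact Nat.zero_le _
  · exact h.rank_le x (List.mem_toFinset.1 hx)

omit [DecidableEq V] in
lemma mem (h : IsDescPath G C r L y) : y ∈ L := by
  obtain ⟨l, rfl⟩ := h.exists_eq_append
  simp

lemma backNbrs_subset (hr : IsRank G k C r) (h : IsDescPath G C r L y) :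
    backNbrs G r y ⊆ C ∪ L.toFinset := by
  induction h with
  | single y hy hB => exact hB ▸ Finset.subset_union_left
  | snoc l x y hl hy hxy ih =>
    rw [union_toFinset_append]
    refine (hr.backNbrs_subset_insert hl.notMem_last hxy).trans ?_
    refine (Finset.insert_subset ?_ ih).trans (Finset.subset_insert _ _)
    simp [hl.mem]

lemma backNbrs_subset_of_isParent (hr : IsRank G k C r) (h : IsDescPath G C r L y) {z : V}
    (hz : IsParent G r y z) : backNbrs G r z ⊆ C ∪ L.toFinset :=
  (hr.backNbrs_subset_insert h.notMem_last hz).trans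
    (Finset.insert_subset (by simp [h.mem]) (h.backNbrs_subset hr))

lemma nbrsIn_last (hr : IsRank G k C r) (h : IsDescPath G C r L y) :
    nbrsIn G (C ∪ L.toFinset) y = backNbrs G r y :=
  hr.nbrsIn_eq (h.backNbrs_subset hr) (h.rank_le_of_mem_union hr) h.notMem_last

lemma nbrsIn_next (hr : IsRank G k C r) (h : IsDescPath G C r L y) {z : V}
    (hz : IsParent G r y z) : nbrsIn G (C ∪ L.toFinset) z = backNbrs G r z :=
  hr.nbrsIn_eq (h.backNbrs_subset_of_isParent hr hz)
    (fun u hu => (h.rank_le_of_mem_union hr u hu).trans (mem_backNbrs.1 hz.1).2.le)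
    (hr.notMem_of_mem_backNbrs hz.1)

lemma isPEO (hr : IsRank G k C r) (h : IsDescPath G C r L y) : IsPEO G k C L := by
  induction h with
  | single y hy hB =>
    refine .snoc [] y .nil hy (by simp) ?_
    rw [coe_union_setOf_mem, ncard_neighborSet_inter,
      hr.nbrsIn_eq (by simp [hB]) (fun u hu => ?_) hy, (hr.isNClique y hy).card_eq]
    rw [(hr.eq_zero_iff u).2 (by simpa using hu)]
    exact Nat.zero_le _
  | snoc l x y hl hy hxy ih =>
    refine .snoc l y ih hy (hl.notMem_of_isParent hxy) ?_
    rw [coe_union_setOf_mem, ncard_neighborSet_inter, hl.nbrsIn_next hr hxy,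
      (hr.isNClique y hy).card_eq]

lemma insert_isNClique (hr : IsRank G k C r) (hy : y ∉ C) (hB : backNbrs G r y = C) :
    G.IsNClique (k + 1) (insert y C) := by
  have hcl := hr.isNClique y hy
  rw [hB] at hcl
  refine hcl.insert fun b hb => ?_
  rw [← hB] at hb
  exact (mem_backNbrs.1 hb).1.symm

lemma card_le (hr : IsRank G k C r) (h : IsDescPath G C r L y) :
    k + 1 ≤ (C ∪ L.toFinset).card := by
  have hsub : insert y (backNbrs G r y) ⊆ C ∪ L.toFinset :=
    Finset.insert_subset (by simp [h.mem]) (h.backNbrs_subset hr)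
  have hle := Finset.card_le_card hsub
  rwa [Finset.card_insert_of_notMem (by simp), (hr.isNClique y h.notMem_last).card_eq] at hle

lemma isPathTypeOn (hr : IsRank G k C r) (h : IsDescPath G C r L y) :
    IsPathTypeOn G k (C ∪ L.toFinset) := by
  induction h with
  | single y hy hB =>
    refine .base₂ _ ?_
    convert insert_isNClique hr hy hB using 1
    ext x
    simp
  | snoc l x y hl hy hxy ih =>
    rw [union_toFinset_append]
    have hyl := hl.notMem_of_isParent hxy
    have hnb := hl.nbrsIn_next hr hxy
    refine .grow _ y (backNbrs G r y) ih (hl.card_le hr) (by simp [hy, hyl])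
      (hl.backNbrs_subset_of_isParent hr hxy) (hr.isNClique y hy) ⟨x, hxy.1, ?_⟩ ?_
    · rw [ncard_neighborSet_inter, hl.nbrsIn_last hr, (hr.isNClique x hl.notMem_last).card_eq]
    · intro w hw
      rw [← hnb, mem_nbrsIn]
      exact ⟨fun h => ⟨hw, h⟩, fun h => h.2⟩

lemma exists_leaf (hr : IsRank G k C r) (hC : G.IsNClique k C) (h : IsDescPath G C r L y) :
    (∀ ℓ ∈ C, (nbrsIn G (C ∪ L.toFinset) ℓ).card = k) ∧ L = [y] ∨
      ∃ ℓ ∈ C, (nbrsIn G (C ∪ L.toFinset) ℓ).card = k ∧ ℓ ∉ backNbrs G r y := by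
  induction h with
  | single y hy hB =>
    refine .inl ⟨fun ℓ hℓ => ?_, rfl⟩
    have hins : C ∪ [y].toFinset = insert y C := by
      ext x
      simp
    rw [hins, nbrsIn_clique (insert_isNClique hr hy hB).isClique (Finset.mem_insert_of_mem hℓ),
      Finset.card_erase_of_mem (Finset.mem_insert_of_mem hℓ),
      (insert_isNClique hr hy hB).card_eq, Nat.add_sub_cancel]
  | snoc l x y hl hy hxy ih =>
    right
    obtain ⟨ℓ, hℓ, hℓk, hℓy⟩ : ∃ ℓ ∈ C, (nbrsIn G (C ∪ l.toFinset) ℓ).card = k ∧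
        ℓ ∉ backNbrs G r y := by
      rcases ih with ⟨hall, rfl⟩ | ⟨ℓ, hℓ, hℓk, hℓx⟩
      · have : ¬ C ⊆ backNbrs G r y := fun hsub => by
          have := Finset.eq_of_subset_of_card_le hsub
            (by rw [hC.card_eq, (hr.isNClique y hy).card_eq])
          exact hl.notMem_last (this ▸ hxy.1)
        obtain ⟨ℓ, hℓ, hℓy⟩ := Finset.not_subset.1 this
        exact ⟨ℓ, hℓ, hall ℓ hℓ, hℓy⟩
      · refine ⟨ℓ, hℓ, hℓk, fun hℓy => ?_⟩
        rcases Finset.mem_insert.1 (hr.backNbrs_subset_insert hl.notMem_last hxy hℓy) with e | e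
        · exact hl.notMem_last (e ▸ hℓ)
        · exact hℓx e
    refine ⟨ℓ, hℓ, ?_, hℓy⟩
    rwa [union_toFinset_append, nbrsIn_insert_of_not_adj]
    rwa [hr.adj_iff_mem_backNbrs hℓ hy]

lemma isCanonPath (hr : IsRank G k C r) (hC : G.IsNClique k C) (hk : 1 ≤ k)
    (h : IsDescPath G C r L y) : IsCanonPath G k C L := by
  refine ⟨List.ne_nil_of_mem h.mem, h.nodup, h.notMem, h.isPathTypeOn hr, ?_, h.isPEO hr⟩
  simp only [coe_union_setOf_mem, ncard_neighborSet_inter]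
  rcases h.exists_leaf hr hC with ⟨hall, -⟩ | ⟨ℓ, hℓ, hℓk, -⟩
  · obtain ⟨ℓ, hℓ⟩ : C.Nonempty := Finset.card_pos.1 (by rw [hC.card_eq]; omega)
    exact ⟨ℓ, hℓ, hall ℓ hℓ⟩
  · exact ⟨ℓ, hℓ, hℓk⟩

end IsDescPath

namespace IsPEO

lemma nbrsIn_eq_backNbrs (hr : IsRank G k C r) {l : List V} {v : V} (hvC : v ∉ C) (hvl : v ∉ l)
    (hdeg : (nbrsIn G (C ∪ l.toFinset) v).card = k)
    (hl : ∀ w ∈ l, backNbrs G r w ⊆ C ∪ l.toFinset) :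
    nbrsIn G (C ∪ l.toFinset) v = backNbrs G r v := by
  refine Finset.eq_of_subset_of_card_le (fun u hu => ?_)
    (by rw [hdeg, (hr.isNClique v hvC).card_eq])
  rw [mem_nbrsIn, Finset.mem_union, List.mem_toFinset, G.adj_comm] at hu
  obtain ⟨hu | hu, hadj⟩ := hu
  · rwa [← hr.adj_iff_mem_backNbrs hu hvC]
  · refine ((hr.adj_iff hvC).1 hadj).resolve_right fun hv => ?_
    have := hl u hu hv
    simp [hvC, hvl] at this

lemma backNbrs_subset (hr : IsRank G k C r) (h : IsPEO G k C L) :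
    ∀ w ∈ L, backNbrs G r w ⊆ C ∪ L.toFinset := by
  induction h with
  | nil => simp
  | snoc l v _ hvC hvl hdeg ih =>
    rw [coe_union_setOf_mem, ncard_neighborSet_inter] at hdeg
    intro w hw
    rw [union_toFinset_append]
    refine Finset.Subset.trans ?_ (Finset.subset_insert _ _)
    rcases List.mem_append.1 hw with hw | hw
    · exact ih w hw
    · rw [List.mem_singleton.1 hw, ← nbrsIn_eq_backNbrs hr hvC hvl hdeg ih]
      exact fun u hu => (mem_nbrsIn.1 hu).1

lemma isDescPath_or (hr : IsRank G k C r) (hC : G.IsNClique k C) {ℓ : V} (hℓ : ℓ ∈ C)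
    (h : IsPEO G k C L) : L ≠ [] → (nbrsIn G (C ∪ L.toFinset) ℓ).card ≤ k →
      (∃ y, IsDescPath G C r L y) ∨ HasThreeLeaves G k (C ∪ L.toFinset) := by
  induction h with
  | nil => simp
  | snoc l v hl hvC hvl hdeg ih =>
    intro _ hℓk
    rw [coe_union_setOf_mem, ncard_neighborSet_inter] at hdeg
    have hnb := nbrsIn_eq_backNbrs hr hvC hvl hdeg (hl.backNbrs_subset hr)
    have hcl := hr.isNClique v hvC
    have hvS : v ∉ C ∪ l.toFinset := by simp [hvC, hvl]
    rw [union_toFinset_append] at hℓk ⊢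
    rcases eq_or_ne l [] with rfl | hne
    · refine .inl ⟨v, .single v hvC (Finset.eq_of_subset_of_card_le (fun u hu => ?_) ?_)⟩
      · rw [← hnb, mem_nbrsIn] at hu
        simpa using hu.1
      · rw [hcl.card_eq, hC.card_eq]
    rcases ih hne ((Finset.card_le_card (nbrsIn_mono (Finset.subset_insert _ _) ℓ)).trans hℓk)
      with ⟨x, hx⟩ | h3
    swap
    · exact .inr (h3.insert hvS (hnb ▸ hcl))
    by_cases hxv : x ∈ backNbrs G r v
    · refine .inl ⟨v, .snoc l x v hx hvC ⟨hxv, fun u hu => ?_⟩⟩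
      rw [← hnb, mem_nbrsIn] at hu
      exact hx.rank_le_of_mem_union hr u hu.1
    right
    obtain ⟨a, t, rfl, ha⟩ := hx.exists_head
    have haC : a ∉ C := hx.notMem a (by simp)
    have hsub : insert a (C.erase ℓ) ⊆ nbrsIn G (insert v (C ∪ (a :: t).toFinset)) ℓ := by
      refine Finset.insert_subset ?_ fun c hc => ?_
      · rw [mem_nbrsIn, hr.adj_iff_mem_backNbrs hℓ haC, ha]
        simp [hℓ]
      · rw [Finset.mem_erase] at hc
        rw [mem_nbrsIn]
        exact ⟨by simp [hc.2], hC.isClique hℓ hc.2 hc.1.symm⟩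
    have hcard : (insert a (C.erase ℓ)).card = k := by
      rw [Finset.card_insert_of_notMem (by simp [haC]), Finset.card_erase_add_one hℓ, hC.card_eq]
    have heq := Finset.eq_of_subset_of_card_le hsub (hcard ▸ hℓk)
    have hℓv : ¬ G.Adj ℓ v := by
      intro hadj
      have : v ∈ insert a (C.erase ℓ) := heq ▸ mem_nbrsIn.2 ⟨by simp, hadj⟩
      rcases Finset.mem_insert.1 this with e | e
      · exact hvl (by simp [e])
      · exact hvC (Finset.mem_of_mem_erase e)
    have hvx : ¬ G.Adj x v := fun hadj =>
      hxv (hnb ▸ mem_nbrsIn.2 ⟨Finset.mem_union_right _ (List.mem_toFinset.2 hx.mem), hadj.symm⟩)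
    have hℓx : ¬ G.Adj ℓ x := by
      intro hadj
      have : x ∈ insert a (C.erase ℓ) := heq ▸ mem_nbrsIn.2
        ⟨Finset.mem_insert_of_mem (Finset.mem_union_right _ (List.mem_toFinset.2 hx.mem)), hadj⟩
      rcases Finset.mem_insert.1 this with rfl | e
      · obtain ⟨l', hl'⟩ := hx.exists_eq_append
        have hnd := hx.nodup
        rcases l' with _ | ⟨b, l'⟩
        · obtain rfl : t = [] := by simpa using hl'
          refine hℓv ((hr.adj_iff_mem_backNbrs hℓ hvC).2 ?_)
          have hsub' : backNbrs G r v ⊆ C := by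
            intro u hu
            have hux : u ≠ x := fun e => hxv (e ▸ hu)
            rw [← hnb, mem_nbrsIn] at hu
            simpa [hux] using hu.1
          rwa [Finset.eq_of_subset_of_card_le hsub' (by rw [hcl.card_eq, hC.card_eq])]
        · simp only [List.cons_append, List.cons.injEq] at hl'
          simp [hl'.2] at hnd
      · exact hx.notMem_last (Finset.mem_of_mem_erase e)
    refine ⟨ℓ, by simp [hℓ], x, ?_, v, by simp, ?_, ?_, ?_, hℓx, hℓv, hvx, ?_, ?_, ?_⟩
    · exact Finset.mem_insert_of_mem (Finset.mem_union_right _ (List.mem_toFinset.2 hx.mem))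
    · exact ne_of_mem_of_not_mem hℓ hx.notMem_last
    · exact ne_of_mem_of_not_mem hℓ hvC
    · exact ne_of_mem_of_not_mem hx.mem hvl
    · rw [← heq, hcard]
    · rw [nbrsIn_insert_of_not_adj hvx, hx.nbrsIn_last hr,
        (hr.isNClique x hx.notMem_last).card_eq]
    · rw [nbrsIn_insert_of_not_adj (G.loopless.irrefl v), hdeg]

end IsPEO

/-- A canonical sequence is a descending path. -/
lemma IsCanonPath.exists_isDescPath (hr : IsRank G k C r) (hC : G.IsNClique k C)
    (h : IsCanonPath G k C L) : ∃ y, IsDescPath G C r L y := by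
  obtain ⟨hne, -, -, hpt, ⟨ℓ, hℓ, hℓk⟩, hpeo⟩ := h
  rw [coe_union_setOf_mem, ncard_neighborSet_inter] at hℓk
  refine (hpeo.isDescPath_or hr hC hℓ hne hℓk.le).resolve_right ?_
  rintro ⟨a, ha, b, hb, c, hc, hab, hac, hbc, nab, -, -, ka, kb, kc⟩
  refine hpt.leaves.2 ?_ a ha b hb c hc hab hac hbc ka kb kc
  have hsub : insert a (insert b (nbrsIn G (C ∪ L.toFinset) b)) ⊆ C ∪ L.toFinset :=
    Finset.insert_subset ha (Finset.insert_subset hb fun y hy => (mem_nbrsIn.1 hy).1)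
  have hle := Finset.card_le_card hsub
  rw [Finset.card_insert_of_notMem, Finset.card_insert_of_notMem (by simp), kb] at hle
  · omega
  · simp [hab, G.adj_comm b a, nab]

lemma charTree_adj_none (hr : IsRank G k C r) (hC : G.IsNClique k C) (hk : 1 ≤ k)
    (y : {x : V // x ∉ C}) :
    (charTree G k C).Adj none (some y) ↔ backNbrs G r y = C := by
  simp only [charTree, SimpleGraph.fromRel_adj]
  constructor
  · rintro ⟨-, ⟨L, hL, -, ⟨-, z, hz, hhead⟩ | ⟨_, _, h, -⟩⟩ | ⟨L, hL, -, ⟨h, -⟩ | ⟨_, _, -, h, -⟩⟩⟩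
    · obtain ⟨v, hv⟩ := hL.exists_isDescPath hr hC
      obtain ⟨a, t, rfl, ha⟩ := hv.exists_head
      cases hz
      simp only [List.head?_cons, Option.some.injEq] at hhead
      rwa [← hhead]
    all_goals cases h
  · intro hy
    obtain ⟨L, v, hL, hpre, hv⟩ :=
      IsDescPath.exists_extension hr _ _ _ rfl (.single y.1 y.2 hy)
    refine ⟨by simp, .inl ⟨L, hL.isCanonPath hr hC hk, ⟨v, ?_, hv⟩, .inl ⟨trivial, y, rfl, ?_⟩⟩⟩
    · obtain ⟨l, rfl⟩ := hL.exists_eq_append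
      simp
    · obtain ⟨l, rfl⟩ := hpre
      simp

lemma charTree_adj_some (hr : IsRank G k C r) (hC : G.IsNClique k C) (hk : 1 ≤ k)
    (x y : {x : V // x ∉ C}) :
    (charTree G k C).Adj (some x) (some y) ↔ IsParent G r x y ∨ IsParent G r y x := by
  have hpar : ∀ x y : {x : V // x ∉ C}, IsParent G r x y ↔
      ∃ L : List V, IsCanonPath G k C L ∧
        (∃ v, L.getLast? = some v ∧ (G.neighborSet v).ncard = k) ∧ [x.val, y.val] <:+: L := by
    intro x y
    constructor
    · intro hxy
      obtain ⟨l, hl⟩ := IsDescPath.exists_path hr hC _ x.1 rfl x.2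
      obtain ⟨L, v, hL, hpre, hv⟩ :=
        IsDescPath.exists_extension hr _ _ _ rfl (.snoc l x.1 y.1 hl y.2 hxy)
      refine ⟨L, hL.isCanonPath hr hC hk, ⟨v, ?_, hv⟩, ?_⟩
      · obtain ⟨l, rfl⟩ := hL.exists_eq_append
        simp
      · obtain ⟨l', rfl⟩ := hl.exists_eq_append
        refine List.IsInfix.trans ?_ hpre.isInfix
        exact ⟨l', [], by simp⟩
    · rintro ⟨L, hL, -, hinf⟩
      obtain ⟨v, hv⟩ := hL.exists_isDescPath hr hC
      exact hv.isParent_of_consecutive hinf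
  have hne : IsParent G r x y ∨ IsParent G r y x → (some x : Option {x : V // x ∉ C}) ≠ some y := by
    rintro h ⟨⟩
    have := h.elim (fun h => h.1) fun h => h.1
    simp at this
  simp only [charTree, SimpleGraph.fromRel_adj]
  constructor
  · rintro ⟨-, ⟨L, hL, hv, ⟨h, -⟩ | ⟨x', y', hx, hy, h⟩⟩ | ⟨L, hL, hv, ⟨h, -⟩ | ⟨x', y', hx, hy, h⟩⟩⟩
    · cases h
    · cases hx
      cases hy
      exact .inl ((hpar x y).2 ⟨L, hL, hv, h⟩)
    · cases h
    · cases hx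
      cases hy
      exact .inr ((hpar y x).2 ⟨L, hL, hv, h⟩)
  · intro h
    refine ⟨hne h, h.imp (fun h => ?_) fun h => ?_⟩
    · obtain ⟨L, hL, hv, hinf⟩ := (hpar x y).1 h
      exact ⟨L, hL, hv, .inr ⟨x, y, rfl, rfl, hinf⟩⟩
    · obtain ⟨L, hL, hv, hinf⟩ := (hpar y x).1 h
      exact ⟨L, hL, hv, .inr ⟨y, x, rfl, rfl, hinf⟩⟩

end Canonical

/-! ### Changing the root within a `(k + 1)`-clique -/

section Reroot

variable [Fintype V] [DecidableEq V] {G : SimpleGraph V} {k : ℕ} {C : Finset V} {c : V}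
  {r : V → ℕ}

/-- The rank which puts the vertices of `C` first and keeps the order of the others. -/
def rerootRank (C : Finset V) (r : V → ℕ) (v : V) : ℕ := if v ∈ C then 0 else r v + 1

omit [Fintype V] in
lemma rerootRank_of_mem {v : V} (hv : v ∈ C) : rerootRank C r v = 0 := if_pos hv

omit [Fintype V] in
lemma rerootRank_of_notMem {v : V} (hv : v ∉ C) : rerootRank C r v = r v + 1 := if_neg hv

lemma backNbrs_rerootRank (hr : IsRank G k (insert c C) r) {v : V} (hv : v ∉ insert c C) :
    backNbrs G (rerootRank C r) v = backNbrs G r v := by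
  have hvC : v ∉ C := fun h => hv (Finset.mem_insert_of_mem h)
  ext u
  simp only [mem_backNbrs, rerootRank_of_notMem hvC]
  refine and_congr_right fun _ => ?_
  by_cases hu : u ∈ C
  · rw [rerootRank_of_mem hu, (hr.eq_zero_iff u).2 (Finset.mem_insert_of_mem hu)]
    exact iff_of_true (Nat.succ_pos _) (hr.pos hv)
  · rw [rerootRank_of_notMem hu]
    omega

lemma backNbrs_rerootRank_self (hr : IsRank G k (insert c C) r) (hc : c ∉ C)
    (hQ : G.IsClique (insert c C : Finset V)) : backNbrs G (rerootRank C r) c = C := by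
  have hcQ := Finset.mem_insert_self c C
  ext u
  rw [mem_backNbrs, rerootRank_of_notMem hc, (hr.eq_zero_iff c).2 hcQ]
  constructor
  · rintro ⟨-, hu⟩
    by_contra huC
    rw [rerootRank_of_notMem huC] at hu
    omega
  · intro hu
    exact ⟨hQ (Finset.mem_insert_of_mem hu) hcQ (ne_of_mem_of_not_mem hu hc),
      by rw [rerootRank_of_mem hu]; exact Nat.succ_pos _⟩

lemma IsRank.reroot (hr : IsRank G k (insert c C) r) (hC : G.IsNClique k C) (hc : c ∉ C)
    (hQ : G.IsClique (insert c C : Finset V)) : IsRank G k C (rerootRank C r) where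
  eq_zero_iff v := by
    by_cases hv : v ∈ C
    · simp [rerootRank_of_mem, hv]
    · simp [rerootRank_of_notMem, hv]
  inj u v hv huv := by
    have hu : u ∉ C := by
      intro hu
      rw [rerootRank_of_mem hu, rerootRank_of_notMem hv] at huv
      omega
    rw [rerootRank_of_notMem hu, rerootRank_of_notMem hv, Nat.succ_inj] at huv
    by_cases hvQ : v ∈ insert c C
    · have huQ : u ∈ insert c C := by
        rwa [← hr.eq_zero_iff, huv, hr.eq_zero_iff]
      rw [(Finset.mem_insert.1 hvQ).resolve_right hv, (Finset.mem_insert.1 huQ).resolve_right hu]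
    · exact hr.inj u v hvQ huv
  isNClique v hv := by
    by_cases hvc : v = c
    · rw [hvc, backNbrs_rerootRank_self hr hc hQ]
      exact hC
    · rw [backNbrs_rerootRank hr (by simp [hvc, hv])]
      exact hr.isNClique v (by simp [hvc, hv])

lemma isParent_rerootRank (hr : IsRank G k (insert c C) r) {x v : V} (hx : x ∉ C)
    (hv : v ∉ insert c C) : IsParent G (rerootRank C r) x v ↔ IsParent G r x v := by
  simp only [IsParent, backNbrs_rerootRank hr hv, rerootRank_of_notMem hx]
  refine and_congr_right fun _ => forall₂_congr fun u _ => ?_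
  by_cases hu : u ∈ C
  · rw [rerootRank_of_mem hu, (hr.eq_zero_iff u).2 (Finset.mem_insert_of_mem hu)]
    simp
  · rw [rerootRank_of_notMem hu]
    omega

omit [DecidableEq V] in
lemma isParent_iff_of_mem {Q : Finset V} (hr : IsRank G k Q r) {x v : V} (hx : x ∈ Q) :
    IsParent G r x v ↔ x ∈ backNbrs G r v ∧ backNbrs G r v ⊆ Q := by
  refine and_congr_right fun _ => forall₂_congr fun u _ => ?_
  rw [(hr.eq_zero_iff x).2 hx, Nat.le_zero, hr.eq_zero_iff]

variable (hr : IsRank G k (insert c C) r) (hC : G.IsNClique k C) (hk : 1 ≤ k) (hc : c ∉ C)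
  (hQ : G.IsClique (insert c C : Finset V))

include hr hC hk hc hQ

lemma charTree_adj_none_self : (charTree G k C).Adj none (some ⟨c, hc⟩) := by
  rw [charTree_adj_none (hr.reroot hC hc hQ) hC hk]
  exact backNbrs_rerootRank_self hr hc hQ

lemma charTree_adj_none_iff {v : {x : V // x ∉ C}} (hv : v.1 ≠ c) :
    (charTree G k C).Adj none (some v) ↔ backNbrs G r v = C := by
  rw [charTree_adj_none (hr.reroot hC hc hQ) hC hk, backNbrs_rerootRank hr]
  simp [hv, v.2]

lemma charTree_adj_self_iff {v : {x : V // x ∉ C}} (hv : v.1 ≠ c) :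
    (charTree G k C).Adj (some ⟨c, hc⟩) (some v) ↔
      c ∈ backNbrs G r v ∧ backNbrs G r v ⊆ insert c C := by
  rw [charTree_adj_some (hr.reroot hC hc hQ) hC hk, isParent_rerootRank hr hc (by simp [hv, v.2]),
    isParent_iff_of_mem hr (Finset.mem_insert_self c C)]
  refine or_iff_left fun h => v.2 ?_
  have := h.1
  rwa [backNbrs_rerootRank_self hr hc hQ] at this

lemma charTree_adj_some_iff {x v : {x : V // x ∉ C}} (hx : x.1 ≠ c) (hv : v.1 ≠ c) :
    (charTree G k C).Adj (some x) (some v) ↔ IsParent G r x v ∨ IsParent G r v x := by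
  rw [charTree_adj_some (hr.reroot hC hc hQ) hC hk,
    isParent_rerootRank hr x.2 (by simp [hv, v.2]), isParent_rerootRank hr v.2 (by simp [hx, x.2])]

end Reroot

/-- The bijection between the vertices of the characteristic `1`-trees of two adjacent
`k`-cliques `C` and `D` which sends the root to `d`, sends `c` to the root and fixes all
other vertices. -/
def swapRoot [DecidableEq V] {C D : Finset V} {c d : V} (hc : c ∉ C) (hd : d ∉ D)
    (h : insert c C = insert d D) : Option {x : V // x ∉ C} ≃ Option {x : V // x ∉ D} where
  toFun
    | none => some ⟨d, hd⟩
    | some x => if hx : x.1 = c then none else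
        some ⟨x, fun hxD => (Finset.mem_insert.1 (h ▸ Finset.mem_insert_of_mem hxD)).elim hx x.2⟩
  invFun
    | none => some ⟨c, hc⟩
    | some x => if hx : x.1 = d then none else
        some ⟨x, fun hxC => (Finset.mem_insert.1 (h ▸ Finset.mem_insert_of_mem hxC)).elim hx x.2⟩
  left_inv := by
    rintro (_ | ⟨x, hx⟩)
    · simp
    · by_cases hxc : x = c
      · simp [hxc]
      · have : x ≠ d := by
          rintro rfl
          have : x ∈ insert c C := h ▸ Finset.mem_insert_self x D
          simp [hxc, hx] at this
        simp [hxc, this]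
  right_inv := by
    rintro (_ | ⟨x, hx⟩)
    · simp
    · by_cases hxd : x = d
      · simp [hxd]
      · have : x ≠ c := by
          rintro rfl
          have : x ∈ insert d D := h ▸ Finset.mem_insert_self x C
          simp [hxd, hx] at this
        simp [hxd, this]

section PartialKelmans

variable {H : SimpleGraph V} {u v a b : V} {W : Set V}

lemma pkelmans_adj_source_target (huv : v ≠ u) (hu : u ∉ W) :
    (pkelmans H v u W).Adj u v ↔ H.Adj u v := by
  have h₁ := H.adj_comm u v
  have h₂ := H.loopless.irrefl v
  simp only [pkelmans, SimpleGraph.fromRel_adj]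
  grind

lemma pkelmans_adj_target (huv : v ≠ u) (hbu : b ≠ u) (hbv : b ≠ v) :
    (pkelmans H v u W).Adj u b ↔ H.Adj u b ∨ b ∈ W ∧ H.Adj v b := by
  have h₁ := H.adj_comm u b
  simp only [pkelmans, SimpleGraph.fromRel_adj]
  grind

lemma pkelmans_adj_source (huv : v ≠ u) (hbu : b ≠ u) (hbv : b ≠ v) :
    (pkelmans H v u W).Adj v b ↔ H.Adj v b ∧ b ∉ W := by
  have h₁ := H.adj_comm v b
  simp only [pkelmans, SimpleGraph.fromRel_adj]
  grind

lemma pkelmans_adj_of_ne (hau : a ≠ u) (hav : a ≠ v) (hbu : b ≠ u) (hbv : b ≠ v) :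
    (pkelmans H v u W).Adj a b ↔ H.Adj a b := by
  have h₁ := H.adj_comm a b
  have h₂ : H.Adj a b → a ≠ b := fun h => h.ne
  simp only [pkelmans, SimpleGraph.fromRel_adj]
  grind

end PartialKelmans

/-- Let `T` be a nontrivial `k`-tree and `C₁, C₂` adjacent `k`-cliques
of `T`, and let `c₂` be the unique vertex of `C₂ ∖ C₁`.  Then the characteristic
`1`-tree `T'_{C₂}` is isomorphic to a tree obtained from `T'_{C₁}` by a partial Kelmans
operation from the vertex `c₂` to the vertex `C₁` (here `none`), i.e. moving some subset
`W` of the neighbours of `c₂` other than `C₁` over to `C₁`. -/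
theorem charTree_pkelmans_iso {V : Type*} [Fintype V] [DecidableEq V]
    (k : ℕ) (hk : 1 ≤ k) (G : SimpleGraph V) (hG : IsKTree G k)
    (hnontriv : k < Fintype.card V)
    (C₁ C₂ : Finset V) (hC₁ : G.IsNClique k C₁) (hC₂ : G.IsNClique k C₂)
    (hadj : CliqueAdj G k C₁ C₂)
    (c₂ : V) (hc₂ : C₂ \ C₁ = {c₂}) (hc₂' : c₂ ∉ C₁) :
    ∃ W : Set (Option {x : V // x ∉ C₁}),
      W ⊆ (charTree G k C₁).neighborSet (some ⟨c₂, hc₂'⟩) \ {none} ∧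
        Nonempty
          ((pkelmans (charTree G k C₁) (some ⟨c₂, hc₂'⟩) none W) ≃g charTree G k C₂) := by
  obtain ⟨-, Q, hQ, hQ₁, hQ₂⟩ := hadj
  have hc₂m : c₂ ∈ C₂ ∧ c₂ ∉ C₁ := by
    rw [← Finset.mem_sdiff, hc₂, Finset.mem_singleton]
  have hcard₁ := hC₁.card_eq
  have hcard₂ := hC₂.card_eq
  obtain ⟨c₁, hc₁⟩ : ∃ c₁, C₁ \ C₂ = {c₁} := by
    rw [← Finset.card_eq_one, Finset.card_sdiff_comm (hcard₁.trans hcard₂.symm), hc₂,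
      Finset.card_singleton]
  have hc₁m : c₁ ∈ C₁ ∧ c₁ ∉ C₂ := by
    rw [← Finset.mem_sdiff, hc₁, Finset.mem_singleton]
  have hQe₁ : insert c₂ C₁ = Q := by
    refine Finset.eq_of_subset_of_card_le (Finset.insert_subset (hQ₂ hc₂m.1) hQ₁) ?_
    rw [Finset.card_insert_of_notMem hc₂', hQ.card_eq, hcard₁]
  have hQe₂ : insert c₁ C₂ = Q := by
    refine Finset.eq_of_subset_of_card_le (Finset.insert_subset (hQ₁ hc₁m.1) hQ₂) ?_
    rw [Finset.card_insert_of_notMem hc₁m.2, hQ.card_eq, hcard₂]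
  obtain ⟨r, hr⟩ := hG.exists_isRank hQ
  have hcl₁ : G.IsClique (insert c₂ C₁ : Finset V) := hQe₁ ▸ hQ.isClique
  have hcl₂ : G.IsClique (insert c₁ C₂ : Finset V) := hQe₂ ▸ hQ.isClique
  have hr₁ : IsRank G k (insert c₂ C₁) r := hQe₁ ▸ hr
  have hr₂ : IsRank G k (insert c₁ C₂) r := hQe₂ ▸ hr
  have key : ∀ {C : Finset V} {c d : V}, insert c C = Q → c ∉ C → d ∈ C → G.IsNClique k C →
      ∀ v ∉ Q, backNbrs G r v = C ↔
        (d ∈ backNbrs G r v ∧ backNbrs G r v ⊆ Q) ∧ c ∉ backNbrs G r v := by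
    rintro C c d rfl hc hd hC v hv
    constructor
    · rintro h
      rw [h]
      exact ⟨⟨hd, Finset.subset_insert _ _⟩, hc⟩
    · rintro ⟨⟨-, hsub⟩, hcv⟩
      refine Finset.eq_of_subset_of_card_le ((Finset.subset_insert_iff_of_notMem hcv).1 hsub) ?_
      rw [hC.card_eq, (hr.isNClique v hv).card_eq]
  have hnotin : ∀ v : {x : V // x ∉ C₁}, v.1 ≠ c₂ → v.1 ∉ Q := by
    intro v hv hvQ
    rw [← hQe₁] at hvQ
    exact (Finset.mem_insert.1 hvQ).elim hv v.2
  set W : Set (Option {x : V // x ∉ C₁}) := {b | ∃ v : {x : V // x ∉ C₁}, b = some v ∧ v.1 ≠ c₂ ∧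
    c₁ ∈ backNbrs G r v ∧ c₂ ∈ backNbrs G r v ∧ backNbrs G r v ⊆ Q} with hW
  have hnoneW : none ∉ W := by simp [hW]
  have hmemW : ∀ v : {x : V // x ∉ C₁}, v.1 ≠ c₂ → (some v ∈ W ↔
      c₁ ∈ backNbrs G r v ∧ c₂ ∈ backNbrs G r v ∧ backNbrs G r v ⊆ Q) := by
    intro v hv
    simp only [hW, Set.mem_ofPred_eq, Option.some.injEq, exists_eq_left', hv, ne_eq,
      not_false_eq_true, true_and]
  set φ := swapRoot hc₂' hc₁m.2 (hQe₁.trans hQe₂.symm) with hφ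
  refine ⟨W, ?_, ⟨φ, ?_⟩⟩
  · rintro _ ⟨v, rfl, hv, -, h₂, hsub⟩
    refine ⟨?_, by simp⟩
    rw [SimpleGraph.mem_neighborSet, charTree_adj_self_iff hr₁ hC₁ hk hc₂' hcl₁ hv, hQe₁]
    exact ⟨h₂, hsub⟩
  set K := pkelmans (charTree G k C₁) (some ⟨c₂, hc₂'⟩) none W with hK
  have hφnone : φ none = some ⟨c₁, hc₁m.2⟩ := rfl
  have hφc : φ (some ⟨c₂, hc₂'⟩) = none := by simp [hφ, swapRoot]
  have hφv : ∀ v : {x : V // x ∉ C₁}, v.1 ≠ c₂ → ∃ w : {x : V // x ∉ C₂},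
      φ (some v) = some w ∧ w.1 = v.1 ∧ w.1 ≠ c₁ := by
    intro v hv
    exact ⟨⟨v, fun h => hnotin v hv (hQ₂ h)⟩, by simp [hφ, swapRoot, hv], rfl,
      fun e => hnotin v hv (by rw [← e] at hc₁m; exact hQ₁ hc₁m.1)⟩
  have hsource : (some ⟨c₂, hc₂'⟩ : Option {x : V // x ∉ C₁}) ≠ none := by simp
  have hother : ∀ v : {x : V // x ∉ C₁}, v.1 ≠ c₂ → some v ≠ some ⟨c₂, hc₂'⟩ := by
    rintro v hv ⟨⟩
    exact hv rfl
  have hroot : K.Adj none (some ⟨c₂, hc₂'⟩) ↔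
      (charTree G k C₂).Adj (φ none) (φ (some ⟨c₂, hc₂'⟩)) := by
    rw [hK, pkelmans_adj_source_target hsource hnoneW, hφnone, hφc]
    exact iff_of_true (charTree_adj_none_self hr₁ hC₁ hk hc₂' hcl₁)
      (charTree_adj_none_self hr₂ hC₂ hk hc₁m.2 hcl₂).symm
  have htarget : ∀ v : {x : V // x ∉ C₁}, v.1 ≠ c₂ →
      (K.Adj none (some v) ↔ (charTree G k C₂).Adj (φ none) (φ (some v))) := by
    intro v hv
    obtain ⟨w, hw, hwv, hwc⟩ := hφv v hv
    rw [hK, pkelmans_adj_target hsource (by simp) (hother v hv), hφnone, hw,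
      charTree_adj_self_iff hr₂ hC₂ hk hc₁m.2 hcl₂ hwc, hwv, hQe₂,
      charTree_adj_none_iff hr₁ hC₁ hk hc₂' hcl₁ hv,
      charTree_adj_self_iff hr₁ hC₁ hk hc₂' hcl₁ hv, hQe₁, hmemW v hv,
      key hQe₁ hc₂' hc₁m.1 hC₁ v (hnotin v hv)]
    tauto
  have hsrc : ∀ v : {x : V // x ∉ C₁}, v.1 ≠ c₂ →
      (K.Adj (some ⟨c₂, hc₂'⟩) (some v) ↔
        (charTree G k C₂).Adj (φ (some ⟨c₂, hc₂'⟩)) (φ (some v))) := by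
    intro v hv
    obtain ⟨w, hw, hwv, hwc⟩ := hφv v hv
    rw [hK, pkelmans_adj_source hsource (by simp) (hother v hv), hφc, hw,
      charTree_adj_none_iff hr₂ hC₂ hk hc₁m.2 hcl₂ hwc, hwv,
      charTree_adj_self_iff hr₁ hC₁ hk hc₂' hcl₁ hv, hQe₁, hmemW v hv,
      key hQe₂ hc₁m.2 hc₂m.1 hC₂ v (hnotin v hv)]
    tauto
  rintro (_ | ⟨x, hx⟩) (_ | ⟨y, hy⟩)
  · simp
  · by_cases hyc : y = c₂
    · subst hyc
      exact hroot.symm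
    · exact (htarget ⟨y, hy⟩ hyc).symm
  · rw [SimpleGraph.adj_comm, K.adj_comm]
    by_cases hxc : x = c₂
    · subst hxc
      exact hroot.symm
    · exact (htarget ⟨x, hx⟩ hxc).symm
  · by_cases hxc : x = c₂ <;> by_cases hyc : y = c₂
    · subst hxc
      subst hyc
      simp
    · subst hxc
      exact (hsrc ⟨y, hy⟩ hyc).symm
    · subst hyc
      rw [SimpleGraph.adj_comm, K.adj_comm]
      exact (hsrc ⟨x, hx⟩ hxc).symm
    · obtain ⟨x', hx', hxv, hxc'⟩ := hφv ⟨x, hx⟩ hxc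
      obtain ⟨y', hy', hyv, hyc'⟩ := hφv ⟨y, hy⟩ hyc
      rw [hx', hy', charTree_adj_some_iff hr₂ hC₂ hk hc₁m.2 hcl₂ hxc' hyc', hxv, hyv, hK,
        pkelmans_adj_of_ne (by simp) (hother _ hxc) (by simp) (hother _ hyc),
        charTree_adj_some_iff hr₁ hC₁ hk hc₂' hcl₁ hxc hyc]
end

section
/- For any k-tree T, the maximum over all k-cliques C of the local mean order μ(T; C) of sub-k-trees containing C is attained at a k-clique of degree at most 2 (i.e., at a non-major k-clique). -/
open Finset

variable {V : Type*}

namespace KTree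

/-- `KTreeFrom G k C s` : the `k`-tree on `s` can be grown from the `k`-clique `C`. -/
inductive KTreeFrom [DecidableEq V] (G : SimpleGraph V) (k : ℕ) (C : Finset V) :
    Finset V → Prop
  | base : G.IsNClique k C → KTreeFrom G k C C
  | grow (s : Finset V) (v : V) (K : Finset V) :
      KTreeFrom G k C s → v ∉ s → K ⊆ s → G.IsNClique k K →
      (∀ w ∈ s, G.Adj v w ↔ w ∈ K) → KTreeFrom G k C (insert v s)

section Structure

variable [DecidableEq V] {G : SimpleGraph V} {k : ℕ} {C D s : Finset V}

theorem KTreeFrom.isKTreeOn (h : KTreeFrom G k C s) : IsKTreeOn G k s := by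
  induction h with
  | base hC => exact .base _ hC
  | grow s v K _ hv hK hKc hadj ih => exact .grow s v K ih hv hK hKc hadj

theorem KTreeFrom.subset (h : KTreeFrom G k C s) : C ⊆ s := by
  induction h with
  | base hC => exact Subset.rfl
  | grow s v K _ hv hK hKc hadj ih => exact ih.trans (subset_insert _ _)

theorem KTreeFrom.isNClique (h : KTreeFrom G k C s) : G.IsNClique k C := by
  induction h with
  | base hC => exact hC
  | grow s v K _ hv hK hKc hadj ih => exact ih

theorem isNClique_erase {B : Finset V} (hB : G.IsNClique (k + 1) B) {u : V} (hu : u ∈ B) :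
    G.IsNClique k (B.erase u) := by
  refine ⟨hB.1.subset (by simp), ?_⟩
  rw [card_erase_of_mem hu, hB.2]; rfl

theorem KTreeFrom.swap_root {K : Finset V} {v w : V} (h : KTreeFrom G k K s)
    (hw : w ∈ K) (hv : v ∉ s) (hadj : ∀ x ∈ s, G.Adj v x ↔ x ∈ K) :
    KTreeFrom G k ((insert v K).erase w) (insert v s) := by
  induction h with
  | base hK =>
    have hB : G.IsNClique (k + 1) (insert v K) :=
      hK.insert fun x hx => (hadj x hx).2 hx
    have hwB : w ∈ insert v K := mem_insert_of_mem hw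
    have hC := isNClique_erase hB hwB
    have := KTreeFrom.grow _ w _ (.base hC) (by simp) Subset.rfl hC (fun x hx => by
      refine iff_of_true ?_ hx
      exact hB.1 (by exact_mod_cast hwB) (by exact_mod_cast mem_of_mem_erase hx)
        (ne_of_mem_erase hx).symm)
    rwa [insert_erase hwB] at this
  | grow s x L hs hx hL hLc hLadj ih =>
    have hvs : v ∉ s := fun h => hv (mem_insert_of_mem h)
    have ih := ih hvs fun y hy => hadj y (mem_insert_of_mem hy)
    rw [Finset.insert_comm]
    have hvx : v ≠ x := fun h => hv (h ▸ mem_insert_self _ _)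
    refine .grow _ x L ih (by simp [hx, hvx.symm]) (hL.trans (subset_insert _ _)) hLc ?_
    intro y hy
    rcases mem_insert.1 hy with rfl | hy
    · refine iff_of_false (fun h => ?_) (fun h => hvs (hL h))
      exact hx (hs.subset ((hadj x (mem_insert_self _ _)).1 h.symm))
    · exact hLadj y hy

theorem _root_.IsKTreeOn.exists_isNClique (h : IsKTreeOn G k s) : ∃ C, G.IsNClique k C := by
  cases h with
  | base s hs => exact ⟨s, hs⟩
  | grow s v K _ _ _ hK _ => exact ⟨K, hK⟩

/-- A `k`-tree can be grown from any of its `k`-cliques. -/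
theorem _root_.IsKTreeOn.kTreeFrom (h : IsKTreeOn G k s) (hC : G.IsNClique k C) (hCs : C ⊆ s) :
    KTreeFrom G k C s := by
  induction h generalizing C with
  | base s hs =>
    obtain rfl : C = s := eq_of_subset_of_card_le hCs (by rw [hs.2, hC.2])
    exact .base hC
  | grow s v K hs hv hK hKc hadj ih =>
    by_cases hvC : v ∈ C
    · have hsub : C.erase v ⊆ K := by
        intro x hx
        have hxv := ne_of_mem_erase hx
        have hxC := mem_of_mem_erase hx
        have hxs : x ∈ s := (mem_insert.1 (hCs hxC)).resolve_left hxv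
        exact (hadj x hxs).1 (hC.1 (by exact_mod_cast hvC) (by exact_mod_cast hxC) hxv.symm)
      have hpos : 0 < C.card := card_pos.2 ⟨v, hvC⟩
      have hlt : (C.erase v).card < K.card := by
        rw [card_erase_of_mem hvC, hC.2, hKc.2]; have := hC.2; omega
      obtain ⟨w, hwK, hwC⟩ := exists_mem_notMem_of_card_lt_card hlt
      have hvK : v ∉ K := fun h => hv (hK h)
      have hwv : w ≠ v := fun h => hvK (h ▸ hwK)
      have hCeq : C = (insert v K).erase w := by
        refine eq_of_subset_of_card_le (fun x hx => ?_) ?_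
        · refine mem_erase.2 ⟨?_, ?_⟩
          · rintro rfl; exact hwC (mem_erase.2 ⟨hwv, hx⟩)
          · by_cases hxv : x = v
            · simp [hxv]
            · exact mem_insert_of_mem (hsub (mem_erase.2 ⟨hxv, hx⟩))
        · rw [card_erase_of_mem (mem_insert_of_mem hwK), card_insert_of_notMem hvK, hKc.2, hC.2]
          rfl
      rw [hCeq]
      exact (ih hKc hK).swap_root hwK hv hadj
    · refine .grow s v K (ih hC fun x hx => (mem_insert.1 (hCs hx)).resolve_left ?_) hv hK hKc hadj
      rintro rfl; exact hvC hx

theorem KTreeFrom.union {A₁ A₂ : Finset V} (h₂ : KTreeFrom G k D A₂) (h₁ : IsKTreeOn G k A₁)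
    (hD : D ⊆ A₁) (hdisj : A₁ ∩ A₂ ⊆ D)
    (hsep : ∀ x ∈ A₁, x ∉ D → ∀ y ∈ A₂, y ∉ D → ¬ G.Adj x y) :
    IsKTreeOn G k (A₁ ∪ A₂) := by
  induction h₂ with
  | base hDc => rwa [union_eq_left.2 hD]
  | grow s v K hs hv hK hKc hadj ih =>
    have hss : s ⊆ insert v s := subset_insert _ _
    have ih := ih ((inter_subset_inter_left hss).trans hdisj)
      fun x hx hxD y hy hyD => hsep x hx hxD y (hss hy) hyD
    have hvD : v ∉ D := fun h => hv (hs.subset h)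
    have hvA : v ∉ A₁ := fun h => hvD (hdisj (mem_inter.2 ⟨h, mem_insert_self _ _⟩))
    rw [union_insert]
    refine .grow _ v K ih (by simp [hv, hvA]) (hK.trans subset_union_right) hKc fun w hw => ?_
    by_cases hws : w ∈ s
    · exact hadj w hws
    · have hwA : w ∈ A₁ := (mem_union.1 hw).resolve_right hws
      refine iff_of_false (fun h => ?_) (fun h => hws (hK h))
      exact hsep w hwA (fun h => hws (hs.subset h)) v (mem_insert_self _ _) hvD h.symm

theorem KTreeFrom.inter {A W : Finset V} (h : KTreeFrom G k D A) (hD : D ⊆ W)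
    (hsep : ∀ x ∈ A, x ∈ W → x ∉ D → ∀ y ∈ A, y ∉ W → ¬ G.Adj x y) :
    IsKTreeOn G k (A ∩ W) := by
  induction h with
  | base hDc => rw [inter_eq_left.2 hD]; exact .base _ hDc
  | grow s v K hs hv hK hKc hadj ih =>
    have hss : s ⊆ insert v s := subset_insert _ _
    have ih := ih fun x hx hxW hxD y hy hyW => hsep x (hss hx) hxW hxD y (hss hy) hyW
    by_cases hvW : v ∈ W
    · rw [insert_inter_of_mem hvW]
      refine .grow _ v K ih (by simp [hv]) (fun y hy => mem_inter.2 ⟨hK hy, ?_⟩) hKc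
        fun w hw => hadj w (mem_inter.1 hw).1
      by_contra hyW
      exact hsep v (mem_insert_self _ _) hvW (fun h => hv (hs.subset h)) y (hss (hK hy)) hyW
        ((hadj y (hK hy)).2 hy)
    · rwa [insert_inter_of_notMem hvW]

/-- `b` sends every vertex outside `C` to the vertex joined to all of `C` in its component
of `G - C`. -/
structure IsBranchMap (G : SimpleGraph V) (C s : Finset V) (b : V → V) : Prop where
  mem : ∀ x ∈ s, x ∉ C → b x ∈ s
  notMem : ∀ x ∈ s, x ∉ C → b x ∉ C
  adj : ∀ x ∈ s, x ∉ C → ∀ w ∈ C, G.Adj (b x) w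
  congr : ∀ x ∈ s, x ∉ C → ∀ y ∈ s, y ∉ C → G.Adj x y → b x = b y
  self : ∀ x ∈ s, x ∉ C → (∀ w ∈ C, G.Adj x w) → b x = x

theorem KTreeFrom.exists_branchMap (h : KTreeFrom G k C s) : ∃ b, IsBranchMap G C s b := by
  induction h with
  | base hC =>
    exact ⟨id, fun x h h' => (h' h).elim, fun x h h' => (h' h).elim, fun x h h' => (h' h).elim,
      fun x h h' => (h' h).elim, fun x h h' => (h' h).elim⟩
  | grow s v K hs hv hK hKc hadj ih =>
    obtain ⟨b, hb⟩ := ih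
    have hvC : v ∉ C := fun h => hv (hs.subset h)
    have key : ∃ r, r ∈ insert v s ∧ r ∉ C ∧ (∀ w ∈ C, G.Adj r w) ∧
        (∀ y ∈ K, y ∉ C → r = b y) ∧ ((∀ w ∈ C, G.Adj v w) → r = v) := by
      by_cases hKC : K ⊆ C
      · obtain rfl : K = C := eq_of_subset_of_card_le hKC (by rw [hKc.2, hs.isNClique.2])
        exact ⟨v, mem_insert_self _ _, hvC, fun w hw => (hadj w (hK hw)).2 hw,
          fun y hy hy' => (hy' hy).elim, fun _ => rfl⟩
      · obtain ⟨z, hzK, hzC⟩ := not_subset.1 hKC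
        have hzs := hK hzK
        refine ⟨b z, mem_insert_of_mem (hb.mem z hzs hzC), hb.notMem z hzs hzC,
          hb.adj z hzs hzC, fun y hy hyC => ?_, fun hall => ?_⟩
        · by_cases hzy : z = y
          · rw [hzy]
          · exact hb.congr z hzs hzC y (hK hy) hyC
              (hKc.1 (by exact_mod_cast hzK) (by exact_mod_cast hy) hzy)
        · have hCK : C ⊆ K := fun w hw => (hadj w (hs.subset hw)).1 (hall w hw)
          have : C = K := eq_of_subset_of_card_le hCK (by rw [hKc.2, hs.isNClique.2])
          exact (hzC (this ▸ hzK)).elim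
    obtain ⟨r, hrs, hrC, hrad, hrK, hrv⟩ := key
    have hne : ∀ x ∈ s, x ≠ v := fun x hx h => hv (h ▸ hx)
    refine ⟨Function.update b v r, ?_, ?_, ?_, ?_, ?_⟩
    · intro x hx hxC
      rcases mem_insert.1 hx with rfl | hx
      · simpa using hrs
      · rw [Function.update_of_ne (hne x hx)]; exact mem_insert_of_mem (hb.mem x hx hxC)
    · intro x hx hxC
      rcases mem_insert.1 hx with rfl | hx
      · simpa using hrC
      · rw [Function.update_of_ne (hne x hx)]; exact hb.notMem x hx hxC
    · intro x hx hxC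
      rcases mem_insert.1 hx with rfl | hx
      · simpa using hrad
      · rw [Function.update_of_ne (hne x hx)]; exact hb.adj x hx hxC
    · intro x hx hxC y hy hyC hxy
      rcases mem_insert.1 hx with hxv | hxs <;> rcases mem_insert.1 hy with hyv | hys
      · rw [hxv, hyv]
      · subst hxv
        rw [Function.update_of_ne (hne y hys), Function.update_self]
        exact hrK y ((hadj y hys).1 hxy) hyC
      · subst hyv
        rw [Function.update_of_ne (hne x hxs), Function.update_self]
        exact (hrK x ((hadj x hxs).1 hxy.symm) hxC).symm
      · rw [Function.update_of_ne (hne x hxs), Function.update_of_ne (hne y hys)]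
        exact hb.congr x hxs hxC y hys hyC hxy
    · intro x hx hxC hall
      rcases mem_insert.1 hx with rfl | hx
      · simpa using hrv hall
      · rw [Function.update_of_ne (hne x hx)]; exact hb.self x hx hxC hall

/-- A sub-`k`-tree containing `C` contains the branch vertex of each of its vertices. -/
theorem KTreeFrom.branch_mem {A : Finset V} (h : KTreeFrom G k C A) {b : V → V}
    (hb : IsBranchMap G C s b) (hA : A ⊆ s) : ∀ x ∈ A, x ∉ C → b x ∈ A := by
  induction h with
  | base hC => exact fun x hx hx' => (hx' hx).elim
  | grow t v K ht hv hK hKc hadj ih =>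
    have hts : t ⊆ s := (subset_insert _ _).trans hA
    have hvs : v ∈ s := hA (mem_insert_self _ _)
    intro x hx hxC
    rcases mem_insert.1 hx with rfl | hx
    · by_cases hKC : K ⊆ C
      · obtain rfl : K = C := eq_of_subset_of_card_le hKC (by rw [hKc.2, ht.isNClique.2])
        rw [hb.self x hvs hxC fun w hw => (hadj w (hK hw)).2 hw]
        exact mem_insert_self _ _
      · obtain ⟨z, hzK, hzC⟩ := not_subset.1 hKC
        rw [hb.congr x hvs hxC z (hts (hK hzK)) hzC ((hadj z (hK hzK)).2 hzK)]
        exact mem_insert_of_mem (ih hts z (hK hzK) hzC)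
    · exact mem_insert_of_mem (ih hts x hx hxC)

theorem KTreeFrom.exists_erase {A : Finset V} {u : V} (h : KTreeFrom G k C A)
    (hu : u ∈ A) (hadj : ∀ w ∈ C, G.Adj u w) (hne : A ≠ insert u C) :
    ∃ v ∈ A, v ∉ insert u C ∧ IsKTreeOn G k (A.erase v) := by
  cases h with
  | base hC => exact absurd (hadj u hu) G.irrefl
  | grow s v K hs hv hK hKc hKadj =>
    have hvC : v ∉ C := fun h => hv (hs.subset h)
    by_cases hvu : v = u
    · subst hvu
      have hCK : C ⊆ K := fun w hw => (hKadj w (hs.subset hw)).1 (hadj w hw)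
      obtain rfl : C = K := eq_of_subset_of_card_le hCK (by rw [hKc.2, hs.isNClique.2])
      cases hs with
      | base hC => exact absurd rfl hne
      | grow t x K' ht hx hK' hKc' hKadj' =>
        have hxv : x ≠ v := fun h => hv (h ▸ mem_insert_self _ _)
        have hvt : v ∉ t := fun h => hv (mem_insert_of_mem h)
        refine ⟨x, by simp, by simpa [hxv] using fun h => hx (ht.subset h), ?_⟩
        have : (insert v (insert x t)).erase x = insert v t := by
          rw [Finset.insert_comm, erase_insert (by simp [hx, hxv])]
        rw [this]
        exact .grow t v C ht.isKTreeOn hvt ht.subset hKc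
          fun w hw => hKadj w (mem_insert_of_mem hw)
    · refine ⟨v, mem_insert_self _ _, by simp [hvu, hvC], ?_⟩
      rw [erase_insert hv]
      exact hs.isKTreeOn

theorem isKTreeOn_insert {u : V} (hC : G.IsNClique k C) (huC : u ∉ C)
    (hadj : ∀ w ∈ C, G.Adj u w) : IsKTreeOn G k (insert u C) :=
  .grow C u C (.base _ hC) huC Subset.rfl hC fun w hw => iff_of_true (hadj w hw) hw

end Structure

section Families

variable [Fintype V] [DecidableEq V] {G : SimpleGraph V} {k : ℕ} {C D : Finset V}

open Classical in
/-- The sub-`k`-trees lying between `R` and `W`. -/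
noncomputable def between (G : SimpleGraph V) (k : ℕ) (R W : Finset V) : Finset (Finset V) :=
  univ.filter fun A => R ⊆ A ∧ A ⊆ W ∧ IsKTreeOn G k A

/-- The number of sub-`k`-trees between `R` and `W`. -/
noncomputable def count (G : SimpleGraph V) (k : ℕ) (R W : Finset V) : ℝ :=
  ((between G k R W).card : ℝ)

/-- The total number of vertices, not counting `k` for each tree, of the sub-`k`-trees
between `R` and `W`. -/
noncomputable def excess (G : SimpleGraph V) (k : ℕ) (R W : Finset V) : ℝ :=
  ∑ A ∈ between G k R W, ((A.card : ℝ) - k)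

theorem mem_between {R W A : Finset V} :
    A ∈ between G k R W ↔ R ⊆ A ∧ A ⊆ W ∧ IsKTreeOn G k A := by
  simp [between]

theorem sum_between_union {R₁ R₂ W₁ W₂ : Finset V} (hDc : G.IsNClique k D)
    (hD₁ : D ⊆ R₁) (hD₂ : D ⊆ R₂) (hR₁ : R₁ ⊆ W₁) (hR₂ : R₂ ⊆ W₂) (hW : W₁ ∩ W₂ ⊆ D)
    (hsep : ∀ x ∈ W₁, x ∉ D → ∀ y ∈ W₂, y ∉ D → ¬ G.Adj x y) (f : Finset V → ℝ) :
    ∑ A ∈ between G k (R₁ ∪ R₂) (W₁ ∪ W₂), f A =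
      ∑ p ∈ between G k R₁ W₁ ×ˢ between G k R₂ W₂, f (p.1 ∪ p.2) := by
  have hD : ∀ x, x ∈ W₁ → x ∈ W₂ → x ∈ D := fun x h h' => hW (mem_inter.2 ⟨h, h'⟩)
  refine sum_nbij' (fun A => (A ∩ W₁, A ∩ W₂)) (fun p => p.1 ∪ p.2) ?_ ?_ ?_ ?_ ?_
  · intro A hA
    obtain ⟨hRA, hAW, hT⟩ := mem_between.1 hA
    have hF := hT.kTreeFrom hDc (hD₁.trans (subset_union_left.trans hRA))
    refine mem_product.2 ⟨mem_between.2 ⟨?_, inter_subset_right, ?_⟩,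
      mem_between.2 ⟨?_, inter_subset_right, ?_⟩⟩
    · exact subset_inter (subset_union_left.trans hRA) hR₁
    · refine hF.inter (hD₁.trans hR₁) fun x _ hx hxD y hy hyW => ?_
      exact hsep x hx hxD y ((mem_union.1 (hAW hy)).resolve_left hyW)
        fun h => hyW (hR₁ (hD₁ h))
    · exact subset_inter (subset_union_right.trans hRA) hR₂
    · refine hF.inter (hD₂.trans hR₂) fun x _ hx hxD y hy hyW h => ?_
      exact hsep y ((mem_union.1 (hAW hy)).resolve_right hyW)
        (fun h => hyW (hR₂ (hD₂ h))) x hx hxD h.symm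
  · rintro ⟨A₁, A₂⟩ hp
    obtain ⟨h₁, h₂⟩ := mem_product.1 hp
    obtain ⟨hRA₁, hAW₁, hT₁⟩ := mem_between.1 h₁
    obtain ⟨hRA₂, hAW₂, hT₂⟩ := mem_between.1 h₂
    refine mem_between.2 ⟨union_subset_union hRA₁ hRA₂, union_subset_union hAW₁ hAW₂, ?_⟩
    exact (hT₂.kTreeFrom hDc (hD₂.trans hRA₂)).union hT₁ (hD₁.trans hRA₁)
      ((inter_subset_inter hAW₁ hAW₂).trans hW)
      fun x hx hxD y hy hyD => hsep x (hAW₁ hx) hxD y (hAW₂ hy) hyD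
  · intro A hA
    obtain ⟨hRA, hAW, hT⟩ := mem_between.1 hA
    simp only
    rw [← inter_union_distrib_left, inter_eq_left.2 hAW]
  · rintro ⟨A₁, A₂⟩ hp
    obtain ⟨h₁, h₂⟩ := mem_product.1 hp
    obtain ⟨hRA₁, hAW₁, hT₁⟩ := mem_between.1 h₁
    obtain ⟨hRA₂, hAW₂, hT₂⟩ := mem_between.1 h₂
    refine Prod.ext ?_ ?_
    · ext x
      simp only [mem_inter, mem_union]
      refine ⟨fun ⟨h, h'⟩ => h.elim id fun h => ?_, fun h => ⟨.inl h, hAW₁ h⟩⟩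
      exact hRA₁ (hD₁ (hD x h' (hAW₂ h)))
    · ext x
      simp only [mem_inter, mem_union]
      refine ⟨fun ⟨h, h'⟩ => h.elim (fun h => ?_) id, fun h => ⟨.inr h, hAW₂ h⟩⟩
      exact hRA₂ (hD₂ (hD x (hAW₁ h) h'))
  · intro A hA
    obtain ⟨hRA, hAW, hT⟩ := mem_between.1 hA
    simp only
    rw [← inter_union_distrib_left, inter_eq_left.2 hAW]

theorem count_union {R₁ R₂ W₁ W₂ : Finset V} (hDc : G.IsNClique k D)
    (hD₁ : D ⊆ R₁) (hD₂ : D ⊆ R₂) (hR₁ : R₁ ⊆ W₁) (hR₂ : R₂ ⊆ W₂) (hW : W₁ ∩ W₂ ⊆ D)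
    (hsep : ∀ x ∈ W₁, x ∉ D → ∀ y ∈ W₂, y ∉ D → ¬ G.Adj x y) :
    count G k (R₁ ∪ R₂) (W₁ ∪ W₂) = count G k R₁ W₁ * count G k R₂ W₂ := by
  have := sum_between_union hDc hD₁ hD₂ hR₁ hR₂ hW hsep (fun _ => 1)
  simpa [count] using this

theorem excess_union {R₁ R₂ W₁ W₂ : Finset V} (hDc : G.IsNClique k D)
    (hD₁ : D ⊆ R₁) (hD₂ : D ⊆ R₂) (hR₁ : R₁ ⊆ W₁) (hR₂ : R₂ ⊆ W₂) (hW : W₁ ∩ W₂ ⊆ D)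
    (hsep : ∀ x ∈ W₁, x ∉ D → ∀ y ∈ W₂, y ∉ D → ¬ G.Adj x y) :
    excess G k (R₁ ∪ R₂) (W₁ ∪ W₂) =
      excess G k R₁ W₁ * count G k R₂ W₂ + count G k R₁ W₁ * excess G k R₂ W₂ := by
  have hcard : ∀ p ∈ between G k R₁ W₁ ×ˢ between G k R₂ W₂,
      ((p.1 ∪ p.2).card : ℝ) - k = ((p.1.card : ℝ) - k) + ((p.2.card : ℝ) - k) := by
    rintro ⟨A₁, A₂⟩ hp
    obtain ⟨h₁, h₂⟩ := mem_product.1 hp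
    obtain ⟨hRA₁, hAW₁, -⟩ := mem_between.1 h₁
    obtain ⟨hRA₂, hAW₂, -⟩ := mem_between.1 h₂
    have hI : A₁ ∩ A₂ = D := ((inter_subset_inter hAW₁ hAW₂).trans hW).antisymm
      (subset_inter (hD₁.trans hRA₁) (hD₂.trans hRA₂))
    have h := card_union_add_card_inter A₁ A₂
    rw [hI, hDc.2] at h
    have h' : ((A₁ ∪ A₂).card : ℝ) + k = A₁.card + A₂.card := by exact_mod_cast h
    simp only
    linarith
  rw [excess, sum_between_union hDc hD₁ hD₂ hR₁ hR₂ hW hsep, sum_congr rfl hcard,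
    sum_add_distrib, sum_product, sum_product]
  simp only [sum_const, nsmul_eq_mul, excess, count, mul_sum, mul_comm]

theorem card_le_card_between {A : Finset V} {u : V} (hC : G.IsNClique k C) (huC : u ∉ C)
    (hadj : ∀ w ∈ C, G.Adj u w) (hA : IsKTreeOn G k A) (hsub : insert u C ⊆ A) :
    A.card ≤ (between G k (insert u C) A).card + k := by
  induction h : A.card generalizing A with
  | zero =>
    exact Nat.zero_le _
  | succ n ih =>
    have hself : A ∈ between G k (insert u C) A := mem_between.2 ⟨hsub, Subset.rfl, hA⟩
    by_cases hne : A = insert u C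
    · have h1 := card_pos.2 ⟨A, hself⟩
      have h2 : A.card = k + 1 := by rw [hne, card_insert_of_notMem huC, hC.2]
      omega
    · obtain ⟨v, hvA, hv, hT⟩ := (hA.kTreeFrom hC ((subset_insert _ _).trans hsub)).exists_erase
        (hsub (mem_insert_self _ _)) hadj hne
      have hcard := card_erase_of_mem hvA
      have ih := ih hT (fun x hx => mem_erase.2 ⟨fun h => hv (h ▸ hx), hsub hx⟩) (by omega)
      have hlt : (between G k (insert u C) (A.erase v)).card <
          (between G k (insert u C) A).card := by
        refine card_lt_card (ssubset_iff_of_subset (fun X hX => ?_) |>.2 ⟨A, hself, fun h => ?_⟩)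
        · obtain ⟨h1, h2, h3⟩ := mem_between.1 hX
          exact mem_between.2 ⟨h1, h2.trans (erase_subset _ _), h3⟩
        · exact notMem_erase v A ((mem_between.1 h).2.1 hvA)
      omega

theorem excess_insert_le {W : Finset V} {u : V} (hC : G.IsNClique k C) (huC : u ∉ C)
    (hadj : ∀ w ∈ C, G.Adj u w) :
    excess G k (insert u C) W ≤ count G k (insert u C) W * count G k (insert u C) W := by
  rw [excess, count, ← nsmul_eq_mul]
  refine sum_le_card_nsmul _ _ _ fun A hA => ?_
  obtain ⟨h1, h2, h3⟩ := mem_between.1 hA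
  have h := card_le_card_between hC huC hadj h3 h1
  have h' : (between G k (insert u C) A).card ≤ (between G k (insert u C) W).card := by
    refine card_le_card fun X hX => ?_
    obtain ⟨hX1, hX2, hX3⟩ := mem_between.1 hX
    exact mem_between.2 ⟨hX1, hX2.trans h2, hX3⟩
  have : (A.card : ℝ) ≤ (between G k (insert u C) W).card + k := by
    exact_mod_cast h.trans (Nat.add_le_add_right h' k)
  linarith

theorem count_le_excess_insert {W : Finset V} {u : V} (hC : G.IsNClique k C) (huC : u ∉ C) :
    count G k (insert u C) W ≤ excess G k (insert u C) W := by
  rw [excess, count, ← mul_one ((between G k (insert u C) W).card : ℝ), ← nsmul_eq_mul]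
  refine card_nsmul_le_sum _ _ _ fun A hA => ?_
  have h := card_le_card (mem_between.1 hA).1
  rw [card_insert_of_notMem huC, hC.2] at h
  have : (k : ℝ) + 1 ≤ A.card := by exact_mod_cast h
  linarith

theorem one_le_count {R W : Finset V} (hR : IsKTreeOn G k R) (hRW : R ⊆ W) :
    1 ≤ count G k R W := by
  have : 0 < (between G k R W).card := card_pos.2 ⟨R, mem_between.2 ⟨Subset.rfl, hRW, hR⟩⟩
  rw [count]
  exact_mod_cast this

theorem sum_between_erase (W : Finset V) (v : V) (f : Finset V → ℝ) :
    ∑ A ∈ between G k C W, f A =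
      ∑ A ∈ between G k C (W.erase v), f A + ∑ A ∈ between G k (insert v C) W, f A := by
  rw [← sum_filter_add_sum_filter_not (between G k C W) (fun A => v ∉ A)]
  congr 1
  · refine sum_congr ?_ fun _ _ => rfl
    ext A
    simp only [mem_filter, mem_between, subset_erase]
    tauto
  · refine sum_congr ?_ fun _ _ => rfl
    ext A
    simp only [mem_filter, mem_between, insert_subset_iff]
    tauto

theorem count_eq_erase_add (W : Finset V) (v : V) :
    count G k C W = count G k C (W.erase v) + count G k (insert v C) W := by
  simpa [count] using sum_between_erase (G := G) (k := k) (C := C) W v (fun _ => 1)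

theorem excess_eq_erase_add (W : Finset V) (v : V) :
    excess G k C W = excess G k C (W.erase v) + excess G k (insert v C) W :=
  sum_between_erase W v _

theorem between_self (hC : G.IsNClique k C) : between G k C C = {C} := by
  ext A
  simp only [mem_between, mem_singleton]
  refine ⟨fun h => h.2.1.antisymm h.1, ?_⟩
  rintro rfl
  exact ⟨Subset.rfl, Subset.rfl, .base _ hC⟩

theorem kMean_eq (hC : G.IsNClique k C) :
    kMean G k C = k + excess G k C univ / count G k C univ := by
  have hs : subKTrees G k C = between G k C univ := by
    ext A; simp [subKTrees, between]
  have h1 : 1 ≤ count G k C univ := one_le_count (.base _ hC) (subset_univ _)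
  have hex : excess G k C univ =
      (∑ A ∈ between G k C univ, (A.card : ℝ)) - count G k C univ * k := by
    rw [excess, sum_sub_distrib, sum_const, nsmul_eq_mul, count]
  rw [kMean, hs, hex, sub_div, mul_div_cancel_left₀ _ (by positivity), count]
  ring

end Families

section Branches

variable [Fintype V] [DecidableEq V] {G : SimpleGraph V} {k : ℕ} {C : Finset V} {b : V → V}

/-- The union of `C` and the branches at `C` whose branch vertex lies in `I`. -/
def region (C : Finset V) (b : V → V) (I : Finset V) : Finset V :=
  univ.filter fun x => x ∈ C ∨ b x ∈ I

open Classical in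
/-- The vertices outside `C` joined to all of `C`. -/
noncomputable def apexes (G : SimpleGraph V) (C : Finset V) : Finset V :=
  univ.filter fun v => v ∉ C ∧ ∀ w ∈ C, G.Adj v w

@[simp] theorem mem_region {I : Finset V} {x : V} : x ∈ region C b I ↔ x ∈ C ∨ b x ∈ I := by
  simp [region]

theorem mem_apexes {v : V} : v ∈ apexes G C ↔ v ∉ C ∧ ∀ w ∈ C, G.Adj v w := by
  simp [apexes]

theorem subset_region (I : Finset V) : C ⊆ region C b I := fun _ hx => mem_region.2 (.inl hx)

theorem region_union (I J : Finset V) :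
    region C b (I ∪ J) = region C b I ∪ region C b J := by
  ext x; simp only [mem_region, mem_union]; tauto

theorem region_inter {I J : Finset V} (h : Disjoint I J) :
    region C b I ∩ region C b J ⊆ C := by
  intro x hx
  simp only [mem_region, mem_inter] at hx
  by_contra hxC
  exact disjoint_left.1 h (hx.1.resolve_left hxC) (hx.2.resolve_left hxC)

theorem IsBranchMap.not_adj (hb : IsBranchMap G C univ b) {I J : Finset V} (h : Disjoint I J) :
    ∀ x ∈ region C b I, x ∉ C → ∀ y ∈ region C b J, y ∉ C → ¬ G.Adj x y := by
  intro x hx hxC y hy hyC hxy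
  have h1 := (mem_region.1 hx).resolve_left hxC
  rw [hb.congr x (mem_univ _) hxC y (mem_univ _) hyC hxy] at h1
  exact disjoint_left.1 h h1 ((mem_region.1 hy).resolve_left hyC)

theorem IsBranchMap.eq_of_mem_apexes (hb : IsBranchMap G C univ b) {v : V}
    (hv : v ∈ apexes G C) : b v = v :=
  hb.self v (mem_univ _) (mem_apexes.1 hv).1 (mem_apexes.1 hv).2

theorem IsBranchMap.mem_apexes (hb : IsBranchMap G C univ b) {x : V} (hx : x ∉ C) :
    b x ∈ apexes G C :=
  KTree.mem_apexes.2 ⟨hb.notMem x (mem_univ _) hx, hb.adj x (mem_univ _) hx⟩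

theorem IsBranchMap.region_apexes (hb : IsBranchMap G C univ b) :
    region C b (apexes G C) = univ := by
  ext x
  simp only [mem_region, mem_univ, iff_true]
  exact or_iff_not_imp_left.2 hb.mem_apexes

theorem IsBranchMap.insert_subset_region (hb : IsBranchMap G C univ b) {I : Finset V} {v : V}
    (hv : v ∈ apexes G C) (hvI : v ∈ I) : insert v C ⊆ region C b I :=
  insert_subset (mem_region.2 (.inr (by rwa [hb.eq_of_mem_apexes hv]))) (subset_region I)

theorem IsBranchMap.between_erase (hb : IsBranchMap G C univ b) (hC : G.IsNClique k C)
    (I : Finset V) {v : V} (hv : v ∈ apexes G C) :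
    between G k C ((region C b I).erase v) = between G k C (region C b (I.erase v)) := by
  ext A
  simp only [mem_between, subset_erase]
  constructor
  · rintro ⟨hCA, ⟨hAI, hvA⟩, hT⟩
    refine ⟨hCA, fun x hx => mem_region.2 (or_iff_not_imp_left.2 fun hxC => ?_), hT⟩
    refine mem_erase.2 ⟨?_, (mem_region.1 (hAI hx)).resolve_left hxC⟩
    rintro rfl
    exact hvA ((hT.kTreeFrom hC hCA).branch_mem hb (subset_univ _) x hx hxC)
  · rintro ⟨hCA, hAI, hT⟩
    refine ⟨hCA, ⟨fun x hx => ?_, fun hvA => ?_⟩, hT⟩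
    · exact mem_region.2 ((mem_region.1 (hAI hx)).imp_right mem_of_mem_erase)
    · have := (mem_region.1 (hAI hvA)).resolve_left (KTree.mem_apexes.1 hv).1
      rw [hb.eq_of_mem_apexes hv] at this
      exact notMem_erase _ _ this

theorem region_empty : region C b ∅ = C := by
  ext x; simp

theorem IsBranchMap.count_singleton (hb : IsBranchMap G C univ b) (hC : G.IsNClique k C)
    {v : V} (hv : v ∈ apexes G C) :
    count G k C (region C b {v}) = 1 + count G k (insert v C) (region C b {v}) := by
  rw [count_eq_erase_add _ v]
  congr 1
  rw [count, hb.between_erase hC _ hv, erase_singleton, region_empty,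
    between_self hC]
  simp

theorem IsBranchMap.excess_singleton (hb : IsBranchMap G C univ b) (hC : G.IsNClique k C)
    {v : V} (hv : v ∈ apexes G C) :
    excess G k C (region C b {v}) = excess G k (insert v C) (region C b {v}) := by
  rw [excess_eq_erase_add _ v, add_eq_right, excess, hb.between_erase hC _ hv, erase_singleton,
    region_empty, between_self hC]
  simp [hC.2]

theorem IsBranchMap.count_region (hb : IsBranchMap G C univ b) (hC : G.IsNClique k C)
    {I : Finset V} (hI : I ⊆ apexes G C) :
    count G k C (region C b I) =
      ∏ v ∈ I, (1 + count G k (insert v C) (region C b {v})) := by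
  induction I using Finset.induction_on with
  | empty => simp [region_empty, count, between_self hC]
  | insert v I hv ih =>
    have hd : Disjoint {v} I := disjoint_singleton_left.2 hv
    have h := count_union hC Subset.rfl Subset.rfl (subset_region {v}) (subset_region I)
      (region_inter (b := b) hd) (hb.not_adj hd)
    rw [union_idempotent, ← region_union, ← insert_eq] at h
    rw [h, prod_insert hv, ih ((subset_insert _ _).trans hI),
      hb.count_singleton hC (hI (mem_insert_self _ _))]

theorem IsBranchMap.excess_region_le (hb : IsBranchMap G C univ b) (hC : G.IsNClique k C)
    {I : Finset V} (hI : I ⊆ apexes G C) (c : ℝ)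
    (hc : ∀ v ∈ I, c * excess G k (insert v C) (region C b {v}) ≤
      (1 + count G k (insert v C) (region C b {v})) *
        count G k (insert v C) (region C b {v})) :
    c * excess G k C (region C b I) ≤
      (∑ v ∈ I, count G k (insert v C) (region C b {v})) * count G k C (region C b I) := by
  induction I using Finset.induction_on with
  | empty => simp [region_empty, excess, between_self hC, hC.2]
  | insert v I hv ih =>
    have hd : Disjoint {v} I := disjoint_singleton_left.2 hv
    have hvL := hI (mem_insert_self _ _)
    have ih := ih ((subset_insert _ _).trans hI) fun w hw => hc w (mem_insert_of_mem hw)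
    have hcv := hc v (mem_insert_self _ _)
    have h := count_union hC Subset.rfl Subset.rfl (subset_region {v}) (subset_region I)
      (region_inter (b := b) hd) (hb.not_adj hd)
    have h' := excess_union hC Subset.rfl Subset.rfl (subset_region {v}) (subset_region I)
      (region_inter (b := b) hd) (hb.not_adj hd)
    rw [union_idempotent, ← region_union, ← insert_eq] at h h'
    rw [h, h', sum_insert hv, hb.count_singleton hC hvL, hb.excess_singleton hC hvL]
    have hN : 0 ≤ count G k C (region C b I) := Nat.cast_nonneg _
    have hP : 0 ≤ 1 + count G k (insert v C) (region C b {v}) :=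
      add_nonneg zero_le_one (Nat.cast_nonneg _)
    have h1 := mul_le_mul_of_nonneg_right hcv hN
    have h2 := mul_le_mul_of_nonneg_left ih hP
    linarith

theorem cliqueDeg_le_card_apexes (hC : G.IsNClique k C) :
    cliqueDeg G k C ≤ (apexes G C).card := by
  classical
  refine le_trans (card_le_card ?_) (card_image_le (s := apexes G C) (f := fun v => insert v C))
  intro Q hQ
  obtain ⟨hCQ, hQc⟩ : C ⊆ Q ∧ G.IsNClique (k + 1) Q := by simpa using hQ
  have hcard : C.card < Q.card := by rw [hC.2, hQc.2]; exact Nat.lt_succ_self k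
  obtain ⟨v, hvQ, hvC⟩ := exists_mem_notMem_of_card_lt_card hcard
  refine mem_image.2 ⟨v, mem_apexes.2 ⟨hvC, fun w hw => ?_⟩, ?_⟩
  · exact hQc.1 (by exact_mod_cast hvQ) (by exact_mod_cast hCQ hw) fun h => hvC (h ▸ hw)
  · refine eq_of_subset_of_card_le (insert_subset hvQ hCQ) ?_
    rw [card_insert_of_notMem hvC, hC.2, hQc.2]

end Branches

theorem mean_lt_mean {N₀ M₀ X Mₓ Nⱼ Mⱼ P M c σ : ℝ} (hX : 1 ≤ X) (hNⱼ : 1 ≤ Nⱼ)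
    (hP : P = X * Nⱼ) (hM : M = Mₓ * Nⱼ + X * Mⱼ) (hMX : Mₓ ≤ X * X) (hMpos : 0 < M)
    (hc : c * M = (1 + P) * P) (hσ : 0 ≤ σ) (hM₀ : c * M₀ ≤ σ * N₀) (hN₀ : σ + c ≤ N₀)
    (hN₀pos : 0 < N₀) :
    (M₀ + (M₀ * P + N₀ * M)) / (N₀ + N₀ * P) < (Mⱼ + (M₀ * P + N₀ * M)) / (Nⱼ + N₀ * P) := by
  have hPpos : 0 < P := by rw [hP]; positivity
  rw [div_lt_div_iff₀ (by positivity) (by positivity)]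
  set E := N₀ * N₀ * M + N₀ * Mⱼ * (1 + P) - M₀ * (1 + P) * Nⱼ - M * Nⱼ * N₀ with hE
  have hEq : X * E = N₀ * M * (X * N₀ + 1) - N₀ * (Mₓ * (Nⱼ * (1 + P))) - c * M₀ * M := by
    have hXM : X * Mⱼ = M - Mₓ * Nⱼ := by rw [hM]; ring
    have hcM : c * M₀ * M = M₀ * (1 + P) * (X * Nⱼ) := by
      rw [mul_right_comm, hc, ← hP]; ring
    have : X * E = X * N₀ * N₀ * M + N₀ * (X * Mⱼ) * (1 + P) - M₀ * (1 + P) * (X * Nⱼ)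
        - M * (X * Nⱼ) * N₀ := by rw [hE]; ring
    rw [this, hXM, hcM, ← hP]
    ring
  have h1 : Mₓ * (Nⱼ * (1 + P)) ≤ X * (c * M) := by
    have := mul_le_mul_of_nonneg_right hMX (by positivity : 0 ≤ Nⱼ * (1 + P))
    refine this.trans_eq ?_
    rw [hc, hP]; ring
  have h2 := mul_le_mul_of_nonneg_left h1 hN₀pos.le
  have h3 := mul_le_mul_of_nonneg_right hM₀ hMpos.le
  have h4 : 0 < X * N₀ + 1 - X * c - σ := by
    have h5 := mul_le_mul_of_nonneg_left hN₀ (by positivity : 0 ≤ X)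
    have h6 := mul_le_mul_of_nonneg_right hX hσ
    linarith
  have h7 : 0 < X * E := by
    have := mul_pos (mul_pos hN₀pos hMpos) h4
    rw [hEq]
    linarith
  have hEpos : 0 < E := pos_of_mul_pos_right h7 (by positivity)
  have : (Mⱼ + (M₀ * P + N₀ * M)) * (N₀ + N₀ * P) - (M₀ + (M₀ * P + N₀ * M)) * (Nⱼ + N₀ * P)
      = E := by
    rw [hE]; ring
  linarith

theorem one_add_sum_le_prod {ι : Type*} [DecidableEq ι] {I : Finset ι} {f : ι → ℝ}
    (hf : ∀ i ∈ I, 0 ≤ f i) : 1 + ∑ i ∈ I, f i ≤ ∏ i ∈ I, (1 + f i) := by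
  induction I using Finset.induction_on with
  | empty => simp
  | insert i I hi ih =>
    have ih := ih fun j hj => hf j (mem_insert_of_mem hj)
    have hfi := hf i (mem_insert_self _ _)
    have hs : 0 ≤ ∑ j ∈ I, f j := sum_nonneg fun j hj => hf j (mem_insert_of_mem hj)
    rw [sum_insert hi, prod_insert hi]
    nlinarith [mul_nonneg hfi hs, mul_le_mul_of_nonneg_left ih hfi]

theorem add_le_prod_one_add {ι : Type*} [DecidableEq ι] {I : Finset ι} {f : ι → ℝ} {c : ℝ}
    (hI : 2 ≤ I.card) (hf : ∀ i ∈ I, 1 ≤ f i) (hc : ∀ i ∈ I, c ≤ 1 + f i) :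
    ∑ i ∈ I, f i + c ≤ ∏ i ∈ I, (1 + f i) := by
  obtain ⟨i, hi, j, hj, hij⟩ := one_lt_card.1 hI
  have hj' : j ∈ I.erase i := mem_erase.2 ⟨hij.symm, hj⟩
  rw [← add_sum_erase _ _ hi, ← add_sum_erase _ _ hj', ← mul_prod_erase _ _ hi,
    ← mul_prod_erase _ _ hj']
  set r := (I.erase i).erase j
  have hr : ∀ l ∈ r, 0 ≤ f l := fun l hl =>
    zero_le_one.trans (hf l (mem_of_mem_erase (mem_of_mem_erase hl)))
  have h1 : 1 + ∑ l ∈ r, f l ≤ ∏ l ∈ r, (1 + f l) := one_add_sum_le_prod hr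
  have h0 : 0 ≤ ∑ l ∈ r, f l := sum_nonneg hr
  have hfi := hf i hi
  have hfj := hf j hj
  have hci := hc i hi
  have h2 := mul_le_mul_of_nonneg_left h1 (by positivity : 0 ≤ (1 + f i) * (1 + f j))
  nlinarith [mul_nonneg (sub_nonneg.2 hfi) (sub_nonneg.2 hfj), mul_nonneg h0 (sub_nonneg.2 hfi),
    mul_nonneg h0 (sub_nonneg.2 hfj), mul_nonneg (mul_nonneg h0 (sub_nonneg.2 hfi))
      (sub_nonneg.2 hfj)]

section Neighbor

variable [Fintype V] [DecidableEq V] {G : SimpleGraph V} {k : ℕ} {C : Finset V} {b b' : V → V}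
  {u v : V}

/-- Branches at `C` other than the one at `v` lie in the branch at `u` of the clique obtained
from `C` by exchanging `u` for `v`. -/
theorem IsBranchMap.eq_of_exchange (hb : IsBranchMap G C univ b) (hG : IsKTree G k)
    (hC : G.IsNClique k C) (hv : v ∈ apexes G C) (hvu : v ≠ u)
    (hC' : G.IsNClique k ((insert v C).erase u))
    (hb' : IsBranchMap G ((insert v C).erase u) univ b') {x : V} (hxC : x ∉ C)
    (hx : b x ≠ v) : b' x = u := by
  obtain ⟨hvC, hvadj⟩ := KTree.mem_apexes.1 hv
  have hbv := hb.eq_of_mem_apexes hv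
  set W := region C b ((apexes G C).erase v) with hW
  have hCW : C ⊆ W := subset_region _
  have hvW : v ∉ W := by simp [hW, hvC, hbv]
  have hadjW : ∀ w ∈ W, G.Adj v w ↔ w ∈ C := by
    refine fun w hw => ⟨fun h => ?_, hvadj w⟩
    by_contra hwC
    have h1 := (mem_region.1 hw).resolve_left hwC
    rw [← hb.congr v (mem_univ _) hvC w (mem_univ _) hwC h, hbv] at h1
    exact notMem_erase _ _ h1
  have hT : IsKTreeOn G k W := by
    have := (hG.kTreeFrom hC (subset_univ _)).inter hCW fun y _ hy hyC z _ hz h => ?_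
    · rwa [univ_inter] at this
    · have hzC : z ∉ C := fun h => hz (hCW h)
      have h1 := (mem_region.1 hy).resolve_left hyC
      rw [hb.congr y (mem_univ _) hyC z (mem_univ _) hzC h] at h1
      exact hz (mem_region.2 (.inr h1))
  have hT' : IsKTreeOn G k (insert v W) := .grow W v C hT hvW hCW hC hadjW
  have hxW : x ∈ W := mem_region.2 (.inr (mem_erase.2 ⟨hx, hb.mem_apexes hxC⟩))
  have hxv : x ≠ v := fun h => hvW (h ▸ hxW)
  have hxC' : x ∉ (insert v C).erase u := by simp [hxv, hxC]
  have hmem := (hT'.kTreeFrom hC' ((erase_subset _ _).trans (insert_subset_insert _ hCW))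
    ).branch_mem hb' (subset_univ _) x (mem_insert_of_mem hxW) hxC'
  have hnot := hb'.notMem x (mem_univ _) hxC'
  have hadj := hb'.adj x (mem_univ _) hxC'
  by_contra hne
  have hbxC : b' x ∉ insert v C := fun h => hnot (mem_erase.2 ⟨hne, h⟩)
  have hbxW : b' x ∈ W :=
    (mem_insert.1 hmem).resolve_left fun h => hbxC (h ▸ mem_insert_self _ _)
  exact hbxC (mem_insert_of_mem ((hadjW _ hbxW).1
    (hadj v (mem_erase.2 ⟨hvu, mem_insert_self _ _⟩)).symm))

end Neighbor

/-- Around a major `k`-clique, some adjacent `k`-clique has larger local mean order. -/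
theorem exists_kMean_lt [Fintype V] [DecidableEq V] {G : SimpleGraph V} {k : ℕ} {C : Finset V}
    (hk : 1 ≤ k) (hG : IsKTree G k) (hC : G.IsNClique k C) (hdeg : 3 ≤ cliqueDeg G k C) :
    ∃ C', G.IsNClique k C' ∧ kMean G k C < kMean G k C' := by
  obtain ⟨b, hb⟩ := (hG.kTreeFrom hC (subset_univ _)).exists_branchMap
  have hL : 3 ≤ (apexes G C).card := hdeg.trans (cliqueDeg_le_card_apexes hC)
  let P : V → ℝ := fun v => count G k (insert v C) (region C b {v})
  let M : V → ℝ := fun v => excess G k (insert v C) (region C b {v})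
  have hP1 : ∀ v ∈ apexes G C, 1 ≤ P v := fun v hv =>
    one_le_count (isKTreeOn_insert hC (mem_apexes.1 hv).1 (mem_apexes.1 hv).2)
      (hb.insert_subset_region hv (mem_singleton_self v))
  have hPM : ∀ v ∈ apexes G C, P v ≤ M v := fun v hv =>
    count_le_excess_insert hC (mem_apexes.1 hv).1
  obtain ⟨v, hv, hmin⟩ := exists_min_image (apexes G C) (fun v => (1 + P v) * P v / M v)
    (card_pos.1 (by omega))
  obtain ⟨hvC, hvadj⟩ := mem_apexes.1 hv
  have hMpos : ∀ w ∈ apexes G C, 0 < M w := fun w hw => by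
    linarith [hP1 w hw, hPM w hw]
  set c := (1 + P v) * P v / M v with hcdef
  have hcM : c * M v = (1 + P v) * P v := div_mul_cancel₀ _ (hMpos v hv).ne'
  have hc : ∀ w ∈ apexes G C, c * M w ≤ (1 + P w) * P w := fun w hw =>
    (le_div_iff₀ (hMpos w hw)).1 (hmin w hw)
  have hc0 : 0 ≤ c := by
    have := hP1 v hv
    have := hMpos v hv
    positivity
  have hcP : ∀ w ∈ apexes G C, c ≤ 1 + P w := fun w hw => by
    have h1 := mul_le_mul_of_nonneg_left (hPM w hw) hc0
    exact le_of_mul_le_mul_right (h1.trans (hc w hw)) (by linarith [hP1 w hw])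
  set I := (apexes G C).erase v with hI
  have hIsub : I ⊆ apexes G C := erase_subset _ _
  have hIcard : 2 ≤ I.card := by rw [hI, card_erase_of_mem hv]; omega
  set N₀ := count G k C (region C b I)
  set M₀ := excess G k C (region C b I)
  have hN₀eq : N₀ = ∏ w ∈ I, (1 + P w) := hb.count_region hC hIsub
  have hM₀ : c * M₀ ≤ (∑ w ∈ I, P w) * N₀ :=
    hb.excess_region_le hC hIsub c fun w hw => hc w (hIsub hw)
  have hN₀ : ∑ w ∈ I, P w + c ≤ N₀ := by
    rw [hN₀eq]
    exact add_le_prod_one_add hIcard (fun w hw => hP1 w (hIsub hw)) fun w hw => hcP w (hIsub hw)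
  have hN₀pos : 0 < N₀ := zero_lt_one.trans_le (one_le_count (.base _ hC) (subset_region _))
  obtain ⟨u, huC⟩ : C.Nonempty := card_pos.1 (by rw [hC.2]; omega)
  have huB : u ∈ insert v C := mem_insert_of_mem huC
  have huv : u ≠ v := fun h => hvC (h ▸ huC)
  have hB : G.IsNClique (k + 1) (insert v C) := hC.insert hvadj
  set C' := (insert v C).erase u with hC'def
  have hC' : G.IsNClique k C' := isNClique_erase hB huB
  have hu : u ∈ apexes G C' := mem_apexes.2 ⟨notMem_erase _ _, fun w hw =>
    hB.1 (by exact_mod_cast huB) (by exact_mod_cast mem_of_mem_erase hw)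
      (ne_of_mem_erase hw).symm⟩
  have hinsert : insert u C' = insert v C := insert_erase huB
  obtain ⟨b', hb'⟩ := (hG.kTreeFrom hC' (subset_univ _)).exists_branchMap
  set J := (apexes G C').erase u with hJ
  have hdI : Disjoint I {v} := disjoint_singleton_right.2 (notMem_erase _ _)
  have hdJ : Disjoint {u} J := disjoint_singleton_left.2 (notMem_erase _ _)
  have hUnivI : region C b I ∪ region C b {v} = univ := by
    rw [← region_union, union_comm, ← insert_eq, insert_erase hv, hb.region_apexes]
  have hUnivJ : region C' b' {u} ∪ region C' b' J = univ := by
    rw [← region_union, ← insert_eq, insert_erase hu, hb'.region_apexes]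
  have hBv := hb.insert_subset_region hv (mem_singleton_self v)
  have hBu := hb'.insert_subset_region hu (mem_singleton_self u)
  rw [hinsert] at hBu
  have hJv : region C' b' J ⊆ region C b {v} := by
    intro x hx
    rw [mem_region, mem_singleton]
    by_contra! hcon
    have hxu : b' x = u := hb.eq_of_exchange hG hC hv huv.symm hC' hb' hcon.1 hcon.2
    have hxC' : x ∉ C' := fun h => by
      rcases mem_insert.1 (mem_of_mem_erase h) with rfl | h
      · exact hcon.2 (hb.eq_of_mem_apexes hv)
      · exact hcon.1 h
    have := (mem_region.1 hx).resolve_left hxC'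
    rw [hxu] at this
    exact notMem_erase _ _ this
  set W := region C b {v} ∩ region C' b' {u} with hWdef
  have hWJ : W ∪ region C' b' J = region C b {v} := by
    rw [hWdef, inter_union_distrib_right, hUnivJ, inter_univ, union_eq_left.2 hJv]
  have hBW : insert v C ⊆ W := subset_inter hBv hBu
  have hC'B : C' ⊆ insert v C := erase_subset _ _
  have hQ := count_union hC Subset.rfl (subset_insert v C) (subset_region I) hBv
    (region_inter hdI) (hb.not_adj hdI)
  have hQ' := excess_union hC Subset.rfl (subset_insert v C) (subset_region I) hBv
    (region_inter hdI) (hb.not_adj hdI)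
  have hWu : W ⊆ region C' b' {u} := inter_subset_right
  have hR := count_union hC' hC'B Subset.rfl hBW (subset_region J)
    ((inter_subset_inter_right hWu).trans (region_inter hdJ))
    fun x hx => hb'.not_adj hdJ x (hWu hx)
  have hR' := excess_union hC' hC'B Subset.rfl hBW (subset_region J)
    ((inter_subset_inter_right hWu).trans (region_inter hdJ))
    fun x hx => hb'.not_adj hdJ x (hWu hx)
  rw [hUnivI, union_eq_right.2 (subset_insert v C)] at hQ hQ'
  rw [hWJ, union_eq_left.2 hC'B] at hR hR'
  have hXX : excess G k (insert v C) W ≤ count G k (insert v C) W * count G k (insert v C) W :=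
    excess_insert_le hC hvC hvadj
  have hX1 : 1 ≤ count G k (insert v C) W :=
    one_le_count (isKTreeOn_insert hC hvC hvadj) hBW
  have hNj1 : 1 ≤ count G k C' (region C' b' J) := one_le_count (.base _ hC') (subset_region _)
  have hcC : count G k C univ = N₀ + count G k (insert v C) univ := by
    rw [count_eq_erase_add _ v, ← hb.region_apexes, count, hb.between_erase hC _ hv]; rfl
  have heC : excess G k C univ = M₀ + excess G k (insert v C) univ := by
    rw [excess_eq_erase_add _ v, ← hb.region_apexes, excess, hb.between_erase hC _ hv]; rfl
  have hcC' : count G k C' univ =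
      count G k C' (region C' b' J) + count G k (insert v C) univ := by
    rw [count_eq_erase_add _ u, hinsert, ← hb'.region_apexes, count, hb'.between_erase hC' _ hu]
    rfl
  have heC' : excess G k C' univ =
      excess G k C' (region C' b' J) + excess G k (insert v C) univ := by
    rw [excess_eq_erase_add _ u, hinsert, ← hb'.region_apexes, excess,
      hb'.between_erase hC' _ hu]
    rfl
  refine ⟨C', hC', ?_⟩
  rw [kMean_eq hC, kMean_eq hC', hcC, heC, hcC', heC', hQ, hQ']
  refine add_lt_add_right (mean_lt_mean hX1 hNj1 hR hR' hXX (hMpos v hv) hcM ?_ hM₀ hN₀ hN₀pos) _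
  exact sum_nonneg fun w hw => zero_le_one.trans (hP1 w (hIsub hw))

end KTree

/-- For any `k`-tree `T`, the maximum of the local mean order
`μ(T; C)` over all `k`-cliques `C` is attained at a `k`-clique of degree at most `2`,
i.e. at a non-major `k`-clique. -/
theorem max_kMean_at_nonmajor {V : Type*} [Fintype V] [DecidableEq V]
    (k : ℕ) (hk : 1 ≤ k) (G : SimpleGraph V) (hG : IsKTree G k) :
    ∃ C : Finset V, G.IsNClique k C ∧ cliqueDeg G k C ≤ 2 ∧
      ∀ C' : Finset V, G.IsNClique k C' → kMean G k C' ≤ kMean G k C := by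
  classical
  obtain ⟨C₀, hC₀⟩ : ∃ C, G.IsNClique k C := hG.exists_isNClique
  obtain ⟨C, hC, hmax⟩ := exists_max_image (univ.filter fun C => G.IsNClique k C) (kMean G k)
    ⟨C₀, by simpa using hC₀⟩
  simp only [mem_filter, mem_univ, true_and] at hC hmax
  refine ⟨C, hC, ?_, hmax⟩
  by_contra! hdeg
  obtain ⟨C', hC', hlt⟩ := KTree.exists_kMean_lt hk hG hC hdeg
  exact (hmax C' hC').not_gt hlt
end

section
/- Let C_1 be an end k-clique of a k-tree T (a k-clique contained in exactly one (k+1)-clique) and let C_2 be a k-clique adjacent to C_1. Then μ(T; C_1) ≥ μ(T; C_2), with equality if and only if C_2 is also an end k-clique, or T is a path-type k-tree and C_1 contains a k-leaf. -/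
open Finset

variable {V : Type*}

lemma ncard_neighborSet_inter_s18 {G : SimpleGraph V} {v : V} {s D : Finset V} (hD : D ⊆ s)
    (hadj : ∀ w ∈ s, G.Adj v w ↔ w ∈ D) :
    (G.neighborSet v ∩ (s : Set V)).ncard = D.card := by
  rw [← Set.ncard_coe_finset]
  congr 1
  ext w
  simp only [Set.mem_inter_iff, SimpleGraph.mem_neighborSet, mem_coe]
  exact ⟨fun h => (hadj w h.2).1 h.1, fun h => ⟨(hadj w (hD h)).2 h, hD h⟩⟩

lemma exists_adj_iff_mem (G : SimpleGraph V) (v : V) (s : Finset V) :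
    ∃ D ⊆ s, ∀ w ∈ s, G.Adj v w ↔ w ∈ D := by
  classical
  exact ⟨s.filter (G.Adj v), filter_subset _ _, fun w hw => by simp [hw]⟩

lemma exists_nbhd_of_ncard_eq {G : SimpleGraph V} {k : ℕ} {v : V} {s : Finset V}
    (h : (G.neighborSet v ∩ (s : Set V)).ncard = k) :
    ∃ D ⊆ s, (∀ w ∈ s, G.Adj v w ↔ w ∈ D) ∧ D.card = k := by
  obtain ⟨D, hD, hadj⟩ := exists_adj_iff_mem G v s
  exact ⟨D, hD, hadj, by rw [← h, ncard_neighborSet_inter_s18 hD hadj]⟩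

section KTree

variable [DecidableEq V] {G : SimpleGraph V} {k : ℕ} {s A C D E : Finset V} {u v c : V}

lemma IsKTreeOn.le_card (h : IsKTreeOn G k s) : k ≤ s.card := by
  induction h with
  | base s h => exact h.card_eq.ge
  | grow s v C _ hv _ _ _ ih => rw [card_insert_of_notMem hv]; omega

lemma isNClique_insert_of_adj_iff (hA : A ⊆ s) (hA' : G.IsNClique k A) (h : E ⊆ A)
    (hE : G.IsNClique k E) (hadj : ∀ w ∈ s, G.Adj v w ↔ w ∈ E) :
    G.IsNClique (k + 1) (insert v A) := by
  obtain rfl : E = A := eq_of_subset_of_card_le h (by rw [hA'.card_eq, hE.card_eq])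
  exact hE.insert fun w hw => (hadj w (hA hw)).2 hw

lemma IsKTreeOn.isNClique_of_card_eq (h : IsKTreeOn G k s) (hs : s.card = k) :
    G.IsNClique k s := by
  cases h with
  | base s h => exact h
  | grow s v C h hv _ _ _ =>
    have := h.le_card
    rw [card_insert_of_notMem hv] at hs
    omega

lemma IsKTreeOn.isNClique_succ_of_card_eq (h : IsKTreeOn G k s) (hs : s.card = k + 1) :
    G.IsNClique (k + 1) s := by
  cases h with
  | base s h => have := h.card_eq; omega
  | grow s v C h hv hC hC' hadj =>
    rw [card_insert_of_notMem hv] at hs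
    exact isNClique_insert_of_adj_iff subset_rfl (h.isNClique_of_card_eq (by omega)) hC hC' hadj

lemma isKTreeOn_of_isNClique_succ (h : G.IsNClique (k + 1) s) : IsKTreeOn G k s := by
  obtain ⟨v, hv⟩ : s.Nonempty := card_pos.1 (by rw [h.card_eq]; omega)
  have hk : G.IsNClique k (s.erase v) := by simpa using h.erase_of_mem hv
  rw [← insert_erase hv]
  refine .grow _ v _ (.base _ hk) (notMem_erase v s) subset_rfl hk fun w hw => ?_
  simp only [hw, iff_true]
  exact h.isClique hv (mem_of_mem_erase hw) (ne_of_mem_erase hw).symm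

/-- If `v` has at most `k` neighbours in a `k`-tree, then it has exactly `k` neighbours there, and
deleting it leaves a `k`-tree. -/
lemma IsKTreeOn.erase_of_card_le (hA : IsKTreeOn G k A) (hD : D.card ≤ k) (hv : v ∈ A)
    (hN : ∀ w ∈ A, G.Adj v w → w ∈ D) (hcard : k + 1 ≤ A.card) :
    D ⊆ A ∧ D.card = k ∧ IsKTreeOn G k (A.erase v) := by
  induction hA with
  | base s h => have := h.card_eq; omega
  | grow s u E hs hu hE hE' hadj ih =>
    have hsub : ∀ F : Finset V, F.card = k → F ⊆ D → F = D := fun F hF h =>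
      eq_of_subset_of_card_le h (by omega)
    by_cases huv : u = v
    · subst huv
      have := hsub E hE'.card_eq fun w hw =>
        hN w (mem_insert_of_mem (hE hw)) ((hadj w (hE hw)).2 hw)
      subst this
      exact ⟨hE.trans (subset_insert _ _), hE'.card_eq, by rwa [erase_insert hu]⟩
    · have hvs : v ∈ s := by simpa [Ne.symm huv] using hv
      rw [card_insert_of_notMem hu] at hcard
      by_cases hk : s.card = k
      · have hcl := isNClique_insert_of_adj_iff subset_rfl (hs.isNClique_of_card_eq hk) hE hE' hadj
        have hcl' : G.IsNClique k ((insert u s).erase v) := by simpa using hcl.erase_of_mem hv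
        have := hsub _ hcl'.card_eq fun w hw => hN w (mem_of_mem_erase hw)
          (hcl.isClique hv (mem_of_mem_erase hw) (ne_of_mem_erase hw).symm)
        rw [← this]
        exact ⟨erase_subset _ _, hcl'.card_eq, .base _ hcl'⟩
      · have := hs.le_card
        obtain ⟨h1, h2, h3⟩ := ih hvs (fun w hw => hN w (mem_insert_of_mem hw)) (by omega)
        have hvu : v ∉ E := fun h =>
          hu (h1 (hN u (mem_insert_self _ _) ((hadj v hvs).2 h).symm))
        refine ⟨h1.trans (subset_insert _ _), h2, ?_⟩
        rw [erase_insert_of_ne huv]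
        exact .grow _ u E h3 (fun h => hu (mem_of_mem_erase h)) (subset_erase.2 ⟨hE, hvu⟩) hE'
          fun w hw => hadj w (mem_of_mem_erase hw)

lemma isKTreeOn_insert_iff (hv : v ∉ s) (hE : G.IsNClique k E)
    (hadj : ∀ w ∈ s, G.Adj v w ↔ w ∈ E) (hA : A ⊆ s) (hk : k ≤ A.card) (hEs : E ⊆ s) :
    IsKTreeOn G k (insert v A) ↔ E ⊆ A ∧ IsKTreeOn G k A := by
  have hvA : v ∉ A := fun h => hv (hA h)
  refine ⟨fun h => ?_, fun h => .grow _ v E h.2 hvA h.1 hE fun w hw => hadj w (hA hw)⟩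
  obtain ⟨h1, -, h3⟩ := h.erase_of_card_le hE.card_eq.le (mem_insert_self v A)
    (fun w hw hvw => (hadj w (hA ((mem_insert.1 hw).resolve_left hvw.ne'))).1 hvw)
    (by rw [card_insert_of_notMem hvA]; omega)
  rw [erase_insert hvA] at h3
  exact ⟨(subset_insert_iff_of_notMem fun h => hv (hEs h)).1 h1, h3⟩

/-- A `k`-tree properly containing a `k`-clique `C` has a vertex outside `C` whose deletion leaves a
`k`-tree. -/
lemma IsKTreeOn.exists_erase (hA : IsKTreeOn G k A) (hC : G.IsNClique k C) (hCA : C ⊆ A)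
    (hcard : k + 1 ≤ A.card) :
    ∃ v ∈ A, v ∉ C ∧ IsKTreeOn G k (A.erase v) ∧ ∃ D ⊆ A.erase v, G.IsNClique k D ∧
      ∀ w ∈ A.erase v, G.Adj v w ↔ w ∈ D := by
  induction hA generalizing C with
  | base s h => have := h.card_eq; omega
  | grow s u E hs hu hE hE' hadj ih =>
    by_cases huC : u ∈ C
    · rw [card_insert_of_notMem hu] at hcard
      by_cases hk : s.card = k
      · have hcl := isNClique_insert_of_adj_iff subset_rfl (hs.isNClique_of_card_eq hk) hE hE' hadj
        obtain ⟨v, hv, hvC⟩ : ∃ v ∈ insert u s, v ∉ C :=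
          exists_mem_notMem_of_card_lt_card (by rw [hcl.card_eq, hC.card_eq]; omega)
        have hcl' : G.IsNClique k ((insert u s).erase v) := by simpa using hcl.erase_of_mem hv
        refine ⟨v, hv, hvC, .base _ hcl', _, subset_rfl, hcl', fun w hw => ?_⟩
        simp only [hw, iff_true]
        exact hcl.isClique hv (mem_of_mem_erase hw) (ne_of_mem_erase hw).symm
      · have := hs.le_card
        obtain ⟨v, hv, hvE, hT, D, hD, hD', hDadj⟩ := ih hE' hE (by omega)
        have huv : u ≠ v := fun h => hu (h ▸ hv)
        have hnadj : ¬ G.Adj u v := fun h => hvE ((hadj v hv).1 h)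
        refine ⟨v, mem_insert_of_mem hv, fun h => hnadj (hC.isClique huC h huv), ?_, D, ?_, hD', ?_⟩
          <;> rw [erase_insert_of_ne huv]
        · exact .grow _ u E hT (fun h => hu (mem_of_mem_erase h)) (subset_erase.2 ⟨hE, hvE⟩) hE'
            fun w hw => hadj w (mem_of_mem_erase hw)
        · exact hD.trans (subset_insert _ _)
        · intro w hw
          rcases mem_insert.1 hw with rfl | hw
          · exact ⟨fun h => (hnadj h.symm).elim, fun h => (hu (mem_of_mem_erase (hD h))).elim⟩
          · exact hDadj w hw
    · refine ⟨u, mem_insert_self _ _, huC, ?_, E, ?_, hE', ?_⟩ <;> rw [erase_insert hu]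
      exacts [hs, hE, hadj]

lemma IsKTreeOn.exists_isNClique_succ (hA : IsKTreeOn G k A) (hC : G.IsNClique k C) (hCA : C ⊆ A)
    (hcard : k + 1 ≤ A.card) : ∃ Q ⊆ A, C ⊆ Q ∧ G.IsNClique (k + 1) Q := by
  induction hn : A.card using Nat.strong_induction_on generalizing A with
  | _ n ih =>
    obtain hk | hk := hcard.eq_or_lt'
    · exact ⟨A, subset_rfl, hCA, hA.isNClique_succ_of_card_eq hk⟩
    · obtain ⟨v, hv, hvC, hT, -⟩ := hA.exists_erase hC hCA hcard
      have := card_erase_of_mem hv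
      obtain ⟨Q, hQ, h⟩ := ih _ (by omega) hT (subset_erase.2 ⟨hCA, hvC⟩) (by omega) rfl
      exact ⟨Q, hQ.trans (erase_subset _ _), h⟩

/-- If `c` completes a `k`-clique `C` to a `(k + 1)`-clique of a `k`-tree, then the vertices
separated from `c` by `C` can be split off: the sub-`k`-trees containing `C` are the unions of a
sub-`k`-tree on one side and a sub-`k`-tree on the other. -/
lemma IsKTreeOn.exists_branch (hs : IsKTreeOn G k s) (hC : G.IsNClique k C) (hCs : C ⊆ s)
    (hcs : c ∈ s) (hcC : c ∉ C) (hc : ∀ w ∈ C, G.Adj c w) :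
    ∃ W ⊆ s, c ∈ W ∧ Disjoint W C ∧ (∀ x ∈ W, ∀ y ∈ s, y ∉ W → y ∉ C → ¬ G.Adj x y) ∧
      (∀ A ⊆ s, C ⊆ A →
        (IsKTreeOn G k A ↔ IsKTreeOn G k (A \ W) ∧ IsKTreeOn G k (A ∩ (W ∪ C)))) ∧
      ∀ A ⊆ s, C ⊆ A → IsKTreeOn G k A → c ∉ A → Disjoint A W := by
  induction hs with
  | base s h =>
    exact (hcC (eq_of_subset_of_card_le hCs (by rw [h.card_eq, hC.card_eq]) ▸ hcs)).elim
  | grow s u E hs hu hE hE' hadj ih =>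
    have hinsert : ∀ A ⊆ s, k ≤ A.card → (IsKTreeOn G k (insert u A) ↔ E ⊆ A ∧ IsKTreeOn G k A) :=
      fun A hA hk => isKTreeOn_insert_iff hu hE' hadj hA hk hE
    have hcardC : ∀ {A}, C ⊆ A → k ≤ A.card := fun h => hC.card_eq ▸ card_le_card h
    by_cases huC : u ∈ C
    · have hcu : c ≠ u := fun h => hcC (h ▸ huC)
      have hcE : c ∈ E := (hadj c ((mem_insert.1 hcs).resolve_left hcu)).1 (hc u huC).symm
      refine ⟨insert u s \ C, sdiff_subset, mem_sdiff.2 ⟨hcs, hcC⟩, sdiff_disjoint, ?_, ?_, ?_⟩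
      · intro x _ y hy hyW hyC
        exact (hyW (mem_sdiff.2 ⟨hy, hyC⟩)).elim
      · intro A hA hCA
        have h1 : A \ (insert u s \ C) = C := by
          ext x; simp only [mem_sdiff, not_and, not_not]
          exact ⟨fun h => h.2 (hA h.1), fun h => ⟨hCA h, fun _ => h⟩⟩
        have h2 : A ∩ ((insert u s \ C) ∪ C) = A := by
          rw [sdiff_union_of_subset hCs, inter_eq_left]; exact hA
        rw [h1, h2]
        exact ⟨fun h => ⟨.base _ hC, h⟩, fun h => h.2⟩
      · intro A hA hCA hT hcA
        obtain hk | hk := (hcardC hCA).eq_or_lt'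
        · rw [← eq_of_subset_of_card_le hCA (by rw [hk, hC.card_eq])]
          exact disjoint_sdiff
        · refine (hcA ((hT.erase_of_card_le hE'.card_eq.le (hCA huC) ?_ hk).1 hcE)).elim
          exact fun w hw huw => (hadj w ((mem_insert.1 (hA hw)).resolve_left huw.ne')).1 huw
    have hCs' : C ⊆ s := (subset_insert_iff_of_notMem huC).1 hCs
    have herase : ∀ {A}, C ⊆ A → C ⊆ A.erase u := fun h => subset_erase.2 ⟨h, huC⟩
    have herase' : ∀ {A}, A ⊆ insert u s → A.erase u ⊆ s := fun h => by
      rwa [← subset_insert_iff]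
    by_cases huc : u = c
    · subst huc
      have hCE : C = E := eq_of_subset_of_card_le (fun w hw => (hadj w (hCs' hw)).1 (hc w hw))
        (by rw [hC.card_eq, hE'.card_eq])
      subst hCE
      refine ⟨{u}, by simp, by simp, by simpa using huC, ?_, ?_, ?_⟩
      · intro x hx y hy hyu hyC
        rw [mem_singleton] at hx hyu
        subst hx
        exact fun h => hyC ((hadj y ((mem_insert.1 hy).resolve_left hyu)).1 h)
      · intro A hA hCA
        by_cases huA : u ∈ A
        · have h1 : A ∩ ({u} ∪ C) = insert u C := by
            rw [← insert_eq, inter_eq_right, insert_subset_iff]; exact ⟨huA, hCA⟩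
          have h2 := hinsert _ (herase' hA) (hcardC (herase hCA))
          rw [insert_erase huA] at h2
          rw [h1, sdiff_singleton_eq_erase, h2, hinsert C hE (hcardC subset_rfl)]
          exact ⟨fun h => ⟨h.2, subset_rfl, .base _ hC⟩, fun h => ⟨herase hCA, h.1⟩⟩
        · have h1 : A ∩ ({u} ∪ C) = C := by
            rw [← insert_eq, inter_insert_of_notMem huA, inter_eq_right.2 hCA]
          rw [h1, sdiff_singleton_eq_erase, erase_eq_of_notMem huA]
          exact ⟨fun h => ⟨h, .base _ hC⟩, fun h => h.1⟩
      · intro A _ _ _ h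
        simpa using h
    have hcs' : c ∈ s := (mem_insert.1 hcs).resolve_left (Ne.symm huc)
    obtain ⟨W, hWs, hcW, hWC, hsep, hprod, hdisj⟩ := ih hCs' hcs'
    have huW : u ∉ W := fun h => hu (hWs h)
    by_cases hEW : Disjoint E W
    · refine ⟨W, hWs.trans (subset_insert _ _), hcW, hWC, ?_, ?_, ?_⟩
      · intro x hx y hy hyW hyC hxy
        rcases mem_insert.1 hy with rfl | hy
        · exact disjoint_left.1 hEW ((hadj x (hWs hx)).1 hxy.symm) hx
        · exact hsep x hx y hy hyW hyC hxy
      · intro A hA hCA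
        by_cases huA : u ∈ A
        · obtain ⟨B, huB, rfl⟩ : ∃ B, u ∉ B ∧ insert u B = A :=
            ⟨A.erase u, notMem_erase _ _, insert_erase huA⟩
          have hB := (insert_subset_insert_iff huB).1 hA
          have hCB := (subset_insert_iff_of_notMem huC).1 hCA
          have hCBW : C ⊆ B \ W := subset_sdiff.2 ⟨hCB, hWC.symm⟩
          rw [insert_sdiff_of_notMem _ huW, insert_inter_of_notMem (by simp [huW, huC]),
            hinsert B hB (hcardC hCB), hinsert _ (sdiff_subset.trans hB) (hcardC hCBW),
            hprod B hB hCB, subset_sdiff]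
          tauto
        · exact hprod A ((subset_insert_iff_of_notMem huA).1 hA) hCA
      · intro A hA hCA hT hcA
        by_cases huA : u ∈ A
        · obtain ⟨B, huB, rfl⟩ : ∃ B, u ∉ B ∧ insert u B = A :=
            ⟨A.erase u, notMem_erase _ _, insert_erase huA⟩
          have hB := (insert_subset_insert_iff huB).1 hA
          have hCB := (subset_insert_iff_of_notMem huC).1 hCA
          rw [hinsert B hB (hcardC hCB)] at hT
          rw [disjoint_insert_left]
          exact ⟨huW, hdisj B hB hCB hT.2 fun h => hcA (mem_insert_of_mem h)⟩
        · exact hdisj A ((subset_insert_iff_of_notMem huA).1 hA) hCA hT hcA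
    · obtain ⟨e, heE, heW⟩ := not_disjoint_iff.1 hEW
      have hEWC : E ⊆ W ∪ C := by
        intro y hy
        by_contra h
        rw [mem_union, not_or] at h
        exact hsep e heW y (hE hy) h.1 h.2
          (hE'.isClique heE hy fun h' => h.1 (h' ▸ heW))
      refine ⟨insert u W, insert_subset_insert _ hWs, mem_insert_of_mem hcW, ?_, ?_, ?_, ?_⟩
      · rw [disjoint_insert_left]; exact ⟨huC, hWC⟩
      · intro x hx y hy hyW hyC hxy
        rw [mem_insert, not_or] at hyW
        have hys := (mem_insert.1 hy).resolve_left hyW.1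
        rcases mem_insert.1 hx with rfl | hx
        · exact (mem_union.1 (hEWC ((hadj y hys).1 hxy))).elim hyW.2 hyC
        · exact hsep x hx y hys hyW.2 hyC hxy
      · intro A hA hCA
        by_cases huA : u ∈ A
        · obtain ⟨B, huB, rfl⟩ : ∃ B, u ∉ B ∧ insert u B = A :=
            ⟨A.erase u, notMem_erase _ _, insert_erase huA⟩
          have hB := (insert_subset_insert_iff huB).1 hA
          have hCB := (subset_insert_iff_of_notMem huC).1 hCA
          have hCBW : C ⊆ B ∩ (W ∪ C) := subset_inter hCB subset_union_right
          have h1 : insert u B \ insert u W = B \ W := by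
            rw [insert_sdiff_insert, sdiff_insert, erase_eq_of_notMem]
            exact fun h => huB (mem_sdiff.1 h).1
          rw [h1, insert_union, ← insert_inter_distrib, hinsert B hB (hcardC hCB),
            hinsert _ (inter_subset_left.trans hB) (hcardC hCBW), hprod B hB hCB, subset_inter_iff]
          tauto
        · have h1 : A \ insert u W = A \ W := by
            rw [sdiff_insert, erase_eq_of_notMem]
            exact fun h => huA (mem_sdiff.1 h).1
          rw [h1, insert_union, inter_insert_of_notMem huA]
          exact hprod A ((subset_insert_iff_of_notMem huA).1 hA) hCA
      · intro A hA hCA hT hcA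
        by_cases huA : u ∈ A
        · obtain ⟨B, huB, rfl⟩ : ∃ B, u ∉ B ∧ insert u B = A :=
            ⟨A.erase u, notMem_erase _ _, insert_erase huA⟩
          have hB := (insert_subset_insert_iff huB).1 hA
          have hCB := (subset_insert_iff_of_notMem huC).1 hCA
          rw [hinsert B hB (hcardC hCB)] at hT
          exact (disjoint_left.1 (hdisj B hB hCB hT.2 fun h => hcA (mem_insert_of_mem h))
            (hT.1 heE) heW).elim
        · rw [disjoint_insert_right]
          exact ⟨huA, hdisj A ((subset_insert_iff_of_notMem huA).1 hA) hCA hT hcA⟩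

lemma ncard_neighborSet_inter_insert_of_not_adj (h : ¬ G.Adj v u) :
    (G.neighborSet v ∩ ((insert u s : Finset V) : Set V)).ncard =
      (G.neighborSet v ∩ (s : Set V)).ncard := by
  rw [coe_insert, Set.inter_insert_of_notMem]
  exact h

lemma ncard_neighborSet_inter_erase_of_not_adj (h : ¬ G.Adj v u) :
    (G.neighborSet v ∩ ((s.erase u : Finset V) : Set V)).ncard =
      (G.neighborSet v ∩ (s : Set V)).ncard := by
  by_cases hu : u ∈ s
  · rw [← ncard_neighborSet_inter_insert_of_not_adj h, insert_erase hu]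
  · rw [erase_eq_of_notMem hu]

lemma ncard_neighborSet_inter_insert_of_adj (hu : u ∉ s) (h : G.Adj v u) :
    (G.neighborSet v ∩ ((insert u s : Finset V) : Set V)).ncard =
      (G.neighborSet v ∩ (s : Set V)).ncard + 1 := by
  rw [coe_insert, Set.inter_insert_of_mem (show u ∈ G.neighborSet v from h),
    Set.ncard_insert_of_notMem]
  exact fun h => hu h.2

lemma ncard_neighborSet_inter_of_isNClique (hs : G.IsNClique (k + 1) s) (hv : v ∈ s) :
    (G.neighborSet v ∩ (s : Set V)).ncard = k := by
  rw [ncard_neighborSet_inter_s18 (erase_subset v s), card_erase_of_mem hv, hs.card_eq,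
    Nat.add_sub_cancel]
  refine fun w hw => ⟨fun h => mem_erase.2 ⟨h.ne', hw⟩, fun h => ?_⟩
  exact hs.isClique hv hw (ne_of_mem_erase h).symm

lemma IsKTreeOn.le_ncard_neighborSet (hs : IsKTreeOn G k s) (hcard : k + 1 ≤ s.card)
    (hv : v ∈ s) : k ≤ (G.neighborSet v ∩ (s : Set V)).ncard := by
  obtain ⟨D, hD, hadj⟩ := exists_adj_iff_mem G v s
  rw [ncard_neighborSet_inter_s18 hD hadj]
  by_contra! h
  have := (hs.erase_of_card_le h.le hv (fun w hw => (hadj w hw).1) hcard).2.1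
  omega

lemma IsPathTypeOn.isKTreeOn (h : IsPathTypeOn G k s) : IsKTreeOn G k s := by
  induction h with
  | base₁ s h => exact .base s h
  | base₂ s h => exact isKTreeOn_of_isNClique_succ h
  | grow s v C _ _ hv hC hC' _ hadj ih => exact .grow s v C ih hv hC hC' hadj

/-- A path-type `k`-tree that is not complete has exactly two vertices of degree `k`; deleting
either leaves a path-type `k`-tree, and no proper sub-`k`-tree contains both. -/
lemma IsPathTypeOn.exists_leaves (hs : IsPathTypeOn G k s) (hcard : k + 2 ≤ s.card) :
    ∃ a ∈ s, ∃ b ∈ s, a ≠ b ∧ ¬ G.Adj a b ∧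
      (∀ v ∈ s, (G.neighborSet v ∩ (s : Set V)).ncard = k → v = a ∨ v = b) ∧
      (G.neighborSet a ∩ (s : Set V)).ncard = k ∧ (G.neighborSet b ∩ (s : Set V)).ncard = k ∧
      IsPathTypeOn G k (s.erase a) ∧ IsPathTypeOn G k (s.erase b) ∧
      ∀ A ⊆ s, IsKTreeOn G k A → a ∈ A → b ∈ A → A = s := by
  induction hs with
  | base₁ s h => have := h.card_eq; omega
  | base₂ s h => have := h.card_eq; omega
  | grow s u C hs hks hu hC hC' hl hadj ih =>
    have hdegu : (G.neighborSet u ∩ ((insert u s : Finset V) : Set V)).ncard = k := by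
      rw [ncard_neighborSet_inter_insert_of_not_adj (G.loopless.irrefl u),
        ncard_neighborSet_inter_s18 hC hadj, hC'.card_eq]
    -- a sub-`k`-tree containing `u` and a non-neighbour of `u` is obtained by attaching `u`
    have hsub : ∀ A ⊆ insert u s, IsKTreeOn G k A → u ∈ A → ∀ x ∈ A, x ≠ u → ¬ G.Adj u x →
        C ⊆ A.erase u ∧ IsKTreeOn G k (A.erase u) := by
      intro A hA hT huA x hx hxu hux
      have hk : k + 1 ≤ A.card := by
        by_contra! h
        have := hT.le_card
        exact hux ((hT.isNClique_of_card_eq (by omega)).isClique huA hx hxu.symm)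
      obtain ⟨h1, -, h3⟩ := hT.erase_of_card_le hC'.card_eq.le huA
        (fun w hw huw => (hadj w ((mem_insert.1 (hA hw)).resolve_left huw.ne')).1 huw) hk
      exact ⟨subset_erase.2 ⟨h1, fun h => hu (hC h)⟩, h3⟩
    by_cases hk : s.card = k + 1
    · have hcl := hs.isKTreeOn.isNClique_succ_of_card_eq hk
      obtain ⟨x, hx, hxC⟩ : ∃ x ∈ s, x ∉ C :=
        exists_mem_notMem_of_card_lt_card (by rw [hk, hC'.card_eq]; omega)
      have hCx : C = s.erase x := eq_of_subset_of_card_le (subset_erase.2 ⟨hC, hxC⟩)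
        (by rw [card_erase_of_mem hx, hk, hC'.card_eq]; simp)
      have hux : u ≠ x := fun h => hu (h ▸ hx)
      have huxa : ¬ G.Adj u x := fun h => hxC ((hadj x hx).1 h)
      refine ⟨u, mem_insert_self _ _, x, mem_insert_of_mem hx, hux, huxa, ?_, hdegu, ?_, ?_, ?_, ?_⟩
      · intro v hv hdeg
        by_contra! h
        have hvs := (mem_insert.1 hv).resolve_left h.1
        have huv : G.Adj v u := ((hadj v hvs).2 (hCx ▸ mem_erase.2 ⟨h.2, hvs⟩)).symm
        rw [ncard_neighborSet_inter_insert_of_adj hu huv,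
          ncard_neighborSet_inter_of_isNClique hcl hvs] at hdeg
        omega
      · rw [ncard_neighborSet_inter_insert_of_not_adj fun h => huxa h.symm,
          ncard_neighborSet_inter_of_isNClique hcl hx]
      · rwa [erase_insert hu]
      · rw [erase_insert_of_ne hux, ← hCx]
        exact .base₂ _ (hC'.insert fun w hw => (hadj w (hC hw)).2 hw)
      · intro A hA hT huA hxA
        obtain ⟨h1, -⟩ := hsub A hA hT huA x hxA hux.symm huxa
        refine hA.antisymm (insert_subset huA fun y hy => ?_)
        by_cases hyx : y = x
        · rwa [hyx]
        · exact mem_of_mem_erase (h1 (hCx ▸ mem_erase.2 ⟨hyx, hy⟩))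
    · obtain ⟨a, ha, b, hb, hab, haC, hnab, hleaf, hda, hdb, hpa, hpb, hall⟩ :
          ∃ a ∈ s, ∃ b ∈ s, a ≠ b ∧ a ∈ C ∧ ¬ G.Adj a b ∧
          (∀ v ∈ s, (G.neighborSet v ∩ (s : Set V)).ncard = k → v = a ∨ v = b) ∧
          (G.neighborSet a ∩ (s : Set V)).ncard = k ∧ (G.neighborSet b ∩ (s : Set V)).ncard = k ∧
          IsPathTypeOn G k (s.erase a) ∧ IsPathTypeOn G k (s.erase b) ∧
          ∀ A ⊆ s, IsKTreeOn G k A → a ∈ A → b ∈ A → A = s := by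
        obtain ⟨a, ha, b, hb, hab, hnab, hleaf, hda, hdb, hpa, hpb, hall⟩ := ih (by omega)
        obtain ⟨l, hlC, hl⟩ := hl
        rcases hleaf l (hC hlC) hl with rfl | rfl
        · exact ⟨l, ha, b, hb, hab, hlC, hnab, hleaf, hda, hdb, hpa, hpb, hall⟩
        · exact ⟨l, hb, a, ha, hab.symm, hlC, fun h => hnab h.symm,
            fun v hv h => (hleaf v hv h).symm, hdb, hda, hpb, hpa,
            fun A hA hT h1 h2 => hall A hA hT h2 h1⟩
      have hub : u ≠ b := fun h => hu (h ▸ hb)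
      have hbC : b ∉ C := fun h => hnab (hC'.isClique haC h hab)
      have hnub : ¬ G.Adj u b := fun h => hbC ((hadj b hb).1 h)
      refine ⟨u, mem_insert_self _ _, b, mem_insert_of_mem hb, hub, hnub, ?_, hdegu, ?_, ?_, ?_, ?_⟩
      · intro v hv hdeg
        by_contra! h
        have hvs := (mem_insert.1 hv).resolve_left h.1
        have hmin := hs.isKTreeOn.le_ncard_neighborSet hks hvs
        by_cases huv : G.Adj v u
        · rw [ncard_neighborSet_inter_insert_of_adj hu huv] at hdeg
          omega
        · rw [ncard_neighborSet_inter_insert_of_not_adj huv] at hdeg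
          obtain rfl := (hleaf v hvs hdeg).resolve_right h.2
          exact huv ((hadj v hvs).2 haC).symm
      · rwa [ncard_neighborSet_inter_insert_of_not_adj fun h => hnub h.symm]
      · rwa [erase_insert hu]
      · rw [erase_insert_of_ne hub]
        refine .grow _ u C hpb ?_ (fun h => hu (mem_of_mem_erase h)) (subset_erase.2 ⟨hC, hbC⟩) hC'
          ⟨a, haC, ?_⟩ fun w hw => hadj w (mem_of_mem_erase hw)
        · rw [card_erase_of_mem hb]; omega
        · rwa [ncard_neighborSet_inter_erase_of_not_adj hnab]
      · intro A hA hT huA hbA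
        obtain ⟨h1, h2⟩ := hsub A hA hT huA b hbA hub.symm hnub
        rw [← hall _ (by rwa [← subset_insert_iff]) h2 (h1 haC) (mem_erase.2 ⟨hub.symm, hbA⟩),
          insert_erase huA]

lemma IsPathTypeOn.eq_of_card_eq {B : Finset V} (hs : IsPathTypeOn G k s) (hv : v ∈ s)
    (hdeg : (G.neighborSet v ∩ (s : Set V)).ncard = k) (hAs : A ⊆ s) (hBs : B ⊆ s)
    (hA : IsKTreeOn G k A) (hB : IsKTreeOn G k B) (hvA : v ∈ A) (hvB : v ∈ B)
    (hk : k + 1 ≤ A.card) (hcard : A.card = B.card) : A = B := by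
  induction hn : s.card using Nat.strong_induction_on generalizing s with
  | _ n ih =>
    have hAs' := card_le_card hAs
    by_cases hks : s.card = k + 1
    · rw [eq_of_subset_of_card_le hAs (by omega), eq_of_subset_of_card_le hBs (by omega)]
    · obtain ⟨b, hb, hnvb, hpb, hall⟩ : ∃ b ∈ s, ¬ G.Adj v b ∧ IsPathTypeOn G k (s.erase b) ∧
          ∀ A ⊆ s, IsKTreeOn G k A → v ∈ A → b ∈ A ∨ v = b → A = s := by
        obtain ⟨a, ha, b, hb, hab, hnab, hleaf, -, -, hpa, hpb, hall⟩ :=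
          hs.exists_leaves (by omega)
        rcases hleaf v hv hdeg with rfl | rfl
        · exact ⟨b, hb, hnab, hpb, fun A hA hT h1 h2 => hall A hA hT h1 (h2.resolve_right hab)⟩
        · exact ⟨a, ha, fun h => hnab h.symm, hpa,
            fun A hA hT h1 h2 => hall A hA hT (h2.resolve_right hab.symm) h1⟩
      by_cases hbA : b ∈ A
      · have := hall A hAs hA hvA (.inl hbA)
        subst this
        exact (eq_of_subset_of_card_le hBs hcard.le).symm
      by_cases hbB : b ∈ B
      · have := hall B hBs hB hvB (.inl hbB)
        subst this
        exact eq_of_subset_of_card_le hAs hcard.ge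
      have hvb : v ≠ b := fun h => hbA (h ▸ hvA)
      refine ih _ ?_ hpb (mem_erase.2 ⟨hvb, hv⟩) ?_ (subset_erase.2 ⟨hAs, hbA⟩)
        (subset_erase.2 ⟨hBs, hbB⟩) rfl
      · rw [← hn]; exact card_erase_lt_of_mem hb
      · rwa [ncard_neighborSet_inter_erase_of_not_adj hnvb]

/-- If the sub-`k`-trees of `s` containing `C` have pairwise distinct orders, then attaching a new
vertex to `C` yields a path-type `k`-tree. -/
lemma IsKTreeOn.isPathTypeOn_insert (hk : 1 ≤ k) (hs : IsKTreeOn G k s) (hC : G.IsNClique k C)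
    (hCs : C ⊆ s) (hcs : c ∉ s) (hadj : ∀ w ∈ s, G.Adj c w ↔ w ∈ C)
    (hinj : ∀ A ⊆ s, ∀ B ⊆ s, C ⊆ A → C ⊆ B → IsKTreeOn G k A → IsKTreeOn G k B →
      A.card = B.card → A = B) : IsPathTypeOn G k (insert c s) := by
  induction hn : s.card using Nat.strong_induction_on generalizing s with
  | _ n ih =>
    have hcC : ∀ w ∈ C, G.Adj c w := fun w hw => (hadj w (hCs hw)).2 hw
    by_cases hks : s.card = k
    · rw [← eq_of_subset_of_card_le hCs (by rw [hks, hC.card_eq])]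
      exact .base₂ _ (hC.insert hcC)
    · have := hs.le_card
      obtain ⟨v, hv, hvC, hT, D, hD, hD', hDadj⟩ := hs.exists_erase hC hCs (by omega)
      have hCs' : C ⊆ s.erase v := subset_erase.2 ⟨hCs, hvC⟩
      have hcs' : c ∉ s.erase v := fun h => hcs (mem_of_mem_erase h)
      have hcv : c ≠ v := fun h => hcs (h ▸ hv)
      have hncv : ¬ G.Adj c v := fun h => hvC ((hadj v hv).1 h)
      have hs' := card_erase_of_mem hv
      have hp : IsPathTypeOn G k (insert c (s.erase v)) :=
        ih _ (by omega) hT hCs' hcs' (fun w hw => hadj w (mem_of_mem_erase hw))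
          (fun A hA B hB => hinj A (hA.trans (erase_subset _ _)) B (hB.trans (erase_subset _ _)))
          rfl
      have hins : insert c s = insert v (insert c (s.erase v)) := by
        rw [insert_comm, insert_erase hv]
      rw [hins]
      refine .grow _ v D hp ?_ ?_ (hD.trans (subset_insert _ _)) hD' ?_ ?_
      · rw [card_insert_of_notMem hcs']; omega
      · simp [hcv.symm]
      · by_cases hks' : (s.erase v).card = k
        · obtain ⟨l, hl⟩ : D.Nonempty := card_pos.1 (by rw [hD'.card_eq]; omega)
          have hCs'' := eq_of_subset_of_card_le hCs' (by rw [hks', hC.card_eq])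
          refine ⟨l, hl, ?_⟩
          rw [← hCs'']
          exact ncard_neighborSet_inter_of_isNClique (hC.insert hcC)
            (mem_insert_of_mem (hCs'' ▸ hD hl))
        · obtain ⟨x, hx, hxC, hT', E, hE, hE', hEadj⟩ := hT.exists_erase hC hCs' (by omega)
          have hxs := mem_of_mem_erase hx
          refine ⟨x, ?_, ?_⟩
          · by_contra hxD
            have hxv : x ≠ v := ne_of_mem_erase hx
            have hvn : v ∉ (s.erase v).erase x := by simp
            have heq := hinj (insert v ((s.erase v).erase x))
              (insert_subset hv ((erase_subset _ _).trans (erase_subset _ _)))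
              (s.erase v) (erase_subset _ _)
              ((subset_erase.2 ⟨hCs', hxC⟩).trans (subset_insert _ _)) hCs'
              (.grow _ v D hT' hvn (subset_erase.2 ⟨hD, hxD⟩) hD'
                fun w hw => hDadj w (mem_of_mem_erase hw)) hT
              (by rw [card_insert_of_notMem hvn, card_erase_add_one hx])
            exact notMem_erase v s (heq ▸ mem_insert_self _ _)
          · rw [ncard_neighborSet_inter_insert_of_not_adj
              (fun h => hxC ((hadj x hxs).1 h.symm)),
              ← ncard_neighborSet_inter_erase_of_not_adj (G.loopless.irrefl x),
              ncard_neighborSet_inter_s18 hE hEadj, hE'.card_eq]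
      · intro w hw
        rcases mem_insert.1 hw with rfl | hw
        · exact ⟨fun h => (hncv h.symm).elim, fun h => (hcs' (hD h)).elim⟩
        · exact hDadj w hw

end KTree

section Counting

variable {ι : Type*} {S : Finset ι} {f : ι → ℕ}

lemma exists_eq_of_le_of_forall_exists_pred
    (h : ∀ x ∈ S, f x ≠ 0 → ∃ y ∈ S, f y + 1 = f x) {x : ι} (hx : x ∈ S) {n : ℕ} (hn : n ≤ f x) :
    ∃ y ∈ S, f y = n := by
  induction hn using Nat.decreasingInduction with
  | self => exact ⟨x, hx, rfl⟩
  | of_succ m _ ih =>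
    obtain ⟨y, hy, hym⟩ := ih
    obtain ⟨z, hz, hzy⟩ := h y hy (by omega)
    exact ⟨z, hz, by omega⟩

/-- If the values of `f` on `S` form an initial segment of `ℕ`, then their sum is at most that of
`0, 1, …, #S - 1`, with equality exactly when `f` is injective on `S`. -/
lemma two_mul_sum_add_card_le [DecidableEq ι]
    (h : ∀ x ∈ S, f x ≠ 0 → ∃ y ∈ S, f y + 1 = f x) :
    2 * ∑ x ∈ S, f x + S.card ≤ S.card ^ 2 ∧
      (2 * ∑ x ∈ S, f x + S.card = S.card ^ 2 ↔ Set.InjOn f S) := by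
  induction S using Finset.induction_on_max_value f with
  | empty => simp
  | insert a S ha hmax ih =>
    have hS : ∀ x ∈ S, f x ≠ 0 → ∃ y ∈ S, f y + 1 = f x := by
      intro x hx hx0
      obtain ⟨y, hy, hyx⟩ := h x (mem_insert_of_mem hx) hx0
      refine ⟨y, (mem_insert.1 hy).resolve_left ?_, hyx⟩
      rintro rfl
      have := hmax x hx
      omega
    obtain ⟨ih1, ih2⟩ := ih hS
    have hle : f a ≤ S.card := by
      have : range (f a) ⊆ S.image f := by
        intro n hn
        rw [mem_range] at hn
        obtain ⟨y, hy, hyn⟩ := exists_eq_of_le_of_forall_exists_pred h (mem_insert_self a S) hn.le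
        refine mem_image.2 ⟨y, (mem_insert.1 hy).resolve_left ?_, hyn⟩
        rintro rfl
        omega
      simpa using (card_le_card this).trans card_image_le
    have hlt : ∀ x ∈ S, f x < S.card := by
      intro x hx
      have : range (f x + 1) ⊆ S.image f := by
        intro n hn
        rw [mem_range] at hn
        obtain ⟨y, hy, hyn⟩ := exists_eq_of_le_of_forall_exists_pred hS hx (Nat.le_of_lt_succ hn)
        exact mem_image.2 ⟨y, hy, hyn⟩
      have := (card_le_card this).trans card_image_le
      simp at this
      omega
    rw [sum_insert ha, card_insert_of_notMem ha, coe_insert,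
      Set.injOn_insert (by simpa using ha), ← ih2]
    refine ⟨by nlinarith, fun heq => ⟨by nlinarith, ?_⟩, fun ⟨h1, h2⟩ => ?_⟩
    · rintro ⟨x, hx, hxa⟩
      have := hlt x hx
      nlinarith
    · have : S.image f ⊆ range (f a) := by
        intro n hn
        obtain ⟨x, hx, rfl⟩ := mem_image.1 hn
        exact mem_range.2 (lt_of_le_of_ne (hmax x hx) fun h => h2 ⟨x, hx, h⟩)
      have := card_le_card this
      rw [card_image_of_injOn (ih2.1 h1), card_range] at this
      nlinarith

end Counting

section MeanOrder

variable [Fintype V] [DecidableEq V] {G : SimpleGraph V} {k : ℕ} {C Q W : Finset V} {c : V}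

lemma mem_subKTrees {A : Finset V} : A ∈ subKTrees G k C ↔ C ⊆ A ∧ IsKTreeOn G k A := by
  simp [subKTrees]

lemma cliqueDeg_eq_one_iff (hCQ : C ⊆ Q) (hQ : G.IsNClique (k + 1) Q) :
    cliqueDeg G k C = 1 ↔ ∀ Q', C ⊆ Q' → G.IsNClique (k + 1) Q' → Q' = Q := by
  classical
  rw [cliqueDeg, card_eq_one]
  constructor
  · rintro ⟨R, hR⟩ Q' h1 h2
    replace hR := Finset.ext_iff.1 hR
    simp only [mem_filter, mem_univ, true_and, mem_singleton] at hR
    rw [(hR Q').1 ⟨h1, h2⟩, (hR Q).1 ⟨hCQ, hQ⟩]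
  · intro h
    refine ⟨Q, ?_⟩
    ext Q'
    simp only [mem_filter, mem_univ, true_and, mem_singleton]
    exact ⟨fun h' => h Q' h'.1 h'.2, by rintro rfl; exact ⟨hCQ, hQ⟩⟩

lemma kMean_eq (h : (subKTrees G k C).Nonempty) :
    kMean G k C = k + ((∑ A ∈ subKTrees G k C, (A.card - k) : ℕ) : ℝ) / (subKTrees G k C).card := by
  have h0 : ((subKTrees G k C).card : ℝ) ≠ 0 := by exact_mod_cast (card_pos.2 h).ne'
  have h1 : ∑ A ∈ subKTrees G k C, (A.card : ℝ) =
      ∑ A ∈ subKTrees G k C, (k + ((A.card - k : ℕ) : ℝ)) := by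
    refine sum_congr rfl fun A hA => ?_
    rw [Nat.cast_sub (mem_subKTrees.1 hA).2.le_card]
    ring
  rw [kMean, h1, sum_add_distrib, sum_const, nsmul_eq_mul, add_div, mul_div_cancel_left₀ _ h0,
    Nat.cast_sum]

lemma sum_filter_mem_eq_sum_product {M : Type*} [AddCommMonoid M] (hcW : c ∈ W)
    (hWC : Disjoint W C)
    (hprod : ∀ A, C ⊆ A →
      (IsKTreeOn G k A ↔ IsKTreeOn G k (A \ W) ∧ IsKTreeOn G k (A ∩ (W ∪ C))))
    (hdisj : ∀ A, C ⊆ A → IsKTreeOn G k A → c ∉ A → Disjoint A W) (g : Finset V → M) :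
    ∑ B ∈ subKTrees G k C with c ∈ B, g B =
      ∑ p ∈ {A ∈ subKTrees G k C | c ∉ A} ×ˢ {A ∈ subKTrees G k C | c ∈ A ∧ A ⊆ W ∪ C},
        g (p.1 ∪ p.2) := by
  have hsplit : ∀ B : Finset V, C ⊆ B → B \ W ∪ B ∩ (W ∪ C) = B := by
    intro B hB
    ext x
    simp only [mem_union, mem_sdiff, mem_inter]
    tauto
  have hfst : ∀ A R : Finset V, C ⊆ A → Disjoint A W → R ⊆ W ∪ C → (A ∪ R) \ W = A := by
    intro A R hA hAW hR
    ext x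
    have h1 : x ∈ A → x ∉ W := fun h => disjoint_left.1 hAW h
    have h2 : x ∈ R → x ∈ W ∨ x ∈ C := fun h => mem_union.1 (hR h)
    have h3 : x ∈ C → x ∈ A := fun h => hA h
    simp only [mem_union, mem_sdiff]
    tauto
  have hsnd : ∀ A R : Finset V, C ⊆ R → Disjoint A W → R ⊆ W ∪ C → (A ∪ R) ∩ (W ∪ C) = R := by
    intro A R hA hAW hR
    ext x
    have h1 : x ∈ A → x ∉ W := fun h => disjoint_left.1 hAW h
    have h2 : x ∈ R → x ∈ W ∨ x ∈ C := fun h => mem_union.1 (hR h)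
    have h3 : x ∈ C → x ∈ R := fun h => hA h
    simp only [mem_union, mem_inter]
    tauto
  refine sum_nbij' (fun B => (B \ W, B ∩ (W ∪ C))) (fun p => p.1 ∪ p.2) ?_ ?_ ?_ ?_ ?_
  · intro B hB
    simp only [mem_filter, mem_product, mem_subKTrees] at hB ⊢
    have := (hprod B hB.1.1).1 hB.1.2
    exact ⟨⟨⟨subset_sdiff.2 ⟨hB.1.1, hWC.symm⟩, this.1⟩, fun h => (mem_sdiff.1 h).2 hcW⟩,
      ⟨subset_inter hB.1.1 subset_union_right, this.2⟩,
      mem_inter.2 ⟨hB.2, mem_union_left _ hcW⟩, inter_subset_right⟩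
  · rintro ⟨A, R⟩ h
    simp only [mem_filter, mem_product, mem_subKTrees] at h ⊢
    obtain ⟨⟨⟨hCA, hA⟩, hcA⟩, ⟨hCR, hR⟩, hcR, hRW⟩ := h
    have hAW := hdisj A hCA hA hcA
    refine ⟨⟨hCA.trans subset_union_left, ?_⟩, mem_union_right _ hcR⟩
    rw [hprod _ (hCA.trans subset_union_left), hfst A R hCA hAW hRW, hsnd A R hCR hAW hRW]
    exact ⟨hA, hR⟩
  · intro B hB
    simp only [mem_filter, mem_subKTrees] at hB
    exact hsplit B hB.1.1
  · rintro ⟨A, R⟩ h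
    simp only [mem_filter, mem_product, mem_subKTrees] at h
    obtain ⟨⟨⟨hCA, hA⟩, hcA⟩, ⟨hCR, hR⟩, hcR, hRW⟩ := h
    have hAW := hdisj A hCA hA hcA
    exact Prod.ext (hfst A R hCA hAW hRW) (hsnd A R hCR hAW hRW)
  · intro B hB
    simp only [mem_filter, mem_subKTrees] at hB
    rw [hsplit B hB.1.1]

lemma subKTrees_eq_insert_of_cliqueDeg_eq_one {C₁ : Finset V} (hC₁ : G.IsNClique k C₁)
    (hQ : G.IsNClique (k + 1) (insert c C)) (hC₁Q : C₁ ⊆ insert c C)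
    (hend : cliqueDeg G k C₁ = 1) :
    subKTrees G k C₁ = insert C₁ {B ∈ subKTrees G k C | c ∈ B} := by
  ext A
  simp only [mem_insert, mem_filter, mem_subKTrees]
  constructor
  · rintro ⟨hC₁A, hA⟩
    obtain hk | hk := (hC₁.card_eq ▸ card_le_card hC₁A : k ≤ A.card).eq_or_lt'
    · exact .inl (eq_of_subset_of_card_le hC₁A (by rw [hk, hC₁.card_eq])).symm
    · obtain ⟨Q, hQA, hCQ, hQ'⟩ := hA.exists_isNClique_succ hC₁ hC₁A hk
      obtain rfl := (cliqueDeg_eq_one_iff hC₁Q hQ).1 hend Q hCQ hQ'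
      exact .inr ⟨⟨(subset_insert _ _).trans hQA, hA⟩, hQA (mem_insert_self _ _)⟩
  · rintro (rfl | ⟨⟨hCA, hA⟩, hcA⟩)
    · exact ⟨subset_rfl, .base _ hC₁⟩
    · exact ⟨hC₁Q.trans (insert_subset hcA hCA), hA⟩

lemma card_filter_notMem_eq_one_iff (hC : G.IsNClique k C) (hc : c ∉ C)
    (hQ : G.IsNClique (k + 1) (insert c C)) :
    ({A ∈ subKTrees G k C | c ∉ A}).card = 1 ↔ cliqueDeg G k C = 1 := by
  have hCmem : C ∈ {A ∈ subKTrees G k C | c ∉ A} :=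
    mem_filter.2 ⟨mem_subKTrees.2 ⟨subset_rfl, .base _ hC⟩, hc⟩
  rw [cliqueDeg_eq_one_iff (subset_insert c C) hQ, card_eq_one]
  constructor
  · rintro ⟨X, hX⟩ Q hCQ hQ'
    by_cases hcQ : c ∈ Q
    · exact (eq_of_subset_of_card_le (insert_subset hcQ hCQ) (by rw [hQ.card_eq, hQ'.card_eq])).symm
    · have h1 : Q ∈ {A ∈ subKTrees G k C | c ∉ A} :=
        mem_filter.2 ⟨mem_subKTrees.2 ⟨hCQ, isKTreeOn_of_isNClique_succ hQ'⟩, hcQ⟩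
      rw [hX, mem_singleton] at h1 hCmem
      have := hQ'.card_eq
      rw [h1, ← hCmem, hC.card_eq] at this
      omega
  · refine fun h => ⟨C, eq_singleton_iff_unique_mem.2 ⟨hCmem, fun A hA => ?_⟩⟩
    simp only [mem_filter, mem_subKTrees] at hA
    obtain hk | hk := (hC.card_eq ▸ card_le_card hA.1.1 : k ≤ A.card).eq_or_lt'
    · exact (eq_of_subset_of_card_le hA.1.1 (by rw [hk, hC.card_eq])).symm
    · obtain ⟨Q, hQA, hCQ, hQ'⟩ := hA.1.2.exists_isNClique_succ hC hA.1.1 hk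
      exact (hA.2 (hQA (h Q hCQ hQ' ▸ mem_insert_self _ _))).elim

lemma exists_card_sub_add_one_eq (hC : G.IsNClique k C) {A : Finset V}
    (hA : A ∈ {A ∈ subKTrees G k C | c ∉ A}) (hAk : A.card - k ≠ 0) :
    ∃ B ∈ {A ∈ subKTrees G k C | c ∉ A}, B.card - k + 1 = A.card - k := by
  simp only [mem_filter, mem_subKTrees] at hA ⊢
  obtain ⟨v, hv, hvC, hT, -⟩ := hA.1.2.exists_erase hC hA.1.1 (by omega)
  refine ⟨A.erase v, ⟨⟨subset_erase.2 ⟨hA.1.1, hvC⟩, hT⟩, fun h => hA.2 (mem_of_mem_erase h)⟩, ?_⟩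
  rw [card_erase_of_mem hv]
  omega

/-- The side of `c` is trivial and the sub-`k`-trees on the other side have distinct orders exactly
when the `k`-tree is of path type with `c` a vertex of degree `k`. -/
lemma card_eq_one_and_injOn_iff_isPathTypeOn (hk : 1 ≤ k) (hG : IsKTree G k) (hC : G.IsNClique k C)
    (hcC : c ∉ C) (hQ : G.IsNClique (k + 1) (insert c C)) (hcW : c ∈ W) (hWC : Disjoint W C)
    (hsep : ∀ x ∈ W, ∀ y, y ∉ W → y ∉ C → ¬ G.Adj x y)
    (hprod : ∀ A, C ⊆ A →
      (IsKTreeOn G k A ↔ IsKTreeOn G k (A \ W) ∧ IsKTreeOn G k (A ∩ (W ∪ C))))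
    (hdisj : ∀ A, C ⊆ A → IsKTreeOn G k A → c ∉ A → Disjoint A W) :
    ({A ∈ subKTrees G k C | c ∈ A ∧ A ⊆ W ∪ C}.card = 1 ∧
      Set.InjOn (fun A : Finset V => A.card - k)
        ({A ∈ subKTrees G k C | c ∉ A} : Finset (Finset V))) ↔
    IsPathTypeOn G k univ ∧ (G.neighborSet c).ncard = k := by
  have hcadj : ∀ w ∈ C, G.Adj c w := fun w hw =>
    hQ.isClique (mem_insert_self _ _) (mem_insert_of_mem hw) fun h => hcC (h ▸ hw)
  have hcoe : ((univ : Finset V) : Set V) = Set.univ := coe_univ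
  rw [← Set.inter_univ (G.neighborSet c), ← hcoe]
  have huniv := (hprod univ (subset_univ C)).1 hG
  constructor
  · rintro ⟨hR, hinj⟩
    obtain ⟨X, hX⟩ := card_eq_one.1 hR
    replace hX := Finset.ext_iff.1 hX
    simp only [mem_filter, mem_subKTrees, mem_singleton] at hX
    have h1 := (hX (insert c C)).1 ⟨⟨subset_insert _ _, isKTreeOn_of_isNClique_succ hQ⟩,
      mem_insert_self _ _, insert_subset (mem_union_left _ hcW) subset_union_right⟩
    have h2 := (hX (W ∪ C)).1 ⟨⟨subset_union_right, by simpa using huniv.2⟩,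
      mem_union_left _ hcW, subset_rfl⟩
    have hW : W = {c} := by
      refine eq_singleton_iff_unique_mem.2 ⟨hcW, fun x hx => ?_⟩
      have : x ∈ insert c C := (h1.trans h2.symm) ▸ mem_union_left C hx
      exact (mem_insert.1 this).resolve_right (disjoint_left.1 hWC hx)
    subst hW
    have hadj : ∀ w, G.Adj c w ↔ w ∈ C := fun w => ⟨fun h => by
      by_contra hw
      exact hsep c hcW w (by simpa using h.ne') hw h, hcadj w⟩
    constructor
    · rw [← insert_erase (mem_univ c), ← sdiff_singleton_eq_erase]
      refine huniv.1.isPathTypeOn_insert hk hC (subset_sdiff.2 ⟨subset_univ _, hWC.symm⟩) (by simp)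
        (fun w _ => hadj w) fun A hA B hB hCA hCB hTA hTB hcard => hinj ?_ ?_ ?_
      · simp only [coe_filter, Set.mem_ofPred_eq, mem_subKTrees]
        exact ⟨⟨hCA, hTA⟩, fun h => by simpa using hA h⟩
      · simp only [coe_filter, Set.mem_ofPred_eq, mem_subKTrees]
        exact ⟨⟨hCB, hTB⟩, fun h => by simpa using hB h⟩
      · simp [hcard]
    · rw [ncard_neighborSet_inter_s18 (subset_univ C) fun w _ => hadj w, hC.card_eq]
  · rintro ⟨hpath, hdeg⟩
    obtain ⟨D, -, hD, hDk⟩ := exists_nbhd_of_ncard_eq hdeg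
    obtain rfl : C = D := eq_of_subset_of_card_le
      (fun w hw => (hD w (mem_univ w)).1 (hcadj w hw)) (by rw [hC.card_eq, hDk])
    have hcard : k + 1 ≤ (univ : Finset V).card := hQ.card_eq ▸ card_le_univ _
    obtain ⟨-, -, hT⟩ := IsKTreeOn.erase_of_card_le hG hDk.le (mem_univ c)
      (fun w hw => (hD w hw).1) hcard
    have hW : W = {c} := by
      refine eq_singleton_iff_unique_mem.2 ⟨hcW, fun x hx => ?_⟩
      by_contra hxc
      exact disjoint_left.1 (hdisj _ (subset_erase.2 ⟨subset_univ _, hcC⟩) hT (notMem_erase _ _))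
        (mem_erase.2 ⟨hxc, mem_univ x⟩) hx
    subst hW
    constructor
    · refine card_eq_one.2 ⟨insert c C, eq_singleton_iff_unique_mem.2 ⟨?_, fun A hA => ?_⟩⟩
      · simp only [mem_filter, mem_subKTrees]
        exact ⟨⟨subset_insert _ _, isKTreeOn_of_isNClique_succ hQ⟩, mem_insert_self _ _, subset_rfl⟩
      · simp only [mem_filter, mem_subKTrees] at hA
        exact hA.2.2.antisymm (insert_subset hA.2.1 hA.1.1)
    · intro A hA B hB hAB
      simp only [coe_filter, Set.mem_ofPred_eq, mem_subKTrees] at hA hB hAB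
      have hins : ∀ A, (C ⊆ A ∧ IsKTreeOn G k A) ∧ c ∉ A → IsKTreeOn G k (insert c A) :=
        fun A h => .grow A c C h.1.2 h.2 h.1.1 hC fun w _ => hD w (mem_univ w)
      have hAk := hA.1.2.le_card
      have hBk := hB.1.2.le_card
      have := hpath.eq_of_card_eq (mem_univ c) hdeg (subset_univ _) (subset_univ _) (hins A hA)
        (hins B hB) (mem_insert_self _ _) (mem_insert_self _ _)
        (by rw [card_insert_of_notMem hA.2]; omega)
        (by rw [card_insert_of_notMem hA.2, card_insert_of_notMem hB.2]; omega)
      rw [← erase_insert hA.2, this, erase_insert hB.2]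

lemma mean_ge_and_eq_iff {κ a σ R t : ℝ} (ha : 1 ≤ a) (hσ : 0 ≤ σ) (hσa : 2 * σ + a ≤ a ^ 2)
    (hR : 1 ≤ R) (ht : R ≤ t) (ht1 : R = 1 → t = 1) :
    κ + (R * σ + a * t) / (1 + a * R) ≥ κ + (σ + (R * σ + a * t)) / (a + a * R) ∧
      (κ + (R * σ + a * t) / (1 + a * R) = κ + (σ + (R * σ + a * t)) / (a + a * R) ↔
        a = 1 ∨ (R = 1 ∧ 2 * σ + a = a ^ 2)) := by
  have h1 : 0 < 1 + a * R := by positivity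
  have h2 : 0 < a + a * R := by positivity
  have hdiff : (R * σ + a * t) / (1 + a * R) - (σ + (R * σ + a * t)) / (a + a * R) =
      (2 * a * (a - 1) * (t - R) + a * (a - 1) * (R - 1) + (R + 1) * (a ^ 2 - a - 2 * σ)) /
        (2 * ((1 + a * R) * (a + a * R))) := by
    field_simp
    ring
  have p1 : 0 ≤ 2 * a * (a - 1) * (t - R) :=
    mul_nonneg (mul_nonneg (by linarith) (by linarith)) (by linarith)
  have p2 : 0 ≤ a * (a - 1) * (R - 1) :=
    mul_nonneg (mul_nonneg (by linarith) (by linarith)) (by linarith)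
  have p3 : 0 ≤ (R + 1) * (a ^ 2 - a - 2 * σ) := mul_nonneg (by linarith) (by linarith)
  constructor
  · have : 0 ≤ (R * σ + a * t) / (1 + a * R) - (σ + (R * σ + a * t)) / (a + a * R) := by
      rw [hdiff]; positivity
    linarith
  · rw [add_right_inj, ← sub_eq_zero, hdiff, div_eq_zero_iff, or_iff_left (by positivity)]
    constructor
    · intro h
      have q2 : a * (a - 1) * (R - 1) = 0 := by linarith
      have q3 : (R + 1) * (a ^ 2 - a - 2 * σ) = 0 := by linarith
      have q3' := (mul_eq_zero.1 q3).resolve_left (by linarith)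
      rcases mul_eq_zero.1 q2 with h' | h'
      · exact .inl (by linarith [(mul_eq_zero.1 h').resolve_left (by linarith)])
      · exact .inr ⟨by linarith, by linarith⟩
    · rintro (rfl | ⟨rfl, h⟩)
      · have : σ = 0 := by linarith
        subst this
        ring
      · rw [ht1 rfl, ← h]
        ring

end MeanOrder

/-- Let `C₁` be an end `k`-clique of a `k`-tree `T` (contained in
exactly one `(k+1)`-clique) and `C₂` a `k`-clique adjacent to `C₁`.  Then
`μ(T; C₁) ≥ μ(T; C₂)`, with equality iff `C₂` is also an end `k`-clique, or `T` is a
path-type `k`-tree and `C₁` contains a `k`-leaf. -/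
theorem end_clique_kMean_ge {V : Type*} [Fintype V] [DecidableEq V]
    (k : ℕ) (hk : 1 ≤ k) (G : SimpleGraph V) (hG : IsKTree G k)
    (C₁ C₂ : Finset V) (hC₁ : G.IsNClique k C₁) (hC₂ : G.IsNClique k C₂)
    (hend : cliqueDeg G k C₁ = 1) (hadj : CliqueAdj G k C₁ C₂) :
    kMean G k C₁ ≥ kMean G k C₂ ∧
      (kMean G k C₁ = kMean G k C₂ ↔
        cliqueDeg G k C₂ = 1 ∨
          (IsPathTypeOn G k Finset.univ ∧ ∃ v ∈ C₁, (G.neighborSet v).ncard = k)) := by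
  obtain ⟨hne, Q, hQ, hC₁Q, hC₂Q⟩ := hadj
  obtain ⟨c, hcQ, hcC₂⟩ : ∃ c ∈ Q, c ∉ C₂ :=
    exists_mem_notMem_of_card_lt_card (by rw [hQ.card_eq, hC₂.card_eq]; omega)
  obtain rfl : insert c C₂ = Q := eq_of_subset_of_card_le (insert_subset hcQ hC₂Q)
    (by rw [card_insert_of_notMem hcC₂, hQ.card_eq, hC₂.card_eq])
  have hcC₁ : c ∈ C₁ := by
    by_contra h
    exact hne (eq_of_subset_of_card_le ((subset_insert_iff_of_notMem h).1 hC₁Q)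
      (by rw [hC₁.card_eq, hC₂.card_eq]))
  have hcadj : ∀ w ∈ C₂, G.Adj c w := fun w hw =>
    hQ.isClique hcQ (mem_insert_of_mem hw) fun h => hcC₂ (h ▸ hw)
  obtain ⟨W, -, hcW, hWC, hsep, hprod, hdisj⟩ := IsKTreeOn.exists_branch hG hC₂ (subset_univ _)
    (mem_univ c) hcC₂ hcadj
  replace hsep := fun x hx y => hsep x hx y (mem_univ y)
  replace hprod := fun A => hprod A (subset_univ A)
  replace hdisj := fun A => hdisj A (subset_univ A)
  set 𝒜 := {A ∈ subKTrees G k C₂ | c ∉ A} with h𝒜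
  set 𝒬 := {A ∈ subKTrees G k C₂ | c ∈ A} with h𝒬
  set ℛ := {A ∈ subKTrees G k C₂ | c ∈ A ∧ A ⊆ W ∪ C₂} with hℛ
  have hsum {M : Type} [AddCommMonoid M] (g : Finset V → M) :
      ∑ B ∈ 𝒬, g B = ∑ p ∈ 𝒜 ×ˢ ℛ, g (p.1 ∪ p.2) :=
    sum_filter_mem_eq_sum_product hcW hWC hprod hdisj g
  have hQmem : insert c C₂ ∈ ℛ := by
    simp only [hℛ, mem_filter, mem_subKTrees]
    exact ⟨⟨hC₂Q, isKTreeOn_of_isNClique_succ hQ⟩, hcQ,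
      insert_subset (mem_union_left _ hcW) subset_union_right⟩
  have hC₂mem : C₂ ∈ 𝒜 := mem_filter.2 ⟨mem_subKTrees.2 ⟨subset_rfl, .base _ hC₂⟩, hcC₂⟩
  have hC₁mem : C₁ ∈ subKTrees G k C₁ := mem_subKTrees.2 ⟨subset_rfl, .base _ hC₁⟩
  have hcardQ : 𝒬.card = 𝒜.card * ℛ.card := by
    rw [card_eq_sum_ones, hsum, ← card_eq_sum_ones, card_product]
  have hsumQ : ∑ B ∈ 𝒬, (B.card - k) =
      ℛ.card * ∑ A ∈ 𝒜, (A.card - k) + 𝒜.card * ∑ R ∈ ℛ, (R.card - k) := by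
    have : ∀ p ∈ 𝒜 ×ˢ ℛ, (p.1 ∪ p.2).card - k = (p.1.card - k) + (p.2.card - k) := by
      rintro ⟨A, R⟩ h
      simp only [h𝒜, hℛ, mem_product, mem_filter, mem_subKTrees] at h
      obtain ⟨⟨⟨hCA, hA⟩, hcA⟩, ⟨hCR, hR⟩, hcR, hRW⟩ := h
      have hAR : A ∩ R = C₂ := by
        refine (subset_inter hCA hCR).antisymm' fun x hx => ?_
        rw [mem_inter] at hx
        exact (mem_union.1 (hRW hx.2)).resolve_left
          (disjoint_left.1 (hdisj A hCA hA hcA) hx.1)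
      have h1 := card_union_add_card_inter A R
      rw [hAR, hC₂.card_eq] at h1
      have := hA.le_card
      have := hR.le_card
      dsimp only
      omega
    rw [hsum, sum_congr rfl this, sum_product, mul_sum]
    simp only [sum_add_distrib, sum_const, smul_eq_mul]
  have hsub₁ : subKTrees G k C₁ = insert C₁ 𝒬 :=
    subKTrees_eq_insert_of_cliqueDeg_eq_one hC₁ hQ hC₁Q hend
  have hC₁𝒬 : C₁ ∉ 𝒬 := fun h => by
    simp only [h𝒬, mem_filter, mem_subKTrees] at h
    exact hne (eq_of_subset_of_card_le h.1.1 (by rw [hC₁.card_eq, hC₂.card_eq])).symm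
  have hcard₁ : (subKTrees G k C₁).card = 1 + 𝒜.card * ℛ.card := by
    rw [hsub₁, card_insert_of_notMem hC₁𝒬, hcardQ, add_comm]
  have hsum₁ : ∑ A ∈ subKTrees G k C₁, (A.card - k) = ∑ B ∈ 𝒬, (B.card - k) := by
    rw [hsub₁, sum_insert hC₁𝒬, hC₁.card_eq, Nat.sub_self, zero_add]
  have hcard₂ : (subKTrees G k C₂).card = 𝒜.card + 𝒜.card * ℛ.card := by
    rw [← hcardQ, add_comm, h𝒬, h𝒜, card_filter_add_card_filter_not]
  have hsum₂ : ∑ A ∈ subKTrees G k C₂, (A.card - k) =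
      ∑ A ∈ 𝒜, (A.card - k) + ∑ B ∈ 𝒬, (B.card - k) := by
    rw [add_comm, h𝒬, h𝒜, sum_filter_add_sum_filter_not]
  obtain ⟨hσ, hσeq⟩ := two_mul_sum_add_card_le (S := 𝒜) (f := fun A => A.card - k)
    fun A hA => exists_card_sub_add_one_eq hC₂ hA
  have hRt : ℛ.card ≤ ∑ R ∈ ℛ, (R.card - k) := by
    rw [card_eq_sum_ones]
    refine sum_le_sum fun R hR => ?_
    simp only [hℛ, mem_filter, mem_subKTrees] at hR
    have := card_le_card (insert_subset hR.2.1 hR.1.1)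
    rw [hQ.card_eq] at this
    omega
  have hRt1 : ℛ.card = 1 → ∑ R ∈ ℛ, (R.card - k) = 1 := by
    intro h
    obtain ⟨X, hX⟩ := card_eq_one.1 h
    rw [hX, mem_singleton] at hQmem
    rw [hX, sum_singleton, ← hQmem, hQ.card_eq]
    omega
  obtain ⟨hge, heq⟩ := mean_ge_and_eq_iff (κ := (k : ℝ)) (a := 𝒜.card)
    (σ := (∑ A ∈ 𝒜, (A.card - k) : ℕ)) (R := ℛ.card) (t := (∑ R ∈ ℛ, (R.card - k) : ℕ))
    (by exact_mod_cast card_pos.2 ⟨_, hC₂mem⟩) (Nat.cast_nonneg _) (by exact_mod_cast hσ)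
    (by exact_mod_cast card_pos.2 ⟨_, hQmem⟩) (by exact_mod_cast hRt) (by exact_mod_cast hRt1)
  have hmean₁ := kMean_eq ⟨_, hC₁mem⟩
  have hmean₂ := kMean_eq ⟨_, (mem_filter.1 hC₂mem).1⟩
  rw [hsum₁, hcard₁, hsumQ] at hmean₁
  rw [hsum₂, hcard₂, hsumQ] at hmean₂
  push_cast at hmean₁ hmean₂ hge heq
  rw [← hmean₁, ← hmean₂] at hge heq
  refine ⟨hge, heq.trans ?_⟩
  have hone : (𝒜.card : ℝ) = 1 ↔ cliqueDeg G k C₂ = 1 := by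
    rw [← card_filter_notMem_eq_one_iff hC₂ hcC₂ hQ]
    norm_cast
  have hpath : (ℛ.card = 1 ∧ Set.InjOn (fun A : Finset V => A.card - k) 𝒜) ↔
      IsPathTypeOn G k univ ∧ (G.neighborSet c).ncard = k :=
    card_eq_one_and_injOn_iff_isPathTypeOn hk hG hC₂ hcC₂ hQ hcW hWC hsep hprod hdisj
  rw [← hσeq] at hpath
  rw [hone, show ((ℛ.card : ℝ) = 1 ∧ (2 : ℝ) * ∑ A ∈ 𝒜, ((A.card - k : ℕ) : ℝ) + 𝒜.card =
      (𝒜.card : ℝ) ^ 2) ↔ _ by exact_mod_cast hpath]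
  constructor
  · rintro (h | ⟨h1, h2⟩)
    · exact .inl h
    · exact .inr ⟨h1, c, hcC₁, h2⟩
  · rintro (h | ⟨h1, v, hv, h2⟩)
    · exact .inl h
    · by_cases hvC₂ : v ∈ C₂
      · refine .inl ((cliqueDeg_eq_one_iff hC₂Q hQ).2 fun Q hCQ hQ' => ?_)
        rw [← Set.inter_univ (G.neighborSet v), ← coe_univ] at h2
        obtain ⟨D, -, hD, hDk⟩ := exists_nbhd_of_ncard_eq h2
        have hnbhd : ∀ {P : Finset V}, G.IsNClique (k + 1) P → v ∈ P → P = insert v D := by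
          intro P hP hvP
          rw [← eq_of_subset_of_card_le (s := P.erase v) (t := D) ?_ ?_, insert_erase hvP]
          · exact fun w hw => (hD w (mem_univ w)).1
              (hP.isClique hvP (mem_of_mem_erase hw) (ne_of_mem_erase hw).symm)
          · rw [card_erase_of_mem hvP, hP.card_eq, hDk, Nat.add_sub_cancel]
        rw [hnbhd hQ' (hCQ hvC₂), ← hnbhd hQ (hC₂Q hvC₂)]
      · obtain rfl := (mem_insert.1 (hC₁Q hv)).resolve_right hvC₂
        exact .inr ⟨h1, h2⟩
end
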